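/- Let m ≥ 3, n ≥ 3 and let a₀, a₁, …, aₙ be rational integers with a₀ ≠ 0 such that the polynomial a₀·Xⁿ + a₁·X^(n−1) + ⋯ + aₙ has at least two simple complex zeroes, and set H = max{|a₀|, …, |aₙ|}. Then all rational integers x, y with y^m = a₀·xⁿ + a₁·x^(n−1) + ⋯ + aₙ satisfy max{|x|, |y|} < exp(exp((5m)^10·(n^(10n)·H)^(n²))). -/

import Mathlib

section

open NumberField Module

theorem exists_mem_ideal_place_lt {K : Type*} [Field K] [NumberField K]
    (I : Ideal (𝓞 K)) (hI : I ≠ ⊥) (f : InfinitePlace K → ℝ) (hf : ∀ w, 0 < f w)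
    (h : (Ideal.absNorm I : ℝ) * √|(discr K : ℝ)| < ∏ w, f w ^ w.mult) :
    ∃ a ∈ I, a ≠ 0 ∧ ∀ w : InfinitePlace K, w (a : K) < f w := by
  classical
  let J : (FractionalIdeal (nonZeroDivisors (𝓞 K)) K)ˣ :=
    Units.mk0 (I : FractionalIdeal (nonZeroDivisors (𝓞 K)) K)
      (by simpa using hI)
  let g : InfinitePlace K → NNReal := fun w => ⟨f w, (hf w).le⟩
  have hlt : mixedEmbedding.minkowskiBound K J <
      MeasureTheory.volume (mixedEmbedding.convexBodyLT K g) := by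
    rw [mixedEmbedding.convexBodyLT_volume, mixedEmbedding.minkowskiBound,
      mixedEmbedding.volume_fundamentalDomain_fractionalIdealLatticeBasis,
      mixedEmbedding.volume_fundamentalDomain_latticeBasis]
    have h2 : (2 : ENNReal)⁻¹ ^ InfinitePlace.nrComplexPlaces K =
        ((2⁻¹ ^ InfinitePlace.nrComplexPlaces K : NNReal) : ENNReal) := by
      push_cast; norm_num
    have h3 : ENNReal.ofReal ((FractionalIdeal.absNorm J.1 : ℚ) : ℝ) =
        ((Ideal.absNorm I : NNReal) : ENNReal) := by
      simp [J, FractionalIdeal.coeIdeal_absNorm]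
    rw [h2, h3]
    rw [mixedEmbedding.finrank]
    have h4 : finrank ℚ K = InfinitePlace.nrRealPlaces K + 2 * InfinitePlace.nrComplexPlaces K :=
      (InfinitePlace.card_add_two_mul_card_eq_rank K).symm
    rw [h4]
    rw [show (2 : ENNReal) = ((2 : NNReal) : ENNReal) from rfl]
    norm_cast
    rw [← NNReal.coe_lt_coe]
    push_cast
    have e1 : (2 : ℝ) ^ (InfinitePlace.nrRealPlaces K + 2 * InfinitePlace.nrComplexPlaces K)
        = 2 ^ InfinitePlace.nrRealPlaces K *
          (2 ^ InfinitePlace.nrComplexPlaces K * 2 ^ InfinitePlace.nrComplexPlaces K) := by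
      rw [pow_add, two_mul, pow_add]
    have e2 : (0 : ℝ) < ∏ w, f w ^ w.mult := Finset.prod_pos fun w _ => pow_pos (hf w) _
    have e3 : (2:ℝ) ^ InfinitePlace.nrComplexPlaces K ≤ Real.pi ^ InfinitePlace.nrComplexPlaces K :=
      pow_le_pow_left₀ (by norm_num) Real.two_le_pi _
    have e4 : (0:ℝ) < 2 ^ InfinitePlace.nrRealPlaces K := by positivity
    have e5 : (0:ℝ) < 2 ^ InfinitePlace.nrComplexPlaces K := by positivity
    rw [e1]
    have hg : ∏ w, ((g w : NNReal) : ℝ) ^ w.mult = ∏ w, f w ^ w.mult := rfl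
    rw [hg]
    have hn : ‖discr K‖ = |(discr K : ℝ)| := by simp [Int.norm_eq_abs]
    calc _ = (2:ℝ) ^ InfinitePlace.nrRealPlaces K * 2 ^ InfinitePlace.nrComplexPlaces K *
        ((Ideal.absNorm I : ℝ) * √|(discr K : ℝ)|) := by
          rw [← hn]
          rw [inv_pow]; field_simp
      _ < (2:ℝ) ^ InfinitePlace.nrRealPlaces K * 2 ^ InfinitePlace.nrComplexPlaces K *
        ∏ w, f w ^ w.mult := by
          gcongr
      _ ≤ _ := by gcongr; exact NNReal.coe_real_pi.symm ▸ Real.two_le_pi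
  obtain ⟨a, ha, ha0, haw⟩ := mixedEmbedding.exists_ne_zero_mem_ideal_lt K J hlt
  have ha' : a ∈ (I : FractionalIdeal (nonZeroDivisors (𝓞 K)) K) := ha
  rw [FractionalIdeal.mem_coeIdeal] at ha'
  obtain ⟨b, hb, rfl⟩ := ha'
  exact ⟨b, hb, fun h => ha0 (by simp [h]), haw⟩

open UniqueFactorizationMonoid in
theorem Ideal.exists_eq_mul_pow_of_mul_eq_mul_pow {R : Type*} [CommRing R] [IsDedekindDomain R]
    {m : ℕ} (hm : 0 < m) (I J A Y D : Ideal R) (hI : I ≠ ⊥) (hJ : J ≠ ⊥) (hA : A ≠ ⊥) (hY : Y ≠ ⊥)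
    (hAD : A ∣ D) (hIJ : ∀ P : Ideal R, Prime P → P ∣ I → P ∣ J → P ∣ D)
    (h : I * J = A * Y ^ m) :
    ∃ B C : Ideal R, I = B * C ^ m ∧ B ∣ D ^ m := by
  classical
  let s := normalizedFactors I
  have hs : s.prod = I := associated_iff_eq.mp (prod_normalizedFactors hI)
  have hprime : ∀ P ∈ s, Prime P := fun P hP => prime_of_normalized_factor P hP
  refine ⟨∏ P ∈ s.toFinset, P ^ (s.count P % m), ∏ P ∈ s.toFinset, P ^ (s.count P / m), ?_, ?_⟩
  · rw [← Finset.prod_pow, ← Finset.prod_mul_distrib]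
    conv_lhs => rw [← hs, Finset.prod_multiset_count]
    refine Finset.prod_congr rfl fun P _ => ?_
    rw [← pow_mul, ← pow_add, mul_comm _ m, Nat.mod_add_div]
  · let t := s.toFinset.filter (fun P => s.count P % m ≠ 0)
    have hmem : ∀ P ∈ t, P ∣ D := by
      intro P hP
      obtain ⟨hPs, hc⟩ := Finset.mem_filter.mp hP
      rw [Multiset.mem_toFinset] at hPs
      have hPp := hprime P hPs
      have hPI : P ∣ I := dvd_of_mem_normalizedFactors hPs
      by_cases hPJ : P ∣ J
      · exact hIJ P hPp hPI hPJ
      by_cases hPA : P ∣ A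
      · exact hPA.trans hAD
      exfalso
      apply hc
      have h0 : ∀ Z : Ideal R, Z ≠ ⊥ → ¬ P ∣ Z → (normalizedFactors Z).count P = 0 := by
        intro Z _ hPZ
        exact Multiset.count_eq_zero.mpr fun hmem => hPZ (dvd_of_mem_normalizedFactors hmem)
      have h1 := congrArg (fun Z => (normalizedFactors Z).count P) h
      simp only [normalizedFactors_mul hI hJ, normalizedFactors_mul hA (pow_ne_zero m hY),
        normalizedFactors_pow, Multiset.count_add, h0 J hJ hPJ, h0 A hA hPA,
        Multiset.count_nsmul] at h1
      have h2 : s.count P = m * (normalizedFactors Y).count P := by simpa using h1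
      rw [h2, Nat.mul_mod_right]
    have hdvd : ∏ P ∈ t, P ∣ D :=
      Finset.prod_primes_dvd D (fun P hP => hprime P
        (Multiset.mem_toFinset.mp (Finset.mem_filter.mp hP).1)) hmem
    refine dvd_trans ?_ (pow_dvd_pow_of_dvd hdvd m)
    rw [← Finset.prod_pow, ← Finset.prod_filter_of_ne (p := fun P => s.count P % m ≠ 0)]
    · exact Finset.prod_dvd_prod_of_dvd _ _ fun P _ => pow_dvd_pow P (Nat.mod_lt _ hm).le
    · intro P _ hne h0
      exact hne (by rw [h0, pow_zero])

theorem exists_mul_eq_mul_pow_of_eval_eq {K : Type*} [Field K] [NumberField K] {m : ℕ} (hm : 0 < m)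
    (F : Polynomial ℤ) (α : 𝓞 K) (hα : Polynomial.aeval α F = 0) (a x y : ℤ) (ha : a ≠ 0)
    (hy : y ≠ 0) (hα' : Polynomial.aeval α F.derivative ≠ 0) (hx : F.eval x = a * y ^ m) :
    ∃ (ρ ξ : 𝓞 K) (A : ℕ), ρ ≠ 0 ∧ ξ ≠ 0 ∧ A ≠ 0 ∧ ((x : 𝓞 K) - α) * ρ = A * ξ ^ m ∧
      A ≤ (Algebra.norm ℤ ((a : 𝓞 K) * Polynomial.aeval α F.derivative)).natAbs ^ m ∧
      ∀ w : InfinitePlace K, w (ρ : K) ≤ A * (|(discr K : ℝ)| + 1) ^ m := by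
  set f := F.map (algebraMap ℤ (𝓞 K)) with hf
  set z : 𝓞 K := (x : 𝓞 K) - α with hz
  set δ : 𝓞 K := Polynomial.aeval α F.derivative with hδ
  obtain ⟨k, hk⟩ := Polynomial.binomExpansion f α z
  have e1 : f.eval (α + z) = (a : 𝓞 K) * (y : 𝓞 K) ^ m := by
    have : α + z = algebraMap ℤ (𝓞 K) x := by simp [hz]
    rw [this, hf, Polynomial.eval_map_algebraMap, Polynomial.aeval_algebraMap_apply,
      Polynomial.coe_aeval_eq_eval, hx]
    simp
  have e2 : f.eval α = 0 := by rw [hf, Polynomial.eval_map_algebraMap, hα]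
  have e3 : f.derivative.eval α = δ := by
    rw [hf, Polynomial.derivative_map, Polynomial.eval_map_algebraMap]
  rw [e1, e2, e3, zero_add] at hk
  have hk' : z * (δ + k * z) = (a : 𝓞 K) * (y : 𝓞 K) ^ m := by rw [hk]; ring
  have ha' : (a : 𝓞 K) ≠ 0 := by exact_mod_cast ha
  have hy' : (y : 𝓞 K) ≠ 0 := by exact_mod_cast hy
  have hne : z * (δ + k * z) ≠ 0 := by rw [hk']; exact mul_ne_zero ha' (pow_ne_zero _ hy')
  have hz0 : z ≠ 0 := left_ne_zero_of_mul hne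
  have hJ0 := right_ne_zero_of_mul hne
  obtain ⟨B, C, hBC, hBD⟩ := Ideal.exists_eq_mul_pow_of_mul_eq_mul_pow hm
    (Ideal.span {z}) (Ideal.span {δ + k * z}) (Ideal.span {(a : 𝓞 K)}) (Ideal.span {(y : 𝓞 K)})
    (Ideal.span {(a : 𝓞 K) * δ}) (by simpa using hz0) (by simpa using hJ0) (by simpa using ha)
    (by simpa using hy) (by
      rw [← Ideal.span_singleton_mul_span_singleton]; exact dvd_mul_right _ _)
    (by
      intro P _ hPI hPJ
      rw [Ideal.dvd_span_singleton] at hPI hPJ ⊢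
      have : δ ∈ P := by
        have := P.sub_mem hPJ (P.mul_mem_left k hPI)
        simpa using this
      exact P.mul_mem_left _ this)
    (by
      rw [Ideal.span_singleton_mul_span_singleton, Ideal.span_singleton_pow,
        Ideal.span_singleton_mul_span_singleton, hk'])
  have hI0 : Ideal.span {z} ≠ ⊥ := by simpa using hz0
  have hB0 : B ≠ ⊥ := by rintro rfl; apply hI0; rw [hBC]; simp
  have hC0 : C ≠ ⊥ := by
    rintro rfl; apply hI0; rw [hBC, ← Ideal.zero_eq_bot, zero_pow hm.ne', mul_zero]
  set κ : ℝ := |(discr K : ℝ)| + 1 with hκ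
  have hD1 : (1 : ℝ) ≤ |(discr K : ℝ)| := by
    have := Int.one_le_abs (discr_ne_zero K)
    exact_mod_cast this
  have hκ1 : 1 ≤ κ := by linarith
  have hκ0 : 0 < κ := by linarith
  have hwz : ∀ w : InfinitePlace K, 0 < w (z : K) := fun w => w.pos_iff.mpr (by simpa using hz0)
  -- norm identity
  have hnorm : ∏ w : InfinitePlace K, (w (z : K)) ^ w.mult =
      (Ideal.absNorm B : ℝ) * (Ideal.absNorm C : ℝ) ^ m := by
    rw [InfinitePlace.prod_eq_abs_norm]
    have h1 := congrArg Ideal.absNorm hBC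
    rw [Ideal.absNorm_span_singleton, map_mul, map_pow] at h1
    rw [← Algebra.coe_norm_int]
    have h2 : |((Algebra.norm ℤ z : ℤ) : ℚ)| = ((Algebra.norm ℤ z).natAbs : ℚ) := by
      rw [Nat.cast_natAbs]; push_cast; rfl
    rw [h2, h1]; push_cast; rfl
  have hBN : 1 ≤ Ideal.absNorm B := Nat.one_le_iff_ne_zero.mpr (mt Ideal.absNorm_eq_zero_iff.mp hB0)
  have hCN : 1 ≤ Ideal.absNorm C := Nat.one_le_iff_ne_zero.mpr (mt Ideal.absNorm_eq_zero_iff.mp hC0)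
  have hm0 : (m : ℝ) ≠ 0 := by exact_mod_cast hm.ne'
  obtain ⟨ξ, hξC, hξ0, hξ⟩ := exists_mem_ideal_place_lt C hC0
    (fun w => κ * (w (z : K)) ^ ((1 : ℝ) / m)) (fun w => mul_pos hκ0 (Real.rpow_pos_of_pos (hwz w) _))
    (by
      simp_rw [mul_pow]
      rw [Finset.prod_mul_distrib, Finset.prod_pow_eq_pow_sum, InfinitePlace.sum_mult_eq]
      have h1 : ∏ w : InfinitePlace K, ((w (z : K)) ^ ((1 : ℝ) / m)) ^ w.mult =
          (∏ w : InfinitePlace K, (w (z : K)) ^ w.mult) ^ ((1 : ℝ) / m) := by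
        rw [← Real.finsetProd_rpow _ _ (fun w _ => pow_nonneg (hwz w).le _)]
        refine Finset.prod_congr rfl fun w _ => ?_
        rw [← Real.rpow_natCast, ← Real.rpow_mul (hwz w).le, mul_comm, Real.rpow_mul (hwz w).le,
          Real.rpow_natCast]
      rw [h1, hnorm]
      have h2 : (Ideal.absNorm C : ℝ) ≤
          ((Ideal.absNorm B : ℝ) * (Ideal.absNorm C : ℝ) ^ m) ^ ((1 : ℝ) / m) := by
        calc (Ideal.absNorm C : ℝ) = ((Ideal.absNorm C : ℝ) ^ m) ^ ((1 : ℝ) / m) := by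
              rw [← Real.rpow_natCast, ← Real.rpow_mul (by positivity), mul_one_div_cancel hm0,
                Real.rpow_one]
          _ ≤ _ := by
              apply Real.rpow_le_rpow (by positivity) _ (by positivity)
              have : (1 : ℝ) ≤ Ideal.absNorm B := by exact_mod_cast hBN
              nlinarith [pow_nonneg (Nat.cast_nonneg (α := ℝ) (Ideal.absNorm C)) m]
      have h3 : √|(discr K : ℝ)| < κ ^ finrank ℚ K := by
        have h4 : κ ≤ κ ^ finrank ℚ K := le_self_pow₀ hκ1 finrank_pos.ne'
        have h5 : √|(discr K : ℝ)| ≤ |(discr K : ℝ)| := by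
          rw [Real.sqrt_le_left (by positivity)]; nlinarith
        linarith
      have h6 : (0 : ℝ) < Ideal.absNorm C := by exact_mod_cast hCN
      rw [mul_comm]
      exact mul_lt_mul h3 h2 h6 (by positivity))
  set A := Ideal.absNorm B with hA
  have hmem : (A : 𝓞 K) * ξ ^ m ∈ Ideal.span {z} := by
    rw [hBC]
    exact Ideal.mul_mem_mul (Ideal.absNorm_mem B) (Ideal.pow_mem_pow hξC m)
  obtain ⟨ρ, hρ⟩ := Ideal.mem_span_singleton'.mp hmem
  have hA0 : (A : 𝓞 K) ≠ 0 := by exact_mod_cast (show A ≠ 0 by omega)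
  refine ⟨ρ, ξ, A, ?_, hξ0, by omega, by rw [mul_comm]; exact hρ, ?_, ?_⟩
  · rintro rfl
    rw [zero_mul] at hρ
    exact mul_ne_zero hA0 (pow_ne_zero _ hξ0) hρ.symm
  · have h1 := Ideal.absNorm_dvd_absNorm_of_le (Ideal.le_of_dvd hBD)
    rw [map_pow, Ideal.absNorm_span_singleton] at h1
    refine Nat.le_of_dvd ?_ h1
    apply pow_pos
    rw [Int.natAbs_pos]
    exact Algebra.norm_ne_zero_iff.mpr (mul_ne_zero ha' hα')
  · intro w
    have h1 : w (ρ : K) * w (z : K) = A * w (ξ : K) ^ m := by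
      rw [← map_mul, ← map_pow]
      have h2 : ((ρ * z : 𝓞 K) : K) = ((A * ξ ^ m : 𝓞 K) : K) := by rw [hρ]
      push_cast at h2
      have h3 : w ((A : K) * (ξ : K) ^ m) = A * w ((ξ : K) ^ m) := by
        rw [map_mul, ← w.norm_embedding_eq (A : K), map_natCast, Complex.norm_natCast]
      rw [← h3, ← h2]
    have h4 : w (ξ : K) ^ m ≤ κ ^ m * w (z : K) := by
      calc w (ξ : K) ^ m ≤ (κ * (w (z : K)) ^ ((1 : ℝ) / m)) ^ m :=
            pow_le_pow_left₀ (apply_nonneg w _) (hξ w).le m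
        _ = _ := by
            rw [mul_pow, ← Real.rpow_natCast ((w (z : K)) ^ ((1 : ℝ) / m)) m,
              ← Real.rpow_mul (hwz w).le, one_div_mul_cancel hm0, Real.rpow_one]
    have h5 : w (ρ : K) * w (z : K) ≤ (A * κ ^ m) * w (z : K) := by
      rw [h1, mul_assoc]; gcongr
    exact le_of_mul_le_mul_right h5 (hwz w)

/-- A pigeonhole form of Siegel's lemma: approximate integral solutions of real linear forms. -/
theorem exists_int_vec_abs_sum_le {ι κ : Type*} [Fintype ι] [Fintype κ] (A : κ → ι → ℝ)
    (X h : ℕ) (E : ℝ) (hh : 0 < h) (hE : 0 < E) (hA : ∀ k, (∑ i, |A k i|) * X ≤ E)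
    (hcard : (h + 1) ^ Fintype.card κ < (X + 1) ^ Fintype.card ι) :
    ∃ c : ι → ℤ, c ≠ 0 ∧ (∀ i, |c i| ≤ X) ∧ ∀ k, |∑ i, A k i * c i| ≤ 2 * E / h := by
  classical
  have hh' : (0 : ℝ) < h := by exact_mod_cast hh
  have hb : ∀ (v : ι → Fin (X + 1)) k, |∑ i, A k i * ((v i : ℕ) : ℝ)| ≤ E := fun v k => by
    refine (Finset.abs_sum_le_sum_abs _ _).trans (le_trans ?_ (hA k))
    rw [Finset.sum_mul]
    refine Finset.sum_le_sum fun i _ => ?_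
    rw [abs_mul, Nat.abs_cast]
    have : ((v i : ℕ) : ℝ) ≤ X := by exact_mod_cast Nat.lt_succ_iff.mp (v i).2
    gcongr
  let f : (ι → Fin (X + 1)) → κ → Fin (h + 1) := fun v k =>
    ⟨⌊((∑ i, A k i * ((v i : ℕ) : ℝ)) + E) * h / (2 * E)⌋₊, by
      rw [Nat.lt_succ_iff]
      refine Nat.floor_le_of_le ?_
      rw [div_le_iff₀ (by positivity)]
      have := (abs_le.mp (hb v k)).2
      nlinarith⟩
  obtain ⟨v, v', hne, hv⟩ := Fintype.exists_ne_map_eq_of_card_lt f (by simpa using hcard)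
  refine ⟨fun i => ((v i : ℕ) : ℤ) - (v' i : ℕ), ?_, fun i => ?_, fun k => ?_⟩
  · intro h0
    apply hne
    ext i
    have := congrFun h0 i
    simp only [Pi.zero_apply] at this
    omega
  · have h1 := (v i).2
    have h2 := (v' i).2
    show |((v i : ℕ) : ℤ) - (v' i : ℕ)| ≤ X
    rw [abs_le]; constructor <;> omega
  · have hk := congrArg Fin.val (congrFun hv k)
    simp only [f] at hk
    set s := ∑ i, A k i * ((v i : ℕ) : ℝ) with hs
    set s' := ∑ i, A k i * ((v' i : ℕ) : ℝ) with hs'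
    have e : ∑ i, A k i * (((((v i : ℕ) : ℤ) - (v' i : ℕ) : ℤ)) : ℝ) = s - s' := by
      rw [hs, hs', ← Finset.sum_sub_distrib]
      refine Finset.sum_congr rfl fun i _ => ?_
      push_cast; ring
    rw [e]
    have p1 : 0 ≤ (s + E) * h / (2 * E) := by
      have := (abs_le.mp (hb v k)).1
      have : 0 ≤ s + E := by linarith
      positivity
    have p2 : 0 ≤ (s' + E) * h / (2 * E) := by
      have := (abs_le.mp (hb v' k)).1
      have : 0 ≤ s' + E := by linarith
      positivity
    have q1 := Nat.floor_le p1
    have q2 := Nat.lt_floor_add_one ((s + E) * h / (2 * E))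
    have q3 := Nat.floor_le p2
    have q4 := Nat.lt_floor_add_one ((s' + E) * h / (2 * E))
    rw [hk] at q1 q2
    have e2 : (s - s') = ((s + E) * h / (2 * E) - (s' + E) * h / (2 * E)) * (2 * E / h) := by
      field_simp; ring
    rw [e2, abs_mul, abs_of_pos (by positivity : (0 : ℝ) < 2 * E / h)]
    refine mul_le_of_le_one_left (by positivity) ?_
    rw [abs_le]; constructor <;> linarith

theorem Matrix.natDegree_det_le_of_natDegree_le {n : ℕ} {R : Type*} [CommRing R]
    (M : Matrix (Fin n) (Fin n) (Polynomial R)) (d : ℕ) (h : ∀ i j, (M i j).natDegree ≤ d) :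
    M.det.natDegree ≤ n * d := by
  rw [Matrix.det_apply]
  refine Polynomial.natDegree_sum_le_of_forall_le _ _ fun σ _ => ?_
  refine (Polynomial.natDegree_smul_le _ _).trans ?_
  refine (Polynomial.natDegree_prod_le _ _).trans ?_
  refine (Finset.sum_le_card_nsmul _ _ d fun i _ => h _ _).trans ?_
  simp

theorem Matrix.coeff_det_of_natDegree_le {n : ℕ} {R : Type*} [CommRing R]
    (M : Matrix (Fin n) (Fin n) (Polynomial R)) (d : ℕ) (h : ∀ i j, (M i j).natDegree ≤ d) :
    M.det.coeff (n * d) = (M.map fun p => p.coeff d).det := by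
  rw [Matrix.det_apply, Matrix.det_apply, Polynomial.finsetSum_coeff]
  refine Finset.sum_congr rfl fun σ _ => ?_
  rw [Polynomial.coeff_smul]
  congr 1
  have := Polynomial.coeff_prod_of_natDegree_le (s := Finset.univ) (fun i => M (σ i) i) d
    fun i _ => h _ _
  simpa using this

theorem exists_eval_ne_zero_of_pow_injective {F : Type*} [Field F] [CharZero F]
    (K L R S N : ℕ) (η ν : F) (hη : Function.Injective fun i : ℕ => η ^ i) (hη0 : η ≠ 0)
    (hν : ν ≠ 0) (P : ℕ → Polynomial F) (hP : ∀ l < L, (P l).natDegree ≤ K)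
    (hP0 : ∃ l < L, P l ≠ 0) (hS : S ≤ N) (hKL : L * K < R * S) :
    ∃ r < R, ∃ s < S + L, ∑ l ∈ Finset.range L,
      (P l).eval ((r * N + s : ℕ) : F) * (η ^ s * ν ^ r) ^ l ≠ 0 := by
  classical
  by_contra! hz
  set σ := (Finset.range L).filter fun l => P l ≠ 0 with hσ
  set n := σ.card with hn
  have hnL : n ≤ L := (Finset.card_filter_le _ _).trans (by simp)
  have hn0 : 0 < n := by
    obtain ⟨l, hl, hl0⟩ := hP0
    exact Finset.card_pos.mpr ⟨l, by simp [hσ, hl, hl0]⟩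
  set e : Fin n → ℕ := fun i => σ.orderEmbOfFin rfl i with he
  have hemem : ∀ i, e i < L ∧ P (e i) ≠ 0 := fun i => by
    have : e i ∈ σ := σ.orderEmbOfFin_mem rfl i
    rw [hσ, Finset.mem_filter, Finset.mem_range] at this
    exact this
  have heinj : Function.Injective e := (σ.orderEmbOfFin rfl).injective
  set M : Matrix (Fin n) (Fin n) (Polynomial F) := Matrix.of fun j i =>
    (P (e i)).comp (Polynomial.X + Polynomial.C ((j : ℕ) : F)) *
      Polynomial.C (η ^ ((j : ℕ) * e i)) with hM
  set M' : Matrix (Fin n) (Fin n) (Polynomial F) := Matrix.of fun j i =>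
    Polynomial.X ^ (K - (P (e i)).natDegree) * M j i with hM'
  have hnd : ∀ (i j : Fin n), ((P (e i)).comp
      (Polynomial.X + Polynomial.C ((j : ℕ) : F))).natDegree = (P (e i)).natDegree := fun i j => by
    rw [Polynomial.natDegree_comp, Polynomial.natDegree_X_add_C, mul_one]
  have hdeg : ∀ i j, (M' i j).natDegree ≤ K := fun j i => by
    simp only [hM', hM, Matrix.of_apply]
    refine Polynomial.natDegree_mul_le.trans ?_
    have h1 := Polynomial.natDegree_mul_C_le ((P (e i)).comp
      (Polynomial.X + Polynomial.C ((j : ℕ) : F))) (η ^ ((j : ℕ) * e i))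
    rw [hnd] at h1
    have h2 := Polynomial.natDegree_X_pow_le (R := F) (K - (P (e i)).natDegree)
    have := hP _ (hemem i).1
    omega
  have hcoeff : (M'.map fun p => p.coeff K) = Matrix.of fun j i =>
      (P (e i)).leadingCoeff * (Matrix.vandermonde fun i => η ^ e i).transpose j i := by
    ext j i
    simp only [Matrix.map_apply, hM', hM, Matrix.of_apply, Matrix.transpose_apply,
      Matrix.vandermonde_apply]
    have h1 : K = (P (e i)).natDegree + (K - (P (e i)).natDegree) := by
      have := hP _ (hemem i).1; omega
    conv_lhs => rw [h1]
    rw [Nat.add_sub_cancel_left, Polynomial.coeff_X_pow_mul, Polynomial.coeff_mul_C]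
    have h2 : ((P (e i)).comp (Polynomial.X + Polynomial.C ((j : ℕ) : F))).coeff
        (P (e i)).natDegree = (P (e i)).leadingCoeff := by
      conv_lhs => rw [← hnd i j]
      rw [Polynomial.coeff_natDegree, Polynomial.leadingCoeff_comp]
      · rw [Polynomial.leadingCoeff_X_add_C, one_pow, mul_one]
      · rw [Polynomial.natDegree_X_add_C]; simp
    rw [h2, ← pow_mul, mul_comm (e i)]
  have hdet0 : M'.det ≠ 0 := by
    intro h0
    have h1 := Matrix.coeff_det_of_natDegree_le M' K hdeg
    rw [h0, Polynomial.coeff_zero, hcoeff, Matrix.det_mul_row, Matrix.det_transpose] at h1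
    have h2 : (Matrix.vandermonde fun i => η ^ e i).det ≠ 0 :=
      Matrix.det_vandermonde_ne_zero_iff.mpr (hη.comp heinj)
    refine mul_ne_zero (Finset.prod_ne_zero_iff.mpr fun i _ => ?_) h2 h1.symm
    exact Polynomial.leadingCoeff_ne_zero.mpr (hemem i).2
  have hfac : M'.det = (∏ i, Polynomial.X ^ (K - (P (e i)).natDegree)) * M.det :=
    Matrix.det_mul_row _ _
  have hvan : ∀ r < R, ∀ s < S, M'.det.eval ((r * N + s : ℕ) : F) = 0 := by
    intro r hr s hs
    rw [hfac, Polynomial.eval_mul]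
    have : M.det.eval ((r * N + s : ℕ) : F) = 0 := by
      rw [← Polynomial.coe_evalRingHom, RingHom.map_det, ← Matrix.exists_mulVec_eq_zero_iff]
      refine ⟨fun i => (η ^ s * ν ^ r) ^ e i, ?_, ?_⟩
      · intro h
        have := congrFun h ⟨0, hn0⟩
        simp [hη0, hν] at this
      · ext j
        have hj : s + (j : ℕ) < S + L := by have := j.2; omega
        have := hz r hr (s + j) hj
        simp only [Matrix.mulVec, dotProduct, RingHom.mapMatrix_apply, Matrix.map_apply, hM,
          Matrix.of_apply, Pi.zero_apply, Polynomial.coe_evalRingHom, Polynomial.eval_mul,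
          Polynomial.eval_comp, Polynomial.eval_add, Polynomial.eval_X, Polynomial.eval_C]
        rw [← this]
        have h3 : ∑ l ∈ Finset.range L, (P l).eval ((r * N + (s + j) : ℕ) : F) *
            (η ^ (s + (j : ℕ)) * ν ^ r) ^ l = ∑ l ∈ σ, (P l).eval ((r * N + (s + j) : ℕ) : F) *
            (η ^ (s + (j : ℕ)) * ν ^ r) ^ l := by
          rw [hσ, Finset.sum_filter]
          refine Finset.sum_congr rfl fun l _ => ?_
          by_cases h : P l = 0 <;> simp [h]
        rw [h3, ← Finset.map_orderEmbOfFin_univ σ rfl, Finset.sum_map]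
        refine Finset.sum_congr rfl fun i _ => ?_
        simp only [he, RelEmbedding.coe_toEmbedding]
        push_cast
        rw [add_assoc, mul_assoc]
        congr 1
        ring
    rw [this, mul_zero]
  refine hdet0 (Polynomial.eq_zero_of_natDegree_lt_card_of_eval_eq_zero' _
    (((Finset.range R) ×ˢ (Finset.range S)).image fun x => ((x.1 * N + x.2 : ℕ) : F)) ?_ ?_)
  · intro z hz'
    obtain ⟨⟨r, s⟩, hx, rfl⟩ := Finset.mem_image.mp hz'
    simp only [Finset.mem_product, Finset.mem_range] at hx
    exact hvan r hx.1 s hx.2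
  · rw [Finset.card_image_of_injOn, Finset.card_product, Finset.card_range, Finset.card_range]
    · calc _ ≤ n * K := Matrix.natDegree_det_le_of_natDegree_le M' K hdeg
        _ ≤ L * K := Nat.mul_le_mul_right _ hnL
        _ < _ := hKL
    · rintro ⟨r, s⟩ hx ⟨r', s'⟩ hx' h
      simp only [Finset.coe_product, Finset.coe_range, Set.mem_prod, Set.mem_Iio] at hx hx'
      have h1 : r * N + s = r' * N + s' := Nat.cast_injective (R := F) h
      have hN : 0 < N := by omega
      have h2 : s = s' := by
        have := congrArg (· % N) h1
        simpa [Nat.mul_add_mod', Nat.mod_eq_of_lt (hx.2.trans_le hS),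
          Nat.mod_eq_of_lt (hx'.2.trans_le hS)] using this
      subst h2
      have : r = r' := Nat.eq_of_mul_eq_mul_right hN (by omega)
      rw [this]

theorem Complex.norm_exp_sub_sum_le {x : ℂ} {E T : ℕ} (hx : ‖x‖ ≤ E) (hT : 8 * E ≤ T) :
    ‖Complex.exp x - ∑ j ∈ Finset.range T, x ^ j / (j.factorial : ℂ)‖ ≤ 2 / 2 ^ T := by
  have hT' : (8 : ℝ) * E ≤ T := by exact_mod_cast hT
  have h1 := Complex.exp_bound' (x := x) (n := T) (by
    rw [div_le_iff₀ (by positivity)]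
    push_cast
    have : (0 : ℝ) ≤ E := by positivity
    linarith)
  refine h1.trans ?_
  have h2 : ‖x‖ ^ T / (T.factorial : ℝ) ≤ 1 / 2 ^ T := by
    have h3 := Real.pow_div_factorial_le_exp (T : ℝ) (by positivity) T
    have h4 : Real.exp (T : ℝ) ≤ 3 ^ T := by
      rw [← Real.exp_one_pow]
      have := Real.exp_one_lt_d9
      gcongr
      linarith
    calc ‖x‖ ^ T / (T.factorial : ℝ) ≤ ((T : ℝ) / 8) ^ T / (T.factorial : ℝ) := by
          gcongr; linarith
      _ = (T : ℝ) ^ T / (T.factorial : ℝ) * (1 / 8) ^ T := by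
          rw [div_pow, div_pow, one_pow]; ring
      _ ≤ 3 ^ T * (1 / 8) ^ T := by gcongr; exact h3.trans h4
      _ = ((3 : ℝ) / 8) ^ T := by rw [← mul_pow]; norm_num
      _ ≤ (1 / 2 : ℝ) ^ T := by gcongr ?_ ^ T; norm_num
      _ = 1 / 2 ^ T := by rw [div_pow, one_pow]
  calc _ ≤ 1 / (2 : ℝ) ^ T * 2 := by gcongr
    _ = 2 / 2 ^ T := by ring

theorem exists_exp_poly_small {M L U V E w : ℕ} {lam : ℂ} {Z : ℕ} (hZ1 : 1 ≤ Z)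
    (hZ : Z ≤ 2 ^ w) (hML : M * L ≤ 2 ^ w) (hM : 0 < M) (hL : 0 < L) (hMV : M ≤ V) (hV : V ≤ 2 ^ w)
    (hE : L * ‖lam‖ * Z ≤ E) (hEV : 8 * E ≤ V) (hUV : 2 * V * (M + V) ≤ U * (M * L)) :
    ∃ c : Fin M × Fin L → ℤ, c ≠ 0 ∧ (∀ i, |c i| ≤ 2 ^ U) ∧ ∀ z : ℕ, z ≤ Z →
      ‖∑ i, (c i : ℂ) * ((z : ℂ) ^ (i.1 : ℕ) * Complex.exp ((i.2 : ℕ) * lam * z))‖ * 2 ^ V ≤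
        2 ^ (w * M + 2 * w + 2 * E + U + 5) := by
  have hV1 : 1 ≤ V := hM.trans_le hMV
  -- coefficient of `z ^ t` in the truncated function
  set a : ℕ → Fin M × Fin L → ℂ := fun t i => ∑ j ∈ Finset.range V,
    if (i.1 : ℕ) + j = t then (((i.2 : ℕ) : ℂ) * lam) ^ j / (j.factorial : ℂ) * (Z : ℂ) ^ t else 0
    with ha
  have hZ1' : (1 : ℝ) ≤ Z := by exact_mod_cast hZ1
  have hZ' : (Z : ℝ) ≤ 2 ^ w := by exact_mod_cast hZ
  have hML' : (M : ℝ) * L ≤ 2 ^ w := by exact_mod_cast hML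
  have hlam : ∀ i : Fin M × Fin L, ‖((i.2 : ℕ) : ℂ) * lam * (Z : ℂ)‖ ≤ E := fun i => by
    rw [norm_mul, norm_mul, Complex.norm_natCast, Complex.norm_natCast]
    have : ((i.2 : ℕ) : ℝ) ≤ L := by exact_mod_cast i.2.2.le
    exact le_trans (by gcongr) hE
  have hZM : ∀ i : Fin M, (Z : ℝ) ^ (i : ℕ) ≤ 2 ^ (w * M) := fun i =>
    calc (Z : ℝ) ^ (i : ℕ) ≤ (Z : ℝ) ^ M := pow_le_pow_right₀ hZ1' i.2.le
      _ ≤ (2 ^ w) ^ M := by gcongr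
      _ = _ := by rw [← pow_mul]
  have hexpE : Real.exp E ≤ 2 ^ (2 * E) := by
    rw [← Real.exp_one_pow, pow_mul]
    have := Real.exp_one_lt_d9
    gcongr
    linarith
  have hanorm : ∀ t i, ‖a t i‖ ≤ 2 ^ (w * M + 2 * E) := fun t i => by
    have h1 : ‖a t i‖ ≤ ∑ j ∈ Finset.range V, (Z : ℝ) ^ (i.1 : ℕ) *
        (‖((i.2 : ℕ) : ℂ) * lam * (Z : ℂ)‖ ^ j / (j.factorial : ℝ)) := by
      refine (norm_sum_le _ _).trans (Finset.sum_le_sum fun j _ => ?_)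
      split_ifs with h
      · rw [← h, norm_mul, norm_div, norm_pow, norm_pow, Complex.norm_natCast,
          Complex.norm_natCast, norm_mul _ (Z : ℂ), Complex.norm_natCast, mul_pow, pow_add]
        apply le_of_eq; ring
      · rw [norm_zero]; positivity
    rw [← Finset.mul_sum] at h1
    have h2 := Real.sum_le_exp_of_nonneg (norm_nonneg (((i.2 : ℕ) : ℂ) * lam * (Z : ℂ))) V
    calc ‖a t i‖ ≤ _ := h1
      _ ≤ 2 ^ (w * M) * 2 ^ (2 * E) := by
        gcongr
        · exact hZM _
        · exact h2.trans ((Real.exp_le_exp.mpr (hlam i)).trans hexpE)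
      _ = _ := by rw [pow_add]
  obtain ⟨c, hc0, hcX, hc⟩ := exists_int_vec_abs_sum_le (ι := Fin M × Fin L)
    (κ := Fin (M + V) × Bool)
    (fun k i => if k.2 then (a k.1 i).re else (a k.1 i).im) (2 ^ U) (2 ^ V - 1)
    (2 ^ (w + (w * M + 2 * E) + U))
    (by have := Nat.one_lt_two_pow (n := V) (by omega); omega) (by positivity)
    (by
      intro k
      have h1 : ∑ i : Fin M × Fin L, |if k.2 then (a k.1 i).re else (a k.1 i).im| ≤
          2 ^ w * 2 ^ (w * M + 2 * E) := by
        calc _ ≤ ∑ i : Fin M × Fin L, (2 : ℝ) ^ (w * M + 2 * E) := by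
              refine Finset.sum_le_sum fun i _ => ?_
              split_ifs
              · exact (Complex.abs_re_le_norm _).trans (hanorm _ _)
              · exact (Complex.abs_im_le_norm _).trans (hanorm _ _)
          _ = ((M : ℝ) * L) * 2 ^ (w * M + 2 * E) := by simp
          _ ≤ _ := by gcongr
      rw [pow_add _ _ U, pow_add]
      push_cast
      gcongr)
    (by
      have h1 : 2 ^ V - 1 + 1 = 2 ^ V := Nat.sub_add_cancel Nat.one_le_two_pow
      rw [h1]
      simp only [Fintype.card_prod, Fintype.card_fin, Fintype.card_bool]
      rw [← pow_mul]
      calc 2 ^ (V * ((M + V) * 2)) ≤ 2 ^ (U * (M * L)) :=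
            Nat.pow_le_pow_right (by norm_num) (by nlinarith)
        _ = (2 ^ U) ^ (M * L) := by rw [pow_mul]
        _ < _ := Nat.pow_lt_pow_left (by omega) (by positivity))
  refine ⟨c, hc0, fun i => by exact_mod_cast hcX i, fun z hz => ?_⟩
  have hcX' : ∀ i, ‖(c i : ℂ)‖ ≤ 2 ^ U := fun i => by
    rw [Complex.norm_intCast]; exact_mod_cast hcX i
  have hzZ : (z : ℝ) ≤ Z := by exact_mod_cast hz
  have hZ0 : (Z : ℂ) ≠ 0 := by exact_mod_cast (by omega : Z ≠ 0)
  set tr : Fin M × Fin L → ℂ := fun i => ∑ j ∈ Finset.range V,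
    (((i.2 : ℕ) : ℂ) * lam * z) ^ j / (j.factorial : ℂ) with htr
  -- the truncated sum
  have e1 : ∑ i, (c i : ℂ) * ((z : ℂ) ^ (i.1 : ℕ) * tr i) =
      ∑ t : Fin (M + V), ((z : ℂ) / Z) ^ (t : ℕ) * ∑ i, a t i * c i := by
    simp_rw [Finset.mul_sum]
    rw [Finset.sum_comm]
    refine Finset.sum_congr rfl fun i _ => ?_
    have : ∀ t : Fin (M + V), ((z : ℂ) / Z) ^ (t : ℕ) * (a t i * c i) =
        ∑ j ∈ Finset.range V, if (i.1 : ℕ) + j = t then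
          c i * ((z : ℂ) ^ (i.1 : ℕ) * ((((i.2 : ℕ) : ℂ) * lam * z) ^ j / (j.factorial : ℂ)))
          else 0 := fun t => by
      simp only [ha]
      rw [Finset.sum_mul, Finset.mul_sum]
      refine Finset.sum_congr rfl fun j _ => ?_
      split_ifs with h
      · rw [← h, div_pow, pow_add (z : ℂ), mul_pow _ (z : ℂ)]
        have : (Z : ℂ) ^ ((i.1 : ℕ) + j) ≠ 0 := pow_ne_zero _ hZ0
        field_simp
      · simp
    simp_rw [this]
    rw [Finset.sum_comm, htr]
    simp only
    rw [Finset.mul_sum, Finset.mul_sum]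
    refine Finset.sum_congr rfl fun j hj => ?_
    have hlt : (i.1 : ℕ) + j < M + V := by
      have := i.1.2; have := Finset.mem_range.mp hj; omega
    rw [Finset.sum_eq_single (⟨(i.1 : ℕ) + j, hlt⟩ : Fin (M + V))]
    · simp
    · intro t _ ht
      rw [if_neg]
      intro h; apply ht; ext; exact h.symm
    · simp
  have h2V : (2 : ℝ) ^ V ≤ 2 * ((2 ^ V - 1 : ℕ) : ℝ) := by
    have : 1 < 2 ^ V := Nat.one_lt_two_pow (by omega)
    have h' : (2 : ℕ) ^ V ≤ 2 * (2 ^ V - 1) := by omega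
    exact_mod_cast h'
  have hVpos : (0 : ℝ) < 2 ^ V := by positivity
  have hform : ∀ t : Fin (M + V), ‖∑ i, a t i * c i‖ ≤
      8 * 2 ^ (w + (w * M + 2 * E) + U) / 2 ^ V := fun t => by
    have h1 := hc (t, true)
    have h2 := hc (t, false)
    simp only [if_true, Bool.false_eq_true, if_false] at h1 h2
    have hre : (∑ i, a t i * c i).re = ∑ i, (a t i).re * c i := by
      rw [Complex.re_sum]; simp
    have him : (∑ i, a t i * c i).im = ∑ i, (a t i).im * c i := by
      rw [Complex.im_sum]; simp
    have h3 := Complex.norm_le_abs_re_add_abs_im (∑ i, a t i * c i)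
    rw [hre, him] at h3
    have h4 : 2 * (2 : ℝ) ^ (w + (w * M + 2 * E) + U) / ((2 ^ V - 1 : ℕ) : ℝ) ≤
        4 * 2 ^ (w + (w * M + 2 * E) + U) / 2 ^ V := by
      have : (0 : ℝ) < ((2 ^ V - 1 : ℕ) : ℝ) := by linarith
      rw [div_le_div_iff₀ this hVpos]
      have : (0 : ℝ) < 2 ^ (w + (w * M + 2 * E) + U) := by positivity
      nlinarith
    calc _ ≤ _ := h3
      _ ≤ 4 * 2 ^ (w + (w * M + 2 * E) + U) / 2 ^ V + 4 * 2 ^ (w + (w * M + 2 * E) + U) / 2 ^ V :=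
        add_le_add (h1.trans h4) (h2.trans h4)
      _ = _ := by ring
  have hmain : ‖∑ i, (c i : ℂ) * ((z : ℂ) ^ (i.1 : ℕ) * tr i)‖ ≤
      2 ^ (w + 1) * (8 * 2 ^ (w + (w * M + 2 * E) + U) / 2 ^ V) := by
    rw [e1]
    have hMV2 : ((M : ℝ) + V) ≤ 2 ^ (w + 1) := by
      have : M + V ≤ 2 ^ (w + 1) := by rw [pow_succ]; omega
      exact_mod_cast this
    calc _ ≤ ∑ t : Fin (M + V), 8 * 2 ^ (w + (w * M + 2 * E) + U) / (2 : ℝ) ^ V := by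
          refine (norm_sum_le _ _).trans (Finset.sum_le_sum fun t _ => ?_)
          rw [norm_mul, norm_pow, norm_div, Complex.norm_natCast, Complex.norm_natCast]
          have : (z : ℝ) / Z ≤ 1 := div_le_one_of_le₀ hzZ (by positivity)
          calc _ ≤ 1 * ‖∑ i, a t i * c i‖ := by
                gcongr; exact pow_le_one₀ (by positivity) this
            _ ≤ _ := by rw [one_mul]; exact hform t
      _ = ((M : ℝ) + V) * (8 * 2 ^ (w + (w * M + 2 * E) + U) / (2 : ℝ) ^ V) := by simp
      _ ≤ _ := by gcongr
  have htail : ‖∑ i, (c i : ℂ) * ((z : ℂ) ^ (i.1 : ℕ) *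
      (Complex.exp ((i.2 : ℕ) * lam * z) - tr i))‖ ≤
      2 ^ w * (2 ^ U * (2 ^ (w * M) * (2 / 2 ^ V))) := by
    calc _ ≤ ∑ i : Fin M × Fin L, (2 : ℝ) ^ U * (2 ^ (w * M) * (2 / 2 ^ V)) := by
          refine (norm_sum_le _ _).trans (Finset.sum_le_sum fun i _ => ?_)
          rw [norm_mul, norm_mul, norm_pow, Complex.norm_natCast]
          have h1 : ‖((i.2 : ℕ) : ℂ) * lam * (z : ℂ)‖ ≤ E := by
            refine le_trans ?_ (hlam i)
            rw [norm_mul, norm_mul _ (Z : ℂ), Complex.norm_natCast, Complex.norm_natCast]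
            gcongr
          have h2 := Complex.norm_exp_sub_sum_le h1 hEV
          have h3 : (z : ℝ) ^ (i.1 : ℕ) ≤ 2 ^ (w * M) := le_trans (by gcongr) (hZM i.1)
          gcongr
          exact hcX' i
      _ = ((M : ℝ) * L) * (2 ^ U * (2 ^ (w * M) * (2 / 2 ^ V))) := by simp
      _ ≤ _ := by gcongr
  have hsplit : ∑ i, (c i : ℂ) * ((z : ℂ) ^ (i.1 : ℕ) * Complex.exp ((i.2 : ℕ) * lam * z)) =
      ∑ i, (c i : ℂ) * ((z : ℂ) ^ (i.1 : ℕ) * tr i) + ∑ i, (c i : ℂ) * ((z : ℂ) ^ (i.1 : ℕ) *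
      (Complex.exp ((i.2 : ℕ) * lam * z) - tr i)) := by
    rw [← Finset.sum_add_distrib]
    refine Finset.sum_congr rfl fun i _ => by ring
  rw [hsplit]
  calc _ ≤ (2 ^ (w + 1) * (8 * 2 ^ (w + (w * M + 2 * E) + U) / 2 ^ V) +
        2 ^ w * (2 ^ U * (2 ^ (w * M) * (2 / 2 ^ V)))) * (2 : ℝ) ^ V := by
        gcongr
        exact (norm_add_le _ _).trans (add_le_add hmain htail)
    _ = 2 ^ (w * M + 2 * w + 2 * E + U + 4) + 2 ^ (w * M + w + U + 1) := by
        field_simp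
        ring
    _ ≤ 2 ^ (w * M + 2 * w + 2 * E + U + 4) + 2 ^ (w * M + 2 * w + 2 * E + U + 4) := by
        gcongr 2 ^ _ + ?_
        exact pow_le_pow_right₀ (by norm_num) (by omega)
    _ = _ := by rw [pow_succ _ (w * M + 2 * w + 2 * E + U + 4)]; ring

theorem eq_zero_of_norm_embedding_lt {K : Type*} [Field K] [NumberField K] {x : K}
    (hx : IsIntegral ℤ x) (φ₀ : K →+* ℂ) {B : ℝ} (hB : 1 ≤ B)
    (h : ∀ φ : K →+* ℂ, ‖φ x‖ ≤ B) (h0 : ‖φ₀ x‖ * B ^ finrank ℚ K < 1) : x = 0 := by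
  classical
  by_contra hx0
  have h1 : (1 : ℝ) ≤ ∏ φ : K →ₐ[ℚ] ℂ, ‖φ x‖ := by
    rw [← norm_prod, ← Algebra.norm_eq_prod_embeddings ℚ ℂ x]
    obtain ⟨y, hy⟩ : ∃ y : 𝓞 K, (y : K) = x := ⟨⟨x, hx⟩, rfl⟩
    have hy0 : y ≠ 0 := by rintro rfl; exact hx0 (by simpa using hy.symm)
    rw [← hy, ← Algebra.coe_norm_int]
    have : (1 : ℤ) ≤ |Algebra.norm ℤ y| := Int.one_le_abs (Algebra.norm_ne_zero_iff.mpr hy0)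
    have h3 : (1 : ℝ) ≤ |(Algebra.norm ℤ y : ℝ)| := by exact_mod_cast this
    simpa using h3
  have e0 : ‖(φ₀.toRatAlgHom : K →ₐ[ℚ] ℂ) x‖ = ‖φ₀ x‖ := rfl
  rw [← Finset.mul_prod_erase _ _ (Finset.mem_univ (φ₀.toRatAlgHom : K →ₐ[ℚ] ℂ)), e0] at h1
  have h2 : ∏ φ ∈ Finset.univ.erase (φ₀.toRatAlgHom : K →ₐ[ℚ] ℂ), ‖φ x‖ ≤
      B ^ finrank ℚ K := by
    refine (Finset.prod_le_prod (fun φ _ => norm_nonneg _)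
      fun (φ : K →ₐ[ℚ] ℂ) _ => h φ.toRingHom).trans ?_
    rw [Finset.prod_const]
    refine pow_le_pow_right₀ hB ?_
    refine (Finset.card_erase_le).trans ?_
    rw [Finset.card_univ, AlgHom.card]
  have : ‖φ₀ x‖ * B ^ finrank ℚ K ≥ 1 := h1.trans (by gcongr)
  linarith

theorem norm_pow_sub_one_le {γ : ℂ} {ε : ℝ} (h : ‖γ - 1‖ ≤ ε) (hε : ε ≤ 1) (n : ℕ) :
    ‖γ ^ n - 1‖ ≤ 2 ^ n * ε := by
  have hε0 : 0 ≤ ε := (norm_nonneg _).trans h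
  induction n with
  | zero => simpa using hε0
  | succ n ih =>
    have hγ : ‖γ‖ ≤ 2 := by
      calc ‖γ‖ = ‖(γ - 1) + 1‖ := by ring_nf
        _ ≤ ‖γ - 1‖ + ‖(1 : ℂ)‖ := norm_add_le _ _
        _ ≤ 2 := by rw [norm_one]; linarith
    have hγn : ‖γ ^ n‖ ≤ 2 ^ n := by rw [norm_pow]; gcongr
    calc ‖γ ^ (n + 1) - 1‖ = ‖γ ^ n * (γ - 1) + (γ ^ n - 1)‖ := by ring_nf
      _ ≤ ‖γ ^ n * (γ - 1)‖ + ‖γ ^ n - 1‖ := norm_add_le _ _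
      _ ≤ 2 ^ n * ε + 2 ^ n * ε := by rw [norm_mul]; gcongr
      _ = 2 ^ (n + 1) * ε := by ring

set_option maxHeartbeats 1000000 in
/-- The transcendence argument: under suitable parameter inequalities, an algebraic number of the
form `γ` attached to `η` and `ν` cannot be too close to `1` at a fixed embedding. -/
theorem false_of_norm_embedding_sub_one_le {K : Type*} [Field K] [NumberField K] (φ₀ : K →+* ℂ)
    {η ν γ : K} {g a₁ a₂ E w M L R S N D : ℕ} {lam : ℂ}
    (hη : IsIntegral ℤ η) (hη1 : ∀ φ : K →+* ℂ, ‖φ η‖ ≤ 2 ^ a₂)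
    (hν1 : ∀ φ : K →+* ℂ, ‖φ ν‖ ≤ 2 ^ a₁) (hg : IsIntegral ℤ (g * ν)) (hg1 : g ≤ 2 ^ a₁)
    (hinj : Function.Injective fun i : ℕ => η ^ i) (hη0 : η ≠ 0) (hν0 : ν ≠ 0) (hg0 : g ≠ 0)
    (hlam : Complex.exp lam = φ₀ η) (hνγ : ν = γ * η ^ N)
    (hγ : ‖φ₀ γ - 1‖ ≤ 1 / 2 ^ (12 * finrank ℚ K * D)) (hSN : S ≤ N) (hRS : M * L < R * S)
    (hD : w * (M + 1) + 2 * L * R * a₁ + L * (S + L) * a₂ ≤ D) (hED : E ≤ D) (ha₁ : 1 ≤ a₁)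
    (hMD : M ≤ D) (hML : 312 * finrank ℚ K ^ 2 * D ≤ M * L) (hDw : 12 * finrank ℚ K * D ≤ 2 ^ w)
    (hZ : R * N + S + L ≤ 2 ^ w) (hE : L * ‖lam‖ * (R * N + S + L : ℕ) ≤ E) (hM : 0 < M)
    (hD6 : 6 ≤ D) : False := by
  set d := finrank ℚ K with hd
  have hd1 : 1 ≤ d := finrank_pos
  set V := 12 * d * D with hV
  have hL : 0 < L := by
    rcases Nat.eq_zero_or_pos L with h | h
    · subst h
      have : 0 < 312 * d ^ 2 * D := by positivity
      omega
    · exact h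
  have hDV : 12 * D ≤ V := by rw [hV]; nlinarith
  have hMLw : M * L ≤ 2 ^ w := by nlinarith
  obtain ⟨c, hc0, hcU, hc⟩ := exists_exp_poly_small (M := M) (L := L) (U := D) (V := V) (E := E)
    (w := w) (lam := lam) (Z := R * N + S + L) (by omega) hZ hMLw hM hL (by omega) hDw hE (by omega)
    (by
      have : 2 * V * (M + V) ≤ 2 * V * (D + V) := by gcongr
      refine this.trans ?_
      have h2 : 2 * V * (D + V) ≤ D * (312 * d ^ 2 * D) := by
        rw [hV]
        have : D ≤ d * D := by nlinarith
        calc 2 * (12 * d * D) * (D + 12 * d * D) ≤ 2 * (12 * d * D) * (d * D + 12 * d * D) := by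
              gcongr
          _ = _ := by ring
      exact h2.trans (by gcongr))
  have hcU' : ∀ i (φ : K →+* ℂ), ‖φ (c i : K)‖ ≤ 2 ^ D := fun i φ => by
    rw [map_intCast, Complex.norm_intCast]; exact_mod_cast hcU i
  set G : ℕ → ℕ → K := fun r s => ∑ i, (c i : K) * (((r * N + s : ℕ) : K) ^ (i.1 : ℕ) *
    (η ^ s * ν ^ r) ^ (i.2 : ℕ)) with hG
  have hgC : (g : ℝ) ≤ 2 ^ a₁ := by exact_mod_cast hg1
  have hg1' : (1 : ℝ) ≤ g := by exact_mod_cast Nat.one_le_iff_ne_zero.mpr hg0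
  have hpow : ∀ {r s : ℕ}, r < R → s < S + L → ∀ i : Fin M,
      ((r * N + s : ℕ) : ℝ) ^ (i : ℕ) ≤ 2 ^ (w * M) := fun {r s} hr hs i => by
    have h1 : r * N + s ≤ 2 ^ w := by
      have : r * N ≤ R * N := by gcongr
      omega
    have h2 : ((r * N + s : ℕ) : ℝ) ≤ 2 ^ w := by exact_mod_cast h1
    calc _ ≤ ((2 : ℝ) ^ w) ^ (i : ℕ) := by gcongr
      _ ≤ (2 ^ w) ^ M := pow_le_pow_right₀ (one_le_pow₀ (by norm_num)) i.2.le
      _ = _ := by rw [← pow_mul]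
  have hzero : ∀ r < R, ∀ s < S + L, G r s = 0 := by
    intro r hr s hs
    have hrl : ∀ i : Fin L, r * i ≤ R * L := fun i => Nat.mul_le_mul hr.le i.2.le
    have hgpow : (g : ℝ) ^ (R * L) ≤ 2 ^ (R * L * a₁) := by
      calc _ ≤ ((2 : ℝ) ^ a₁) ^ (R * L) := by gcongr
        _ = _ := by rw [← pow_mul, mul_comm]
    have key : (g : K) ^ (R * L) * G r s = 0 := by
      refine eq_zero_of_norm_embedding_lt ?_ φ₀ (B := 2 ^ (2 * D)) (one_le_pow₀ (by norm_num)) ?_ ?_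
      · rw [hG, Finset.mul_sum]
        refine IsIntegral.sum _ fun i _ => ?_
        have : (g : K) ^ (R * L) * ((c i : K) * (((r * N + s : ℕ) : K) ^ (i.1 : ℕ) *
            (η ^ s * ν ^ r) ^ (i.2 : ℕ))) = (g : K) ^ (R * L - r * i.2) * ((c i : K) *
            (((r * N + s : ℕ) : K) ^ (i.1 : ℕ) * ((η ^ s) ^ (i.2 : ℕ) * (g * ν) ^ (r * i.2)))) := by
          conv_lhs => rw [← Nat.sub_add_cancel (hrl i.2), pow_add]
          rw [mul_pow, mul_pow, ← pow_mul ν]; ring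
        rw [this]
        exact ((isIntegral_natCast g).pow _).mul ((isIntegral_intCast _).mul
          (((isIntegral_natCast _).pow _).mul (((hη.pow _).pow _).mul (hg.pow _))))
      · intro φ
        rw [map_mul, map_pow, map_natCast, norm_mul, norm_pow, Complex.norm_natCast]
        have h1 : ‖φ (G r s)‖ ≤ 2 ^ w * (2 ^ D * (2 ^ (w * M) *
            (2 ^ (L * (S + L) * a₂) * 2 ^ (R * L * a₁)))) := by
          rw [hG, map_sum]
          calc _ ≤ ∑ i : Fin M × Fin L, (2 : ℝ) ^ D * (2 ^ (w * M) *
                (2 ^ (L * (S + L) * a₂) * 2 ^ (R * L * a₁))) := by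
                refine (norm_sum_le _ _).trans (Finset.sum_le_sum fun i _ => ?_)
                rw [map_mul, map_mul, map_pow, map_pow, map_mul, map_pow, map_pow, mul_pow,
                  norm_mul, norm_mul, norm_mul, map_natCast, norm_pow, Complex.norm_natCast,
                  ← pow_mul, ← pow_mul, norm_pow, norm_pow]
                have h2 : ‖φ η‖ ^ (s * (i.2 : ℕ)) ≤ 2 ^ (L * (S + L) * a₂) := by
                  calc _ ≤ ((2 : ℝ) ^ a₂) ^ (s * (i.2 : ℕ)) := by gcongr; exact hη1 φ
                    _ ≤ (2 ^ a₂) ^ ((S + L) * L) := pow_le_pow_right₀ (one_le_pow₀ (by norm_num))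
                        (Nat.mul_le_mul hs.le i.2.2.le)
                    _ = _ := by rw [← pow_mul]; ring_nf
                have h3 : ‖φ ν‖ ^ (r * (i.2 : ℕ)) ≤ 2 ^ (R * L * a₁) := by
                  calc _ ≤ ((2 : ℝ) ^ a₁) ^ (r * (i.2 : ℕ)) := by gcongr; exact hν1 φ
                    _ ≤ (2 ^ a₁) ^ (R * L) := pow_le_pow_right₀ (one_le_pow₀ (by norm_num)) (hrl _)
                    _ = _ := by rw [← pow_mul]; ring_nf
                have h4 := hpow hr hs i.1
                have h5 := hcU' i φ
                gcongr
            _ = ((M * L : ℕ) : ℝ) * (2 ^ D * (2 ^ (w * M) *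
                (2 ^ (L * (S + L) * a₂) * 2 ^ (R * L * a₁)))) := by simp
            _ ≤ _ := by
                gcongr
                exact_mod_cast hMLw
        calc _ ≤ (2 : ℝ) ^ (R * L * a₁) * (2 ^ w * (2 ^ D * (2 ^ (w * M) *
              (2 ^ (L * (S + L) * a₂) * 2 ^ (R * L * a₁))))) := by gcongr
          _ = 2 ^ (D + (w * (M + 1) + 2 * L * R * a₁ + L * (S + L) * a₂)) := by ring
          _ ≤ 2 ^ (2 * D) := pow_le_pow_right₀ (by norm_num) (by omega)
      · rw [map_mul, map_pow, map_natCast, norm_mul, norm_pow, Complex.norm_natCast]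
        have hz : r * N + s ≤ R * N + S + L := by
          have : r * N ≤ R * N := by gcongr
          omega
        have h1 := hc (r * N + s) hz
        set Φ := ∑ i, (c i : ℂ) * (((r * N + s : ℕ) : ℂ) ^ (i.1 : ℕ) *
          Complex.exp ((i.2 : ℕ) * lam * (r * N + s : ℕ))) with hΦ
        have h2 : ‖φ₀ (G r s) - Φ‖ ≤
            2 ^ w * (2 ^ D * (2 ^ (w * M) * (2 ^ (2 * E) * (2 ^ (R * L) * (1 / 2 ^ V))))) := by
          rw [hG, map_sum, hΦ, ← Finset.sum_sub_distrib]
          calc _ ≤ ∑ i : Fin M × Fin L, (2 : ℝ) ^ D * (2 ^ (w * M) *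
                (2 ^ (2 * E) * (2 ^ (R * L) * (1 / 2 ^ V)))) := by
                refine (norm_sum_le _ _).trans (Finset.sum_le_sum fun i _ => ?_)
                have e1 : φ₀ ((η ^ s * ν ^ r) ^ (i.2 : ℕ)) =
                    Complex.exp ((i.2 : ℕ) * lam * (r * N + s : ℕ)) *
                      (φ₀ γ) ^ (r * (i.2 : ℕ)) := by
                  rw [hνγ]
                  simp only [map_mul, map_pow]
                  rw [← hlam]
                  have : Complex.exp ((i.2 : ℕ) * lam * (r * N + s : ℕ)) =
                      Complex.exp lam ^ ((i.2 : ℕ) * (r * N + s)) := by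
                    rw [← Complex.exp_nat_mul]; push_cast; ring_nf
                  rw [this]; ring
                have e2 : φ₀ ((c i : K) * (((r * N + s : ℕ) : K) ^ (i.1 : ℕ) *
                    (η ^ s * ν ^ r) ^ (i.2 : ℕ))) - (c i : ℂ) * (((r * N + s : ℕ) : ℂ) ^ (i.1 : ℕ) *
                    Complex.exp ((i.2 : ℕ) * lam * (r * N + s : ℕ))) =
                    φ₀ (c i : K) * (((r * N + s : ℕ) : ℂ) ^ (i.1 : ℕ) *
                    (Complex.exp ((i.2 : ℕ) * lam * (r * N + s : ℕ)) *
                    ((φ₀ γ) ^ (r * (i.2 : ℕ)) - 1))) := by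
                  rw [map_mul, map_mul, e1, map_pow, map_natCast, map_intCast]; ring
                rw [e2, norm_mul, norm_mul, norm_mul, norm_pow, Complex.norm_natCast]
                have h3 : ‖Complex.exp ((i.2 : ℕ) * lam * (r * N + s : ℕ))‖ ≤ 2 ^ (2 * E) := by
                  refine (Complex.norm_exp_le_exp_norm _).trans ?_
                  have : ‖((i.2 : ℕ) : ℂ) * lam * (r * N + s : ℕ)‖ ≤ E := by
                    refine le_trans ?_ hE
                    rw [norm_mul, norm_mul, Complex.norm_natCast, Complex.norm_natCast]
                    have h4 : ((r * N + s : ℕ) : ℝ) ≤ (R * N + S + L : ℕ) := by exact_mod_cast hz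
                    have h5 : ((i.2 : ℕ) : ℝ) ≤ L := by exact_mod_cast i.2.2.le
                    gcongr
                  refine (Real.exp_le_exp.mpr this).trans ?_
                  rw [← Real.exp_one_pow, pow_mul]
                  have := Real.exp_one_lt_d9
                  gcongr
                  linarith
                have h4 : ‖(φ₀ γ) ^ (r * (i.2 : ℕ)) - 1‖ ≤ 2 ^ (R * L) * (1 / 2 ^ V) := by
                  refine (norm_pow_sub_one_le hγ ?_ _).trans ?_
                  · rw [div_le_one (by positivity)]; exact one_le_pow₀ (by norm_num)
                  · exact mul_le_mul_of_nonneg_right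
                      (pow_le_pow_right₀ (by norm_num) (hrl _)) (by positivity)
                have h5 := hpow hr hs i.1
                have h6 := hcU' i φ₀
                gcongr
            _ = ((M * L : ℕ) : ℝ) * (2 ^ D * (2 ^ (w * M) *
                (2 ^ (2 * E) * (2 ^ (R * L) * (1 / 2 ^ V))))) := by simp
            _ ≤ _ := by
                gcongr
                exact_mod_cast hMLw
        have hwM : w * M + w ≤ D := by
          have : w * (M + 1) = w * M + w := by ring
          omega
        have hRL : R * L ≤ R * L * a₁ := Nat.le_mul_of_pos_right _ ha₁
        have hRLa : 2 * (R * L * a₁) ≤ D := by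
          have : 2 * L * R * a₁ = 2 * (R * L * a₁) := by ring
          omega
        have h3 : ‖φ₀ (G r s)‖ * 2 ^ V ≤ 2 ^ (6 * D + 6) := by
          have e : φ₀ (G r s) = Φ + (φ₀ (G r s) - Φ) := by ring
          calc ‖φ₀ (G r s)‖ * 2 ^ V ≤ (‖Φ‖ + ‖φ₀ (G r s) - Φ‖) * 2 ^ V := by
                gcongr
                conv_lhs => rw [e]
                exact norm_add_le _ _
            _ ≤ 2 ^ (w * M + 2 * w + 2 * E + D + 5) + 2 ^ w * (2 ^ D * (2 ^ (w * M) *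
                (2 ^ (2 * E) * (2 ^ (R * L) * (1 / 2 ^ V))))) * 2 ^ V := by
                rw [add_mul]; gcongr
            _ = 2 ^ (w * M + 2 * w + 2 * E + D + 5) + 2 ^ (w + D + w * M + 2 * E + R * L) := by
                field_simp; ring
            _ ≤ 2 ^ (6 * D + 5) + 2 ^ (6 * D + 5) :=
                add_le_add (pow_le_pow_right₀ (by norm_num) (by omega))
                  (pow_le_pow_right₀ (by norm_num) (by omega))
            _ = _ := by rw [pow_succ _ (6 * D + 5)]; ring
        have h4 : ((g : ℝ) ^ (R * L) * ‖φ₀ (G r s)‖ * (2 ^ (2 * D)) ^ d) * 2 ^ V <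
            1 * 2 ^ V := by
          calc _ = (g : ℝ) ^ (R * L) * (2 ^ (2 * D)) ^ d * (‖φ₀ (G r s)‖ * 2 ^ V) := by ring
            _ ≤ 2 ^ (R * L * a₁) * (2 ^ (2 * D)) ^ d * 2 ^ (6 * D + 6) := by gcongr
            _ = 2 ^ (R * L * a₁ + 2 * D * d + (6 * D + 6)) := by
                rw [← pow_mul, ← pow_add, ← pow_add]
            _ < 2 ^ V := by
                refine pow_lt_pow_right₀ (by norm_num) ?_
                rw [hV]
                have : D ≤ D * d := Nat.le_mul_of_pos_right _ hd1
                have e : 12 * d * D = 2 * D * d + 10 * (D * d) := by ring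
                omega
            _ = _ := (one_mul _).symm
        exact lt_of_mul_lt_mul_right h4 (by positivity)
    rcases mul_eq_zero.mp key with h | h
    · exact absurd h (pow_ne_zero _ (by exact_mod_cast hg0))
    · exact h
  -- contradiction with the zero estimate
  classical
  set P : ℕ → Polynomial K := fun l => ∑ k : Fin M, if hl : l < L then
    Polynomial.C (c (k, ⟨l, hl⟩) : K) * Polynomial.X ^ (k : ℕ) else 0 with hP
  obtain ⟨r, hr, s, hs, hne⟩ := exists_eval_ne_zero_of_pow_injective M L R S N η ν hinj hη0 hν0 P
    (by
      intro l hl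
      refine Polynomial.natDegree_sum_le_of_forall_le _ _ fun k _ => ?_
      rw [dif_pos hl]
      exact (Polynomial.natDegree_C_mul_X_pow_le _ _).trans k.2.le)
    (by
      obtain ⟨i, hi⟩ := Function.ne_iff.mp hc0
      refine ⟨i.2, i.2.2, fun h => hi ?_⟩
      have := congrArg (fun p => p.coeff (i.1 : ℕ)) h
      simp only [hP, Polynomial.finsetSum_coeff, Fin.is_lt, dif_pos, Polynomial.coeff_C_mul,
        Polynomial.coeff_X_pow, Polynomial.coeff_zero] at this
      rw [Finset.sum_eq_single i.1] at this
      · simpa using this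
      · intro b _ hb
        rw [if_neg]
        · simp
        · intro h; exact hb (Fin.ext h.symm)
      · simp)
    hSN (by rw [mul_comm]; exact hRS)
  apply hne
  rw [← hzero r hr s hs]
  simp only [hG]
  rw [Fintype.sum_prod_type_right,
    ← Fin.sum_univ_eq_sum_range (fun l => (P l).eval ((r * N + s : ℕ) : K) *
      (η ^ s * ν ^ r) ^ l) L]
  refine Finset.sum_congr rfl fun l _ => ?_
  simp only [hP, Polynomial.eval_finsetSum, Fin.is_lt, dif_pos, Polynomial.eval_mul,
    Polynomial.eval_C, Polynomial.eval_pow, Polynomial.eval_X]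
  rw [Finset.sum_mul]
  refine Finset.sum_congr rfl fun k _ => by ring

theorem NumberField.InfinitePlace.one_le_prod_pow_mult {K : Type*} [Field K] [NumberField K] {a : 𝓞 K}
    (ha : a ≠ 0) : 1 ≤ ∏ w : InfinitePlace K, w (a : K) ^ w.mult := by
  rw [InfinitePlace.prod_eq_abs_norm, ← Algebra.coe_norm_int]
  have : (1 : ℤ) ≤ |Algebra.norm ℤ a| := Int.one_le_abs (Algebra.norm_ne_zero_iff.mpr ha)
  exact_mod_cast this

theorem NumberField.InfinitePlace.prod_pow_mult_le_of_dvd {K : Type*} [Field K] [NumberField K]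
    {a : 𝓞 K} {g : ℕ} (hg : g ≠ 0) (ha : a ∣ (g : 𝓞 K)) :
    ∏ w : InfinitePlace K, w (a : K) ^ w.mult ≤ (g : ℝ) ^ finrank ℚ K := by
  obtain ⟨c, hc⟩ := ha
  have hc0 : c ≠ 0 := by
    rintro rfl
    rw [mul_zero] at hc
    exact hg (by exact_mod_cast hc)
  have h1 := one_le_prod_pow_mult hc0
  have h2 : ∏ w : InfinitePlace K, w ((g : 𝓞 K) : K) ^ w.mult = (g : ℝ) ^ finrank ℚ K := by
    rw [← InfinitePlace.sum_mult_eq, ← Finset.prod_pow_eq_pow_sum]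
    refine Finset.prod_congr rfl fun w _ => ?_
    rw [show ((g : 𝓞 K) : K) = (g : K) from map_natCast _ g, ← w.norm_embedding_eq (g : K),
      map_natCast, Complex.norm_natCast]
  rw [← h2, hc]
  simp only [map_mul, mul_pow, Finset.prod_mul_distrib]
  refine le_mul_of_one_le_right (Finset.prod_nonneg fun w _ => by positivity) h1

theorem exists_abs_log_sub_le {K : Type*} [Field K] [NumberField K] {b₀ b₁ : 𝓞 K} {g : ℕ}
    (hb₀ : b₀ ≠ 0) (hb₁ : b₁ ≠ 0) (hg : g ≠ 0) (hg₀ : b₀ ∣ (g : 𝓞 K)) (hg₁ : b₁ ∣ (g : 𝓞 K))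
    {t : ℝ} (ht0 : 0 ≤ t) (ht1 : t ≤ 1) {M : ℕ}
    (hM : M = (((discr K).natAbs + 1) * g ^ 2) ^ finrank ℚ K) :
    ∃ a : 𝓞 K, a ≠ 0 ∧ (Algebra.norm ℤ a).natAbs ≤ M ∧
      ∀ w : InfinitePlace K,
        |Real.log (w (a : K)) - t * Real.log (w ((b₁ : K) / b₀))| ≤ Real.log M := by
  classical
  set d := finrank ℚ K with hd
  have hd1 : 1 ≤ d := finrank_pos
  set κ : ℝ := ((discr K).natAbs : ℝ) + 1 with hκ
  set β : K := (b₁ : K) / b₀ with hβ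
  have hβ0 : β ≠ 0 := div_ne_zero (by simpa using hb₁) (by simpa using hb₀)
  have hwβ : ∀ w : InfinitePlace K, 0 < w β := fun w => w.pos_iff.mpr hβ0
  have hg1 : (1 : ℝ) ≤ g := by exact_mod_cast Nat.one_le_iff_ne_zero.mpr hg
  have hκ1 : 1 ≤ κ := by rw [hκ]; linarith [(Nat.cast_nonneg (discr K).natAbs : (0 : ℝ) ≤ _)]
  have hMR : (M : ℝ) = (κ * g ^ 2) ^ d := by rw [hM, hκ]; push_cast; rfl
  have hM1 : (1 : ℝ) ≤ M := by
    rw [hMR]; exact one_le_pow₀ (one_le_mul_of_one_le_of_one_le hκ1 (one_le_pow₀ hg1))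
  set f : InfinitePlace K → ℝ := fun w => κ * g * (w β) ^ t with hf
  have hf0 : ∀ w, 0 < f w := fun w => by
    have := Real.rpow_pos_of_pos (hwβ w) t
    simp only [hf]; positivity
  set n := ∏ w : InfinitePlace K, (w β) ^ w.mult with hn
  have hn0 : 0 < n := Finset.prod_pos fun w _ => pow_pos (hwβ w) _
  have hprod : ∏ w : InfinitePlace K, f w ^ w.mult = (κ * g) ^ d * n ^ t := by
    simp only [hf, mul_pow _ (_ ^ t)]
    rw [Finset.prod_mul_distrib, Finset.prod_pow_eq_pow_sum, InfinitePlace.sum_mult_eq]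
    congr 1
    rw [hn, ← Real.finsetProd_rpow _ _ (fun w _ => pow_nonneg (hwβ w).le _)]
    refine Finset.prod_congr rfl fun w _ => ?_
    rw [← Real.rpow_natCast, ← Real.rpow_mul (hwβ w).le, mul_comm, Real.rpow_mul (hwβ w).le,
      Real.rpow_natCast]
  have hneq : n * ∏ w : InfinitePlace K, w (b₀ : K) ^ w.mult =
      ∏ w : InfinitePlace K, w (b₁ : K) ^ w.mult := by
    rw [hn, ← Finset.prod_mul_distrib]
    refine Finset.prod_congr rfl fun w _ => ?_
    rw [← mul_pow, ← map_mul, hβ, div_mul_cancel₀ _ (by simpa using hb₀)]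
  have l0 := InfinitePlace.one_le_prod_pow_mult hb₀
  have l1 := InfinitePlace.one_le_prod_pow_mult hb₁
  have u0 := InfinitePlace.prod_pow_mult_le_of_dvd hg hg₀
  have u1 := InfinitePlace.prod_pow_mult_le_of_dvd hg hg₁
  rw [← hneq] at l1 u1
  have hgd : (1 : ℝ) ≤ (g : ℝ) ^ d := one_le_pow₀ hg1
  have hnu : n ^ t ≤ (g : ℝ) ^ d := by
    have h1 : n ≤ (g : ℝ) ^ d := (le_mul_of_one_le_right hn0.le l0).trans u1
    calc n ^ t ≤ ((g : ℝ) ^ d) ^ t := Real.rpow_le_rpow hn0.le h1 ht0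
      _ ≤ ((g : ℝ) ^ d) ^ (1 : ℝ) := Real.rpow_le_rpow_of_exponent_le hgd ht1
      _ = _ := Real.rpow_one _
  have hnl : 1 ≤ (g : ℝ) ^ d * n ^ t := by
    have h1 : 1 ≤ n * (g : ℝ) ^ d := l1.trans (by gcongr)
    have h2 : 1 ≤ n ^ t * ((g : ℝ) ^ d) ^ t := by
      rw [← Real.mul_rpow hn0.le (by positivity)]; exact Real.one_le_rpow h1 ht0
    have h3 : ((g : ℝ) ^ d) ^ t ≤ (g : ℝ) ^ d := by
      calc _ ≤ ((g : ℝ) ^ d) ^ (1 : ℝ) := Real.rpow_le_rpow_of_exponent_le hgd ht1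
        _ = _ := Real.rpow_one _
    rw [mul_comm]
    exact h2.trans (by gcongr)
  have hprodM : ∏ w : InfinitePlace K, f w ^ w.mult ≤ M := by
    rw [hprod, hMR]
    calc _ ≤ (κ * g) ^ d * (g : ℝ) ^ d := by gcongr
      _ = _ := by rw [← mul_pow]; ring
  obtain ⟨a, -, ha0, ha⟩ := exists_mem_ideal_place_lt (⊤ : Ideal (𝓞 K)) top_ne_bot f hf0 (by
    rw [Ideal.absNorm_top, Nat.cast_one, one_mul, hprod, mul_pow, mul_assoc]
    have h1 : √|(discr K : ℝ)| < κ := by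
      rw [Real.sqrt_lt' (by linarith), hκ, Nat.cast_natAbs, Int.cast_abs]
      nlinarith [abs_nonneg (discr K : ℝ)]
    calc √|(discr K : ℝ)| < κ := h1
      _ ≤ κ ^ d := le_self_pow₀ hκ1 (by omega)
      _ ≤ _ := le_mul_of_one_le_right (by positivity) hnl)
  have hwa : ∀ w : InfinitePlace K, 0 < w (a : K) := fun w => w.pos_iff.mpr (by simpa using ha0)
  refine ⟨a, ha0, ?_, fun w => ?_⟩
  · have h1 : (((Algebra.norm ℤ a).natAbs : ℕ) : ℝ) = ∏ w : InfinitePlace K, w (a : K) ^ w.mult := by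
      rw [InfinitePlace.prod_eq_abs_norm, ← Algebra.coe_norm_int, Nat.cast_natAbs]
      push_cast; rfl
    have : (((Algebra.norm ℤ a).natAbs : ℕ) : ℝ) ≤ M := by
      rw [h1]
      refine le_trans ?_ hprodM
      exact Finset.prod_le_prod (fun w _ => by positivity) fun w _ =>
        pow_le_pow_left₀ (hwa w).le (ha w).le _
    exact_mod_cast this
  · have hlow : f w ≤ w (a : K) * M := by
      have h1 : f w ^ w.mult ≤ w (a : K) ^ w.mult * M := by
        have h2 : 1 ≤ w (a : K) ^ w.mult * ∏ v ∈ Finset.univ.erase w, f v ^ v.mult := by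
          refine (InfinitePlace.one_le_prod_pow_mult ha0).trans ?_
          rw [← Finset.mul_prod_erase _ _ (Finset.mem_univ w)]
          gcongr with v _
          exact (ha v).le
        calc f w ^ w.mult ≤ f w ^ w.mult *
              (w (a : K) ^ w.mult * ∏ v ∈ Finset.univ.erase w, f v ^ v.mult) :=
              le_mul_of_one_le_right (pow_nonneg (hf0 w).le _) h2
          _ = w (a : K) ^ w.mult * (f w ^ w.mult * ∏ v ∈ Finset.univ.erase w, f v ^ v.mult) := by
              ring
          _ = w (a : K) ^ w.mult * ∏ v, f v ^ v.mult := by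
              rw [Finset.mul_prod_erase _ (fun v => f v ^ v.mult) (Finset.mem_univ w)]
          _ ≤ _ := by gcongr
      have h3 : f w ^ w.mult ≤ (w (a : K) * M) ^ w.mult := by
        refine h1.trans ?_
        rw [mul_pow]
        gcongr
        exact le_self_pow₀ hM1 InfinitePlace.mult_ne_zero
      exact le_of_pow_le_pow_left₀ InfinitePlace.mult_ne_zero
        (mul_nonneg (hwa w).le (by linarith)) h3
    have hlogf : Real.log (f w) = Real.log (κ * g) + t * Real.log (w β) := by
      simp only [hf]
      rw [Real.log_mul (by positivity) (Real.rpow_pos_of_pos (hwβ w) t).ne', Real.log_rpow (hwβ w)]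
    have h1 : Real.log (w (a : K)) ≤ Real.log (f w) := Real.log_le_log (hwa w) (ha w).le
    have h2 : Real.log (f w) ≤ Real.log (w (a : K)) + Real.log M := by
      rw [← Real.log_mul (hwa w).ne' (by positivity)]
      exact Real.log_le_log (hf0 w) hlow
    have h3 : 0 ≤ Real.log (κ * g) := Real.log_nonneg (one_le_mul_of_one_le_of_one_le hκ1 hg1)
    have h4 : Real.log (κ * g) ≤ Real.log M := by
      refine Real.log_le_log (by positivity) ?_
      rw [hMR]
      refine le_trans ?_ (le_self_pow₀ (one_le_mul_of_one_le_of_one_le hκ1 (one_le_pow₀ hg1))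
        (by omega))
      gcongr
      exact le_self_pow₀ hg1 (by norm_num)
    rw [abs_le]
    constructor <;> linarith

theorem abs_sub_le_of_floor_mul_eq {x y : ℝ} {Q : ℕ} (hQ : 1 ≤ Q) (hx : 0 ≤ x) (hy : 0 ≤ y)
    (h : ⌊(Q : ℝ) * x⌋₊ = ⌊(Q : ℝ) * y⌋₊) : |x - y| ≤ 1 / Q := by
  have hQ' : (0 : ℝ) < Q := by exact_mod_cast hQ
  have h1 := Nat.floor_le (mul_nonneg hQ'.le hx)
  have h2 := Nat.lt_floor_add_one ((Q : ℝ) * x)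
  have h3 := Nat.floor_le (mul_nonneg hQ'.le hy)
  have h4 := Nat.lt_floor_add_one ((Q : ℝ) * y)
  rw [h] at h1 h2
  have h5 : |x - y| * Q = |(x - y) * Q| := by rw [abs_mul, abs_of_pos hQ']
  rw [le_div_iff₀ hQ', h5, abs_le]
  constructor <;> linarith

theorem exists_log_near_multiple {K : Type*} [Field K] [NumberField K] (φ₀ : K →+* ℂ)
    {b₀ b₁ : 𝓞 K} {g : ℕ} (hb₀ : b₀ ≠ 0) (hb₁ : b₁ ≠ 0) (hg : g ≠ 0) (hg₀ : b₀ ∣ (g : 𝓞 K))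
    (hg₁ : b₁ ∣ (g : 𝓞 K)) {M : ℕ}
    (hM : M = (((discr K).natAbs + 1) * g ^ 2) ^ finrank ℚ K) {Q J : ℕ} (hQ : 1 ≤ Q)
    (hJ : (16 * Q * M) ^ (3 * finrank ℚ K) ≤ J) {B : ℝ} (hB : J ≤ B) :
    ∃ (η : K) (q : ℕ) (lam : ℂ), IsIntegral ℤ η ∧ η ≠ 0 ∧ 1 ≤ q ∧ q ≤ J ∧
      Complex.exp lam = φ₀ η ∧ |lam.im| ≤ 1 / Q ∧ lam.re = Real.log ‖φ₀ η‖ ∧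
      ∀ w : InfinitePlace K,
        |Real.log (w η) - q / B * Real.log (w ((b₁ : K) / b₀))| ≤ 1 / Q := by
  classical
  set d := finrank ℚ K with hd
  have hd1 : 1 ≤ d := finrank_pos
  have hM1 : 1 ≤ M := by
    rw [hM]; exact Nat.one_le_pow _ _ (by positivity)
  have hJ1 : 1 ≤ J := le_trans (Nat.one_le_pow _ _ (by positivity)) hJ
  have hB0 : 0 < B := lt_of_lt_of_le (by exact_mod_cast hJ1) hB
  have hjB : ∀ j : Fin (J + 1), ((j : ℕ) : ℝ) / B ≤ 1 := fun j => by
    rw [div_le_one hB0]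
    exact le_trans (by exact_mod_cast Nat.lt_succ_iff.mp j.2) hB
  choose a ha0 haN ha using fun j : Fin (J + 1) =>
    exists_abs_log_sub_le hb₀ hb₁ hg hg₀ hg₁ (t := (j : ℕ) / B) (by positivity) (hjB j) hM
  have hlogM : Real.log M ≤ M := (Real.log_le_sub_one_of_pos (by positivity)).trans (by linarith)
  have hlogM0 : 0 ≤ Real.log M := Real.log_natCast_nonneg M
  have hN0 : ∀ j, 0 < (Algebra.norm ℤ (a j)).natAbs := fun j =>
    Int.natAbs_pos.mpr (Algebra.norm_ne_zero_iff.mpr (ha0 j))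
  set b := RingOfIntegers.basis K
  have hδ0 : ∀ (j : Fin (J + 1)) (w : InfinitePlace K),
      0 ≤ Real.log (w (a j : K)) - ((j : ℕ) : ℝ) / B * Real.log (w ((b₁ : K) / b₀)) +
      Real.log M := fun j w => by
    have := (abs_le.mp (ha j w)).1; linarith
  have harg0 : ∀ j, 0 ≤ (φ₀ (a j)).arg + Real.pi := fun j => by
    have := Complex.neg_pi_lt_arg (φ₀ (a j)); linarith
  let F : Fin (J + 1) → Fin (M + 1) × (Module.Free.ChooseBasisIndex ℤ (𝓞 K) → Fin (M + 1)) ×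
      (InfinitePlace K → Fin (2 * Q * M + 1)) × Fin (7 * Q + 1) := fun j =>
    (⟨(Algebra.norm ℤ (a j)).natAbs, Nat.lt_succ_of_le (haN j)⟩,
     fun i => ⟨(b.repr (a j) i % ((Algebra.norm ℤ (a j)).natAbs : ℤ)).toNat, by
      have h0 := haN j
      have h1 : ((Algebra.norm ℤ (a j)).natAbs : ℤ) ≠ 0 := by have := hN0 j; omega
      have h2 := Int.emod_nonneg (b.repr (a j) i) h1
      have h3 := Int.emod_lt_of_pos (b.repr (a j) i)
        (show (0 : ℤ) < ((Algebra.norm ℤ (a j)).natAbs : ℤ) by have := hN0 j; omega)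
      omega⟩,
     fun w => ⟨⌊(Q : ℝ) * (Real.log (w (a j : K)) - ((j : ℕ) : ℝ) / B *
      Real.log (w ((b₁ : K) / b₀)) + Real.log M)⌋₊, by
      rw [Nat.lt_succ_iff]
      refine Nat.floor_le_of_le ?_
      have := (abs_le.mp (ha j w)).2
      push_cast
      have hQ0 : (0 : ℝ) ≤ Q := by positivity
      nlinarith⟩,
     ⟨⌊(Q : ℝ) * ((φ₀ (a j)).arg + Real.pi)⌋₊, by
      rw [Nat.lt_succ_iff]
      refine Nat.floor_le_of_le ?_
      have h1 := Complex.arg_le_pi (φ₀ (a j))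
      have h2 := Real.pi_lt_d2
      push_cast
      have hQ0 : (0 : ℝ) ≤ Q := by positivity
      nlinarith⟩)
  have hcard : Fintype.card (Fin (M + 1) × (Module.Free.ChooseBasisIndex ℤ (𝓞 K) → Fin (M + 1)) ×
      (InfinitePlace K → Fin (2 * Q * M + 1)) × Fin (7 * Q + 1)) < Fintype.card (Fin (J + 1)) := by
    simp only [Fintype.card_prod, Fintype.card_fin, Fintype.card_fun]
    rw [← Module.finrank_eq_card_chooseBasisIndex, RingOfIntegers.rank, ← hd]
    have hr : Fintype.card (InfinitePlace K) ≤ d := by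
      rw [hd, ← InfinitePlace.sum_mult_eq, ← Finset.card_univ, Finset.card_eq_sum_ones]
      exact Finset.sum_le_sum fun w _ => w.mult_pos
    rw [Nat.lt_succ_iff]
    refine le_trans ?_ hJ
    have hQM : 1 ≤ Q * M := Nat.mul_pos hQ hM1
    have m1 : M ≤ Q * M := Nat.le_mul_of_pos_left _ hQ
    have m2 : Q ≤ Q * M := Nat.le_mul_of_pos_right _ hM1
    have e1 : (2 * Q * M + 1) ^ Fintype.card (InfinitePlace K) ≤ (3 * (Q * M)) ^ d := by
      refine (Nat.pow_le_pow_right (by omega) hr).trans (Nat.pow_le_pow_left ?_ _)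
      rw [mul_assoc]; omega
    calc (M + 1) * ((M + 1) ^ d * ((2 * Q * M + 1) ^ Fintype.card (InfinitePlace K) * (7 * Q + 1)))
        ≤ (2 * M) * ((2 * M) ^ d * ((3 * (Q * M)) ^ d * (8 * Q))) := by
          gcongr <;> omega
      _ = 16 * (Q * M) * ((2 * M) ^ d * (3 * (Q * M)) ^ d) := by ring
      _ ≤ (16 * (Q * M)) ^ d * ((16 * (Q * M)) ^ d * (16 * (Q * M)) ^ d) := by
          gcongr
          · exact Nat.le_self_pow (by omega) _
          · omega
          · norm_num
      _ = _ := by rw [← pow_add, ← pow_add, mul_assoc 16]; congr 1; ring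
  obtain ⟨j, j', hlt, hF⟩ : ∃ j j' : Fin (J + 1), j' < j ∧ F j = F j' := by
    obtain ⟨j, j', hne, h⟩ := Fintype.exists_ne_map_eq_of_card_lt F hcard
    rcases lt_or_gt_of_ne hne with h1 | h1
    · exact ⟨j', j, h1, h.symm⟩
    · exact ⟨j, j', h1, h⟩
  simp only [F, Prod.mk.injEq, Fin.mk.injEq] at hF
  obtain ⟨hFn, hFc, hFw, hFa⟩ := hF
  -- `a j'` divides `a j`
  set n := (Algebra.norm ℤ (a j')).natAbs with hn
  have hdvd : ∀ i, (n : ℤ) ∣ b.repr (a j) i - b.repr (a j') i := fun i => by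
    have h1 := congrArg Fin.val (congrFun hFc i)
    simp only [hFn, ← hn] at h1
    have h0 : (n : ℤ) ≠ 0 := by have := hN0 j'; omega
    have h2 := Int.emod_nonneg (b.repr (a j) i) h0
    have h3 := Int.emod_nonneg (b.repr (a j') i) h0
    exact Int.ModEq.dvd (show b.repr (a j') i ≡ b.repr (a j) i [ZMOD n] by
      unfold Int.ModEq; omega)
  choose c hc using hdvd
  have hsub : a j - a j' = (n : 𝓞 K) * ∑ i, c i • b i := by
    rw [← b.sum_repr (a j), ← b.sum_repr (a j'), ← Finset.sum_sub_distrib, Finset.mul_sum]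
    refine Finset.sum_congr rfl fun i _ => ?_
    rw [← sub_smul, hc, mul_smul, zsmul_eq_mul, Int.cast_natCast]
  have hdvd' : a j' ∣ (n : 𝓞 K) := by
    have h1 := Ideal.absNorm_mem (Ideal.span {a j'})
    rwa [Ideal.absNorm_span_singleton, Ideal.mem_span_singleton] at h1
  obtain ⟨u, hu⟩ : a j' ∣ a j := by
    have : a j = a j' + (n : 𝓞 K) * ∑ i, c i • b i := by rw [← hsub]; ring
    rw [this]
    exact dvd_add dvd_rfl (hdvd'.mul_right _)
  have huK : (a j : K) = a j' * u := by rw [hu]; simp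
  have hu0 : (u : K) ≠ 0 := by
    intro h
    rw [h, mul_zero] at huK
    exact ha0 j (by simpa using huK)
  have haj : ∀ k, φ₀ (a k) ≠ 0 := fun k => by
    rw [Ne, map_eq_zero]; simpa using ha0 k
  have hφu : φ₀ (a j) = φ₀ (a j') * φ₀ u := by rw [huK, map_mul]
  have hj'j : (j' : ℕ) < j := hlt
  refine ⟨u, (j : ℕ) - j', Complex.log (φ₀ (a j)) - Complex.log (φ₀ (a j')),
    u.isIntegral_coe, hu0, by omega, by have := j.2; omega, ?_, ?_, ?_, fun w => ?_⟩
  · rw [Complex.exp_sub, Complex.exp_log (haj j), Complex.exp_log (haj j'), hφu,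
      mul_div_cancel_left₀ _ (haj j')]
  · rw [Complex.sub_im, Complex.log_im, Complex.log_im]
    have := abs_sub_le_of_floor_mul_eq hQ (harg0 j) (harg0 j') hFa
    simpa using this
  · rw [Complex.sub_re, Complex.log_re, Complex.log_re, hφu, norm_mul, Real.log_mul]
    · ring
    · simpa using haj j'
    · simpa using hu0
  · have h1 := congrArg Fin.val (congrFun hFw w)
    have h2 := abs_sub_le_of_floor_mul_eq hQ (hδ0 j w) (hδ0 j' w) h1
    refine le_trans (le_of_eq ?_) h2
    congr 1
    have hwpos : ∀ {x : K}, x ≠ 0 → w x ≠ 0 := fun hx => (w.pos_iff.mpr hx).ne'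
    rw [huK, map_mul, Real.log_mul (hwpos (by simpa using ha0 j')) (hwpos hu0),
      Nat.cast_sub hj'j.le]
    ring

theorem abs_log_norm_le {z : ℂ} {δ : ℝ} (hz : ‖z - 1‖ ≤ δ) (hδ : δ ≤ 1 / 2) :
    |Real.log ‖z‖| ≤ 2 * δ := by
  have h1 : |‖z‖ - 1| ≤ δ := by
    have := abs_norm_sub_norm_le z 1
    rw [norm_one] at this
    exact this.trans hz
  obtain ⟨h2, h3⟩ := abs_le.mp h1
  have hpos : 0 < ‖z‖ := by linarith
  have h4 := Real.log_le_sub_one_of_pos hpos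
  have h5 := Real.one_sub_inv_le_log_of_pos hpos
  have h6 : ‖z‖⁻¹ ≤ 1 + 2 * δ := by
    rw [inv_le_iff_one_le_mul₀ hpos]
    nlinarith
  rw [abs_le]
  constructor <;> linarith

theorem norm_inv_sub_one_le {z : ℂ} {δ : ℝ} (hz : ‖z - 1‖ ≤ δ) (hδ : δ ≤ 1 / 2) :
    ‖z⁻¹ - 1‖ ≤ 2 * δ := by
  have h1 : 1 - δ ≤ ‖z‖ := by
    have := norm_sub_norm_le 1 z
    rw [norm_one, norm_sub_rev] at this
    linarith
  have hpos : 0 < ‖z‖ := by linarith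
  have hz0 : z ≠ 0 := norm_pos_iff.mp hpos
  have : z⁻¹ - 1 = -((z - 1) / z) := by field_simp; ring
  rw [this, norm_neg, norm_div, div_le_iff₀ hpos]
  have := (norm_nonneg _).trans hz
  nlinarith

theorem exp_two_mul_le (k : ℕ) : Real.exp (2 * k) ≤ (2 : ℝ) ^ (3 * k) := by
  have h : Real.exp 2 ≤ 2 ^ 3 := by
    have h1 := Real.exp_one_lt_d9
    have h2 : Real.exp 2 = Real.exp 1 ^ 2 := by rw [← Real.exp_nat_mul]; norm_num
    rw [h2]
    nlinarith [Real.exp_pos 1]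
  rw [pow_mul, mul_comm, Real.exp_nat_mul]
  exact pow_le_pow_left₀ (Real.exp_pos _).le h _

theorem exists_floor_parameters {B : ℝ} {Q J h q : ℕ} (hh : 1 ≤ h) (h3 : 3 * h ≤ Q)
    (hQJ : Q ≤ J) (hq : 1 ≤ q) (hqJ : q ≤ J) (hB : 2 * (Q : ℝ) * J ^ 2 ≤ B) :
    ∃ N P : ℕ, (N : ℝ) * q ≤ B ∧ B - N * q ≤ q ∧ J ≤ P ∧ (N : ℝ) / Q ≤ P ∧ h * P ≤ N ∧ P ≤ N ∧
      (q : ℝ) * P * Q ≤ 2 * B := by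
  have hQ1 : 1 ≤ Q := by omega
  have hqR : (1 : ℝ) ≤ q := by exact_mod_cast hq
  have hQR : (1 : ℝ) ≤ Q := by exact_mod_cast hQ1
  have hqJR : (q : ℝ) ≤ J := by exact_mod_cast hqJ
  have hQJR : (Q : ℝ) ≤ J := by exact_mod_cast hQJ
  have hJR : (1 : ℝ) ≤ J := hQR.trans hQJR
  have hB0 : 0 ≤ B := le_trans (by positivity) hB
  obtain ⟨N, hN⟩ : ∃ N, N = ⌊B / q⌋₊ := ⟨_, rfl⟩
  have hNle : (N : ℝ) ≤ B / q := hN ▸ Nat.floor_le (by positivity)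
  have hNlt : B / q < N + 1 := hN ▸ Nat.lt_floor_add_one _
  rw [le_div_iff₀ (by positivity)] at hNle
  rw [div_lt_iff₀ (by positivity)] at hNlt
  have hNQJ : (Q : ℝ) * J ≤ N := by
    by_contra! hlt
    have h1 : ((N : ℝ) + 1) * q ≤ (Q * J + 1) * J := by gcongr
    have h2 : (J : ℝ) ≤ Q * J * J := by
      rw [mul_comm (Q : ℝ), mul_assoc]
      exact le_mul_of_one_le_right (by positivity) (one_le_mul_of_one_le_of_one_le hQR hJR)
    have h4 : ((Q : ℝ) * J + 1) * J = Q * J * J + J := by ring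
    have h5 : 2 * (Q : ℝ) * J ^ 2 = 2 * (Q * J * J) := by ring
    linarith
  obtain ⟨P, hP⟩ : ∃ P, P = N / Q + 1 := ⟨_, rfl⟩
  have hPQ : P * Q ≤ N + Q := by
    rw [hP, add_mul, one_mul]; exact Nat.add_le_add_right (Nat.div_mul_le_self N Q) Q
  have hNQJ' : Q * J ≤ N := by exact_mod_cast hNQJ
  have hQN : Q ≤ N := le_trans (Nat.le_mul_of_pos_right _ (by omega)) hNQJ'
  have hPQ' : P * Q ≤ 2 * N := by omega
  have hhP : 3 * (h * P) ≤ 2 * N := by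
    calc 3 * (h * P) = P * (3 * h) := by ring
      _ ≤ P * Q := by gcongr
      _ ≤ 2 * N := hPQ'
  refine ⟨N, P, hNle, by linarith, ?_, ?_, by omega, ?_, ?_⟩
  · have := (Nat.le_div_iff_mul_le hQ1).mpr (by rwa [mul_comm] : J * Q ≤ N)
    omega
  · rw [div_le_iff₀ (by positivity)]
    have h4 : N ≤ P * Q := by
      rw [hP, add_mul, one_mul]; exact (Nat.lt_div_mul_add hQ1).le
    exact_mod_cast h4
  · have : P ≤ h * P := Nat.le_mul_of_pos_left _ hh
    omega
  · have h4 : (P : ℝ) * Q ≤ 2 * N := by exact_mod_cast hPQ'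
    calc (q : ℝ) * P * Q = q * (P * Q) := by ring
      _ ≤ q * (2 * N) := by gcongr
      _ = 2 * (N * q) := by ring
      _ ≤ 2 * B := by gcongr

theorem exp_neg_div_le {B : ℝ} {e Q : ℕ} (he : 1 ≤ e) (heQ : e ≤ Q) (hB : 2 * (Q : ℝ) * Q ≤ B) :
    2 * Real.exp (-(B / e)) ≤ Real.exp (-(B / (2 * e))) ∧ 2 * Real.exp (-(B / e)) ≤ 1 / Q := by
  have heR : (1 : ℝ) ≤ e := by exact_mod_cast he
  have heQR : (e : ℝ) ≤ Q := by exact_mod_cast heQ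
  have hQR : (1 : ℝ) ≤ Q := heR.trans heQR
  have hx : 2 * (Q : ℝ) ≤ B / e := by
    rw [le_div_iff₀ (by positivity)]
    exact le_trans (by gcongr) hB
  have hx2 : B / (2 * e) = B / e / 2 := by rw [mul_comm, div_div]
  rw [hx2]
  generalize B / (e : ℝ) = x at *
  constructor
  · have h3 : Real.exp (-x) = Real.exp (-(x / 2)) * Real.exp (-(x / 2)) := by
      rw [← Real.exp_add]; congr 1; ring
    have h4 : Real.exp (-(x / 2)) ≤ 1 / 2 := by
      have h6 : Real.exp (-(x / 2)) ≤ Real.exp (-1) := Real.exp_le_exp.mpr (by linarith)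
      refine h6.trans ?_
      rw [Real.exp_neg, one_div]
      exact inv_anti₀ (by norm_num) (by linarith [Real.add_one_le_exp (1 : ℝ)])
    rw [h3]
    nlinarith [Real.exp_pos (-(x / 2))]
  · have h6 : 2 * (Q : ℝ) ≤ Real.exp x := by linarith [Real.add_one_le_exp x]
    rw [Real.exp_neg, le_div_iff₀ (by linarith), mul_assoc, mul_comm, mul_assoc,
      inv_mul_le_iff₀ (Real.exp_pos _)]
    linarith

theorem parameter_inequalities {B : ℝ} {d e w h Q L k q P N : ℕ} (hd : 1 ≤ d) (he : 1 ≤ e)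
    (hw : 1 ≤ w) (hL : L = 1248 * d ^ 2 * w) (hk : k = 7488 * d ^ 2 * h)
    (hh : h = 9346272 * d ^ 4 * w) (hQ : Q = 1437696 * d ^ 3 * w * e * h) (hq : 1 ≤ q)
    (hP : 1 ≤ P) (hPN : P ≤ N) (hNq : (N : ℝ) * q ≤ B) (hqPQ : (q : ℝ) * P * Q ≤ 2 * B)
    (hhB : 3 * (h : ℝ) ≤ B) (hBw : B ^ 2 ≤ 2 ^ w) {D : ℕ}
    (hD : D = (2 * w * k + 12 * L * h) * (q * P)) :
    k * (q * P) * L < h * q * (h * P) ∧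
    w * (k * (q * P) + 1) + 2 * L * (h * q) * (3 * P) + L * (h * P + L) * (3 * q) ≤ D ∧
    9 * L * h * (q * P) ≤ D ∧ k * (q * P) ≤ D ∧ 312 * d ^ 2 * D ≤ k * (q * P) * L ∧
    12 * d * D ≤ 2 ^ w ∧ h * q * N + h * P + L ≤ 2 ^ w ∧ 0 < k * (q * P) ∧ 6 ≤ D ∧
    12 * (d : ℝ) * D ≤ B / (2 * e) ∧ ((h * q * N + h * P + L : ℕ) : ℝ) ≤ 3 * h * (q * N) := by
  have hhL : h = 7489 * d ^ 2 * L := by rw [hh, hL]; ring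
  have hQD : Q = 48 * d * e * (2 * w * k + 12 * L * h) := by rw [hQ, hk, hL]; ring
  have hML : 312 * d ^ 2 * (2 * w * k + 12 * L * h) = k * L := by rw [hk, hL]; ring
  have hL1 : 1 ≤ L := hL ▸ Nat.one_le_iff_ne_zero.mpr (by positivity)
  have hh1 : 1 ≤ h := hh ▸ Nat.one_le_iff_ne_zero.mpr (by positivity)
  have hk1 : 1 ≤ k := hk ▸ Nat.one_le_iff_ne_zero.mpr (by positivity)
  have hLh : L ≤ h := by rw [hhL]; exact Nat.le_mul_of_pos_left _ (by positivity)
  have hkL : k * L < h * h := by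
    calc k * L = h * (7488 * d ^ 2 * L) := by rw [hk]; ring
      _ < h * h := by
        refine Nat.mul_lt_mul_of_pos_left ?_ hh1
        rw [hhL]
        have : 0 < d ^ 2 * L := by positivity
        nlinarith
  clear hk hh hQ
  have hB1 : 1 ≤ B := le_trans (by have : (1 : ℝ) ≤ h := by exact_mod_cast hh1
                                   linarith) hhB
  have heR : (1 : ℝ) ≤ e := by exact_mod_cast he
  have hT : 1 ≤ q * P := Nat.mul_pos hq hP
  have hDB : 12 * (d : ℝ) * D ≤ B / (2 * e) := by
    rw [le_div_iff₀ (by positivity)]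
    have h3 : 12 * (d : ℝ) * D * (2 * e) = q * P * Q / 2 := by
      rw [hQD, hD]; push_cast; ring
    rw [h3]; linarith
  have hBB : B ≤ 2 ^ w := le_trans (by nlinarith) hBw
  have hZ : h * q * N + h * P + L ≤ 3 * h * (q * N) := by
    have h3 : h * P ≤ h * (q * N) :=
      Nat.mul_le_mul_left _ (hPN.trans (Nat.le_mul_of_pos_left _ hq))
    have h4 : h ≤ h * (q * N) := Nat.le_mul_of_pos_right _ (Nat.mul_pos hq (hP.trans hPN))
    have h5 : h * q * N = h * (q * N) := by ring
    have h6 : 3 * h * (q * N) = 3 * (h * (q * N)) := by ring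
    omega
  have hZR : ((h * q * N + h * P + L : ℕ) : ℝ) ≤ 3 * h * (q * N) := by exact_mod_cast hZ
  refine ⟨?_, ?_, ?_, ?_, ?_, ?_, ?_, Nat.mul_pos hk1 hT, ?_, hDB, hZR⟩
  · calc k * (q * P) * L = k * L * (q * P) := by ring
      _ < h * h * (q * P) := Nat.mul_lt_mul_of_pos_right hkL hT
      _ = _ := by ring
  · have h3 : w ≤ w * k * (q * P) := by
      rw [mul_assoc]; exact Nat.le_mul_of_pos_right _ (Nat.mul_pos hk1 hT)
    have h4 : L * L * q ≤ L * h * (q * P) :=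
      Nat.mul_le_mul (Nat.mul_le_mul_left _ hLh) (Nat.le_mul_of_pos_right _ hP)
    calc w * (k * (q * P) + 1) + 2 * L * (h * q) * (3 * P) + L * (h * P + L) * (3 * q)
        = w * k * (q * P) + w + 9 * (L * h * (q * P)) + 3 * (L * L * q) := by ring
      _ ≤ w * k * (q * P) + w * k * (q * P) + 9 * (L * h * (q * P)) +
          3 * (L * h * (q * P)) := by gcongr
      _ = D := by rw [hD]; ring
  · rw [hD]
    refine Nat.mul_le_mul_right _ ?_
    have : 9 * L * h ≤ 12 * L * h := by gcongr; norm_num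
    omega
  · rw [hD]
    refine Nat.mul_le_mul_right _ ?_
    have : k ≤ w * k := Nat.le_mul_of_pos_left _ hw
    have h5 : 2 * w * k = 2 * (w * k) := by ring
    omega
  · refine le_of_eq ?_
    rw [hD, ← mul_assoc, hML]; ring
  · have h3 : ((12 * d * D : ℕ) : ℝ) ≤ ((2 ^ w : ℕ) : ℝ) := by
      push_cast; exact hDB.trans ((div_le_self (by linarith) (by linarith)).trans hBB)
    exact_mod_cast h3
  · have h3 : ((h * q * N + h * P + L : ℕ) : ℝ) ≤ ((2 ^ w : ℕ) : ℝ) := by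
      refine hZR.trans ?_
      push_cast
      refine le_trans ?_ hBw
      rw [sq]
      exact mul_le_mul hhB (by linarith) (by positivity) (by linarith)
    exact_mod_cast h3
  · rw [hD]
    have h3 : 12 * 1 ≤ 12 * (L * h) := Nat.mul_le_mul_left _ (Nat.mul_pos hL1 hh1)
    refine le_trans ?_ (Nat.le_mul_of_pos_right _ hT)
    rw [mul_assoc 12]
    omega

theorem lt_of_norm_embedding_sub_one_le_exp {K : Type*} [Field K] [NumberField K] (φ₀ : K →+* ℂ)
    {b₀ b₁ : 𝓞 K} {g : ℕ} (hb₀ : b₀ ≠ 0) (hb₁ : b₁ ≠ 0) (hg : g ≠ 0) (hg₀ : b₀ ∣ (g : 𝓞 K))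
    (hg₁ : b₁ ∣ (g : 𝓞 K)) {M : ℕ}
    (hM : M = (((discr K).natAbs + 1) * g ^ 2) ^ finrank ℚ K) {w e Q J h : ℕ}
    (hw : 1 ≤ w) (he : 1 ≤ e) (hh : h = 9346272 * finrank ℚ K ^ 4 * w)
    (hQ : Q = 1437696 * finrank ℚ K ^ 3 * w * e * h) (hJ : J = (16 * Q * M) ^ (3 * finrank ℚ K))
    {B : ℝ} (hBw : B ^ 2 ≤ 2 ^ w)
    (hB : ∀ v : InfinitePlace K, |Real.log (v ((b₁ : K) / b₀))| ≤ B)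
    (hB' : ∃ v : InfinitePlace K, |Real.log (v ((b₁ : K) / b₀))| = B)
    (hβ : ‖φ₀ ((b₁ : K) / b₀) - 1‖ ≤ Real.exp (-(B / e))) : B < 2 * Q * J ^ 2 := by
  by_contra! hBJ
  have hd1 : 1 ≤ finrank ℚ K := finrank_pos
  have hM1 : 1 ≤ M := by
    rw [hM]; exact Nat.one_le_pow _ _ (by positivity)
  have hh1 : 1 ≤ h := by rw [hh]; exact Nat.one_le_iff_ne_zero.mpr (by positivity)
  have h3hQ : 3 * h ≤ Q := by
    rw [hQ]
    refine Nat.mul_le_mul_right h ?_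
    have : 1 ≤ finrank ℚ K ^ 3 * w * e := Nat.one_le_iff_ne_zero.mpr (by positivity)
    nlinarith
  have hQ1 : 1 ≤ Q := by omega
  have heQ : e ≤ Q := by
    rw [hQ, mul_right_comm]
    exact Nat.le_mul_of_pos_left _ (by positivity)
  have hJ0 : 16 * Q * M ≤ J := by rw [hJ]; exact Nat.le_self_pow (by omega) _
  have hQJ : Q ≤ J := le_trans (by rw [mul_right_comm]; exact Nat.le_mul_of_pos_left _ (by omega)) hJ0
  have hMJ : M ≤ J := le_trans (Nat.le_mul_of_pos_left _ (by omega)) hJ0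
  have hgM : g ≤ M := by
    rw [hM]
    refine le_trans ?_ (Nat.le_self_pow (by omega) _)
    exact (Nat.le_self_pow (by norm_num) g).trans (Nat.le_mul_of_pos_left _ (by omega))
  have hQR : (1 : ℝ) ≤ Q := by exact_mod_cast hQ1
  have hQJR : (Q : ℝ) ≤ J := by exact_mod_cast hQJ
  have hBQQ : 2 * (Q : ℝ) * Q ≤ B := by
    refine le_trans ?_ hBJ
    have : (Q : ℝ) ≤ J ^ 2 := hQJR.trans (le_self_pow₀ (hQR.trans hQJR) (by norm_num))
    gcongr
  have hBJ' : (J : ℝ) ≤ B := by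
    refine le_trans ?_ hBJ
    have h1 : (J : ℝ) ≤ J ^ 2 := le_self_pow₀ (hQR.trans hQJR) (by norm_num)
    exact h1.trans (le_mul_of_one_le_left (by positivity) (by linarith))
  have hB0 : 0 < B := by linarith
  obtain ⟨η, q, lam, hη, hη0, hq1, hqJ, hlam, him, hre, hlog⟩ :=
    exists_log_near_multiple φ₀ hb₀ hb₁ hg hg₀ hg₁ hM hQ1 hJ.ge hBJ'
  obtain ⟨N, P, hNq, hNq', hJP, hNP, hhP, hPN, hqPQ⟩ :=
    exists_floor_parameters hh1 h3hQ hQJ hq1 hqJ hBJ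
  have hP1 : 1 ≤ P := by omega
  obtain ⟨L, hL⟩ : ∃ L, L = 1248 * finrank ℚ K ^ 2 * w := ⟨_, rfl⟩
  obtain ⟨k, hk⟩ : ∃ k, k = 7488 * finrank ℚ K ^ 2 * h := ⟨_, rfl⟩
  obtain ⟨D, hD⟩ : ∃ D, D = (2 * w * k + 12 * L * h) * (q * P) := ⟨_, rfl⟩
  obtain ⟨hRS, hD', hED, hMD, hML, hDw, hZ, hM0, hD6, hDB, hZR⟩ := parameter_inequalities hd1 he hw
    hL hk hh hQ hq1 hP1 hPN hNq hqPQ (B := B)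
    (by have : 3 * (h : ℝ) ≤ Q := by exact_mod_cast h3hQ
        refine this.trans (le_trans ?_ hBQQ)
        nlinarith) hBw hD
  have hgP : g ≤ 2 ^ (3 * P) :=
    ((hgM.trans hMJ).trans hJP).trans
      (Nat.lt_two_pow_self.le.trans (Nat.pow_le_pow_right (by norm_num) (by omega)))
  obtain ⟨hδ, hδQ⟩ := exp_neg_div_le he heQ hBQQ
  have h1Q : 1 / (Q : ℝ) ≤ 1 / 3 := by
    have : 3 ≤ Q := by omega
    have : (3 : ℝ) ≤ Q := by exact_mod_cast this
    exact one_div_le_one_div_of_le (by norm_num) this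
  have hqR : (1 : ℝ) ≤ q := by exact_mod_cast hq1
  have hqP : (q : ℝ) ≤ P := by exact_mod_cast hqJ.trans hJP
  have hqB : (q : ℝ) / B ≤ 1 := by
    rw [div_le_one hB0]; exact le_trans (by exact_mod_cast hqJ) hBJ'
  clear hJ hQ hh hM hBJ hJ0 h3hQ hQJ hMJ hgM hqJ hJP hQJR hBQQ hBJ' hqPQ heQ hM1 hPN
  have hδ2 : Real.exp (-(B / e)) ≤ 1 / 2 := by linarith
  set β : K := (b₁ : K) / b₀ with hβdef
  have hb₀K : (b₀ : K) ≠ 0 := by simpa using hb₀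
  have hb₁K : (b₁ : K) ≠ 0 := by simpa using hb₁
  have hβ0 : β ≠ 0 := div_ne_zero hb₁K hb₀K
  have hqBB : (q : ℝ) / B * B = q := div_mul_cancel₀ _ hB0.ne'
  have hqB0 : 0 ≤ (q : ℝ) / B := by positivity
  have hvpos : ∀ (v : InfinitePlace K) {x : K}, x ≠ 0 → 0 < v x := fun v x hx => v.pos_iff.mpr hx
  have hlogη : ∀ v : InfinitePlace K, Real.log (v η) ≤ 2 * q := fun v => by
    have h1 := (abs_le.mp (hlog v)).2
    have h2 := mul_le_mul_of_nonneg_left ((le_abs_self _).trans (hB v)) hqB0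
    rw [hqBB] at h2
    linarith
  have hlogν : ∀ v : InfinitePlace K, Real.log (v (β⁻¹ * η ^ N)) ≤ 2 * P := fun v => by
    rw [map_mul, map_inv₀, map_pow, Real.log_mul (by have := hvpos v hβ0; positivity)
      (by have := hvpos v hη0; positivity), Real.log_inv, Real.log_pow]
    have h1 := (abs_le.mp (hlog v)).2
    have h2 := abs_le.mp (hB v)
    have h3 : (N : ℝ) * (q / B) - 1 = -(B - N * q) / B := by field_simp; ring
    have h4 : (N : ℝ) * (Real.log (v η) - q / B * Real.log (v β)) ≤ N * (1 / Q) := by gcongr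
    have h5 : ((N : ℝ) * (q / B) - 1) * Real.log (v β) ≤ q := by
      rw [h3, div_mul_eq_mul_div, div_le_iff₀ hB0]
      nlinarith
    rw [mul_one_div] at h4
    linarith
  have hemb : ∀ φ : K →+* ℂ, ∀ x : K, InfinitePlace.mk φ x = ‖φ x‖ := fun φ x => rfl
  have hnorm : ∀ {x : K} {k : ℕ}, x ≠ 0 → (∀ v : InfinitePlace K, Real.log (v x) ≤ 2 * k) →
      ∀ φ : K →+* ℂ, ‖φ x‖ ≤ 2 ^ (3 * k) := fun hx hv φ => by
    rw [← hemb]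
    exact ((Real.log_le_iff_le_exp (hvpos _ hx)).mp (hv _)).trans (exp_two_mul_le _)
  have hν0 : β⁻¹ * η ^ N ≠ 0 := mul_ne_zero (inv_ne_zero hβ0) (pow_ne_zero _ hη0)
  have hlamn : ‖lam‖ ≤ 3 / Q := by
    have h1 : |lam.re| ≤ 2 / Q := by
      rw [hre]
      have h2 := hlog (InfinitePlace.mk φ₀)
      simp only [hemb] at h2
      have h3 := (abs_log_norm_le hβ hδ2).trans hδQ
      have h4 : |(q : ℝ) / B * Real.log ‖φ₀ β‖| ≤ 1 / Q := by
        rw [abs_mul, abs_of_nonneg hqB0]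
        exact (mul_le_of_le_one_left (abs_nonneg _) hqB).trans h3
      have h5 : Real.log ‖φ₀ η‖ = (Real.log ‖φ₀ η‖ - q / B * Real.log ‖φ₀ β‖) +
        q / B * Real.log ‖φ₀ β‖ := by ring
      rw [h5]
      refine (abs_add_le _ _).trans ((add_le_add h2 h4).trans_eq (by ring))
    refine (Complex.norm_le_abs_re_add_abs_im lam).trans ((add_le_add h1 him).trans_eq (by ring))
  refine false_of_norm_embedding_sub_one_le φ₀ (η := η) (ν := β⁻¹ * η ^ N) (γ := β⁻¹) (g := g)
    (a₁ := 3 * P) (a₂ := 3 * q) (w := w) (R := h * q) (S := h * P) (N := N) (lam := lam) hη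
    (hnorm hη0 hlogη) (hnorm hν0 hlogν) ?_ hgP ?_ hη0 hν0 hg hlam rfl ?_ hhP hRS hD' hED (by omega)
    hMD hML hDw hZ ?_ hM0 hD6
  · obtain ⟨c, hc⟩ := hg₁
    have h3 : (g : K) * (β⁻¹ * η ^ N) = (c : K) * b₀ * η ^ N := by
      have h4 : (g : K) = b₁ * c := by
        have := congrArg (algebraMap (𝓞 K) K) hc
        simpa using this
      rw [h4, hβdef]
      field_simp
    rw [h3]
    exact (c.isIntegral_coe.mul b₀.isIntegral_coe).mul (hη.pow _)
  · obtain ⟨v, hv⟩ := hB'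
    have hne : Real.log (v η) ≠ 0 := fun h0 => by
      have h1 := hlog v
      rw [h0, zero_sub, abs_neg, abs_mul, hv, abs_of_nonneg hqB0, hqBB] at h1
      linarith
    intro i j hij
    have h1 := congrArg (fun x => Real.log (v x)) hij
    simp only [map_pow, Real.log_pow] at h1
    exact_mod_cast mul_right_cancel₀ hne h1
  · rw [map_inv₀]
    refine (norm_inv_sub_one_le hβ hδ2).trans (hδ.trans ?_)
    rw [Real.exp_neg, one_div]
    refine inv_anti₀ (by positivity) ?_
    have h3 : ((2 : ℝ) ^ (12 * finrank ℚ K * D)) ≤ Real.exp ((12 * finrank ℚ K * D : ℕ) : ℝ) := by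
      rw [← Real.exp_one_pow]
      exact pow_le_pow_left₀ (by norm_num) (by linarith [Real.add_one_le_exp (1 : ℝ)]) _
    refine h3.trans (Real.exp_le_exp.mpr ?_)
    push_cast
    exact hDB
  · have h4 : (L : ℝ) * (3 / Q) * (3 * h * (q * N)) = 9 * L * h * q * (N / Q) := by ring
    refine (mul_le_mul (mul_le_mul_of_nonneg_left hlamn (by positivity)) hZR (by positivity)
      (by positivity)).trans ?_
    rw [h4]
    push_cast
    calc 9 * (L : ℝ) * h * q * (N / Q) ≤ 9 * L * h * q * P := by gcongr
      _ = 9 * L * h * (q * P) := by ring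

theorem le_of_lt_two_mul_mul_sq {B : ℝ} {d e w Q J M : ℕ} (hd : 1 ≤ d) (he : 1 ≤ e) (hM : 1 ≤ M)
    (hw : 1 ≤ w) (hB0 : 0 < B) (hB : 1 ≤ Real.log B) (hwB : (w : ℝ) ≤ 4 * Real.log B)
    (hQ : Q = 1437696 * d ^ 3 * w * e * (9346272 * d ^ 4 * w))
    (hJ : J = (16 * Q * M) ^ (3 * d)) (h : B < 2 * Q * J ^ 2) :
    Real.log B ≤ 16 * d * (44 + 9 * Real.log d + Real.log e + Real.log M) := by
  have hQ1 : 1 ≤ Q := by rw [hQ]; exact Nat.one_le_iff_ne_zero.mpr (by positivity)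
  have h1 : 2 * Q * J ^ 2 ≤ (16 * Q * M) ^ (8 * d) := by
    have h2 : 2 * Q ≤ (16 * Q * M) ^ (2 * d) := by
      refine le_trans ?_ (Nat.le_self_pow (by omega) _)
      calc 2 * Q ≤ 16 * Q * 1 := by omega
        _ ≤ 16 * Q * M := by gcongr
    calc 2 * Q * J ^ 2 ≤ (16 * Q * M) ^ (2 * d) * J ^ 2 := by gcongr
      _ = _ := by rw [hJ, ← pow_mul, ← pow_add]; congr 1; ring
  have h2 : B ≤ ((16 * Q * M : ℕ) : ℝ) ^ (8 * d) := h.le.trans (by exact_mod_cast h1)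
  have h3 := Real.log_le_log hB0 h2
  rw [Real.log_pow] at h3
  have hdR : (1 : ℝ) ≤ d := by exact_mod_cast hd
  have heR : (1 : ℝ) ≤ e := by exact_mod_cast he
  have hMR : (1 : ℝ) ≤ M := by exact_mod_cast hM
  have hwR : (1 : ℝ) ≤ w := by exact_mod_cast hw
  set x := Real.log B with hx
  have h4 : ((16 * Q * M : ℕ) : ℝ) ≤ (256 * 1437696 * 9346272) * (d : ℝ) ^ 7 * x ^ 2 * e * M := by
    have h5 : ((16 * Q * M : ℕ) : ℝ) =
        (16 * 1437696 * 9346272) * (d : ℝ) ^ 7 * (w : ℝ) ^ 2 * e * M := by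
      rw [hQ]; push_cast; ring
    rw [h5]
    have h6 : (w : ℝ) ^ 2 ≤ (4 * x) ^ 2 := by gcongr
    calc (16 * 1437696 * 9346272) * (d : ℝ) ^ 7 * (w : ℝ) ^ 2 * e * M
        ≤ (16 * 1437696 * 9346272) * (d : ℝ) ^ 7 * (4 * x) ^ 2 * e * M := by gcongr
      _ = _ := by ring
  have h5 : Real.log ((16 * Q * M : ℕ) : ℝ) ≤ Real.log (256 * 1437696 * 9346272) +
      7 * Real.log d + 2 * Real.log x + Real.log e + Real.log M := by
    refine (Real.log_le_log (by positivity) h4).trans (le_of_eq ?_)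
    rw [Real.log_mul (by positivity) (by positivity), Real.log_mul (by positivity) (by positivity),
      Real.log_mul (by positivity) (by positivity), Real.log_mul (by positivity) (by positivity),
      Real.log_pow, Real.log_pow]
    norm_num
  have h6 : Real.log x ≤ x / (32 * d) - 1 + Real.log 32 + Real.log d := by
    have h7 := Real.log_le_sub_one_of_pos (show 0 < x / (32 * d) by positivity)
    rw [Real.log_div (by positivity) (by positivity), Real.log_mul (by positivity) (by positivity)] at h7
    linarith
  have h7 : Real.log (256 * 1437696 * 9346272) + 2 * Real.log 32 ≤ 44 := by
    rw [show 2 * Real.log 32 = Real.log (32 ^ 2) by rw [Real.log_pow]; norm_num,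
      ← Real.log_mul (by positivity) (by positivity), Real.log_le_iff_le_exp (by positivity),
      show (44 : ℝ) = (44 : ℕ) * 1 by norm_num, Real.exp_nat_mul]
    refine le_trans ?_ (pow_le_pow_left₀ (by norm_num) Real.exp_one_gt_d9.le 44)
    norm_num
  have h8 : (16 * (d : ℝ)) * (x / (32 * d)) = x / 2 := by field_simp; norm_num
  have h9 : x ≤ 8 * d * (Real.log (256 * 1437696 * 9346272) + 7 * Real.log d +
      2 * (x / (32 * d) - 1 + Real.log 32 + Real.log d) + Real.log e + Real.log M) := by
    refine h3.trans ?_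
    push_cast
    have := h5.trans (show _ ≤ Real.log (256 * 1437696 * 9346272) + 7 * Real.log d +
      2 * (x / (32 * d) - 1 + Real.log 32 + Real.log d) + Real.log e + Real.log M by linarith)
    push_cast at this
    gcongr
  have h10 : x / 2 ≤ 8 * d * ((Real.log (256 * 1437696 * 9346272) + 2 * Real.log 32) +
      9 * Real.log d + Real.log e + Real.log M) := by
    have : 0 ≤ (d : ℝ) := by positivity
    linarith
  have h11 : 8 * (d : ℝ) * ((Real.log (256 * 1437696 * 9346272) + 2 * Real.log 32) +
      9 * Real.log d + Real.log e + Real.log M) ≤ 8 * d * (44 +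
      9 * Real.log d + Real.log e + Real.log M) := by gcongr
  have h12 := h10.trans h11
  linarith only [h12]

theorem log_le_of_norm_embedding_sub_one_le_exp {K : Type*} [Field K] [NumberField K]
    (φ₀ : K →+* ℂ) {b₀ b₁ : 𝓞 K} {g : ℕ} (hb₀ : b₀ ≠ 0) (hb₁ : b₁ ≠ 0) (hg : g ≠ 0)
    (hg₀ : b₀ ∣ (g : 𝓞 K)) (hg₁ : b₁ ∣ (g : 𝓞 K)) {M : ℕ}
    (hM : M = (((discr K).natAbs + 1) * g ^ 2) ^ finrank ℚ K) {e : ℕ} (he : 1 ≤ e) {B : ℝ}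
    (hB : ∀ v : InfinitePlace K, |Real.log (v ((b₁ : K) / b₀))| ≤ B)
    (hB' : ∃ v : InfinitePlace K, |Real.log (v ((b₁ : K) / b₀))| = B)
    (hβ : ‖φ₀ ((b₁ : K) / b₀) - 1‖ ≤ Real.exp (-(B / e))) :
    Real.log B ≤ 16 * finrank ℚ K * (44 + 9 * Real.log (finrank ℚ K) + Real.log e +
      Real.log M) := by
  have hd : 1 ≤ finrank ℚ K := finrank_pos
  have hM1 : 1 ≤ M := by
    rw [hM]; exact Nat.one_le_pow _ _ (by positivity)
  by_cases hx : Real.log B < 1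
  · have h1 := Real.log_natCast_nonneg (finrank ℚ K)
    have h2 := Real.log_natCast_nonneg e
    have h3 := Real.log_natCast_nonneg M
    have hdR : (1 : ℝ) ≤ finrank ℚ K := by exact_mod_cast hd
    nlinarith
  push Not at hx
  have hl2 := Real.log_two_gt_d9
  have hB0 : 0 < B := by
    obtain ⟨v, hv⟩ := hB'
    rcases (abs_nonneg (Real.log (v ((b₁ : K) / b₀)))).lt_or_eq with h | h
    · rwa [hv] at h
    · rw [hv] at h
      rw [← h, Real.log_zero] at hx
      linarith
  obtain ⟨w, hw⟩ : ∃ w, w = ⌈2 * Real.log B / Real.log 2⌉₊ := ⟨_, rfl⟩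
  have hw1 : 2 * Real.log B / Real.log 2 ≤ w := hw ▸ Nat.le_ceil _
  have hw2 : (w : ℝ) < 2 * Real.log B / Real.log 2 + 1 := hw ▸ Nat.ceil_lt_add_one (by positivity)
  have hw0 : 1 ≤ w := by rw [hw, Nat.one_le_ceil_iff]; positivity
  have hw4 : (w : ℝ) ≤ 4 * Real.log B := by
    have : 2 * Real.log B / Real.log 2 ≤ 3 * Real.log B := by
      rw [div_le_iff₀ (by linarith)]; nlinarith
    linarith
  have hBw : B ^ 2 ≤ 2 ^ w := by
    rw [← Real.log_le_log_iff (by positivity) (by positivity), Real.log_pow, Real.log_pow]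
    rw [div_le_iff₀ (by linarith)] at hw1
    exact_mod_cast hw1
  exact le_of_lt_two_mul_mul_sq hd he hM1 hw0 hB0 hx hw4 rfl rfl
    (lt_of_norm_embedding_sub_one_le_exp φ₀ hb₀ hb₁ hg hg₀ hg₁ hM hw0 he rfl rfl rfl hBw hB hB' hβ)

theorem exists_place_log_le {K : Type*} [Field K] [NumberField K] {b₁ b₂ : 𝓞 K} {g : ℕ}
    (hb₁ : b₁ ≠ 0) (hb₂ : b₂ ≠ 0) (hg : g ≠ 0) (h₁ : b₁ ∣ (g : 𝓞 K)) {B : ℝ} (hB0 : 0 < B)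
    (hB : 2 * finrank ℚ K * Real.log g ≤ B) {w₁ : InfinitePlace K}
    (hw₁ : Real.log (w₁ (b₁ : K)) - Real.log (w₁ (b₂ : K)) = B) :
    ∃ w : InfinitePlace K,
      Real.log (w (b₁ : K)) - Real.log (w (b₂ : K)) ≤ -(B / (2 * finrank ℚ K)) := by
  by_contra! hcon
  have hd : (0 : ℝ) < finrank ℚ K := by exact_mod_cast finrank_pos (R := ℚ) (M := K)
  have hpos : ∀ {b : 𝓞 K}, b ≠ 0 → ∀ w : InfinitePlace K, w (b : K) ≠ 0 := fun hb w =>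
    (w.pos_iff.mpr (by simpa using hb)).ne'
  have hlog : ∀ {b : 𝓞 K}, b ≠ 0 → Real.log (∏ w : InfinitePlace K, w (b : K) ^ w.mult) =
      ∑ w : InfinitePlace K, w.mult * Real.log (w (b : K)) := fun hb => by
    rw [Real.log_prod fun w _ => pow_ne_zero _ (hpos hb w)]
    exact Finset.sum_congr rfl fun w _ => Real.log_pow _ _
  have e1 : ∑ w : InfinitePlace K, w.mult * Real.log (w (b₁ : K)) ≤ finrank ℚ K * Real.log g := by
    rw [← hlog hb₁, ← Real.log_pow]
    exact Real.log_le_log (lt_of_lt_of_le one_pos (InfinitePlace.one_le_prod_pow_mult hb₁))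
      (InfinitePlace.prod_pow_mult_le_of_dvd hg h₁)
  have e2 : 0 ≤ ∑ w : InfinitePlace K, w.mult * Real.log (w (b₂ : K)) := by
    rw [← hlog hb₂]
    exact Real.log_nonneg (InfinitePlace.one_le_prod_pow_mult hb₂)
  have e3 : ∑ w : InfinitePlace K, (w.mult : ℝ) * (B / (2 * finrank ℚ K)) = B / 2 := by
    rw [← Finset.sum_mul, ← Nat.cast_sum, InfinitePlace.sum_mult_eq]
    field_simp
  have e4 : B < ∑ w : InfinitePlace K, (w.mult : ℝ) * (Real.log (w (b₁ : K)) -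
      Real.log (w (b₂ : K)) + B / (2 * finrank ℚ K)) := by
    have hm : (1 : ℝ) ≤ w₁.mult := by exact_mod_cast w₁.mult_pos
    have hd' : 0 < B / (2 * finrank ℚ K) := by positivity
    refine lt_of_lt_of_le (b := (w₁.mult : ℝ) * (Real.log (w₁ (b₁ : K)) -
      Real.log (w₁ (b₂ : K)) + B / (2 * finrank ℚ K))) ?_ ?_
    · rw [hw₁]; nlinarith
    · refine Finset.single_le_sum (f := fun w : InfinitePlace K => (w.mult : ℝ) *
        (Real.log (w (b₁ : K)) - Real.log (w (b₂ : K)) + B / (2 * finrank ℚ K)))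
        (fun w _ => ?_) (Finset.mem_univ w₁)
      have := hcon w
      exact mul_nonneg (Nat.cast_nonneg _) (by linarith)
  simp only [mul_add, mul_sub, Finset.sum_add_distrib, Finset.sum_sub_distrib] at e4
  linarith

/-- An effective bound for three-term relations between divisors of a fixed integer, obtained
without fundamental units from the lower bound for `‖φ₀ γ - 1‖`. -/
theorem le_exp_of_add_eq_zero {K : Type*} [Field K] [NumberField K] {b₁ b₂ b₃ c₁ c₂ c₃ : 𝓞 K}
    {m g M : ℕ} (h : c₁ * b₁ + c₂ * b₂ + c₃ * b₃ = 0) (hb₁ : b₁ ≠ 0) (hb₂ : b₂ ≠ 0) (hb₃ : b₃ ≠ 0)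
    (hg : g ≠ 0) (hm : 1 ≤ m) (hmg : m ≤ g) (h₁ : b₁ ∣ (g : 𝓞 K)) (h₂ : c₂ * b₂ ∣ (g : 𝓞 K))
    (h₃ : c₃ * b₃ ∣ (g : 𝓞 K))
    (hc₁ : ∀ w : InfinitePlace K, 1 ≤ m * w (c₁ : K) ∧ w (c₁ : K) ≤ 2)
    (hc₂ : ∀ w : InfinitePlace K, 1 ≤ m * w (c₂ : K) ∧ w (c₂ : K) ≤ 2)
    (hc₃ : ∀ w : InfinitePlace K, 1 ≤ m * w (c₃ : K) ∧ w (c₃ : K) ≤ 2)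
    (hM : M = (((discr K).natAbs + 1) * g ^ 2) ^ finrank ℚ K) {B : ℝ}
    (h32 : ∀ w : InfinitePlace K, |Real.log (w (b₃ : K)) - Real.log (w (b₂ : K))| ≤ B)
    (h12 : ∃ w : InfinitePlace K, Real.log (w (b₁ : K)) - Real.log (w (b₂ : K)) = B) :
    B ≤ Real.exp (16 * finrank ℚ K * (50 + 10 * Real.log (finrank ℚ K) + Real.log M)) := by
  obtain ⟨w₁, hw₁⟩ := h12
  have hd1 : 1 ≤ finrank ℚ K := finrank_pos
  have hdR : (1 : ℝ) ≤ finrank ℚ K := by exact_mod_cast hd1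
  have hmR : (1 : ℝ) ≤ m := by exact_mod_cast hm
  have hgR : (1 : ℝ) ≤ g := by exact_mod_cast hm.trans hmg
  have hm0 : (m : ℝ) ≠ 0 := by linarith
  have hld := Real.log_natCast_nonneg (finrank ℚ K)
  have hlM := Real.log_natCast_nonneg M
  have hgM : m * g ≤ M := by
    rw [hM]
    refine le_trans ?_ (Nat.le_self_pow (by omega) _)
    calc m * g ≤ g * g := by gcongr
      _ = 1 * g ^ 2 := by ring
      _ ≤ _ := by gcongr; omega
  have hpos : ∀ {b : 𝓞 K}, b ≠ 0 → ∀ w : InfinitePlace K, 0 < w (b : K) := fun hb w =>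
    w.pos_iff.mpr (by simpa using hb)
  have hc0 : ∀ {c : 𝓞 K}, (∀ w : InfinitePlace K, 1 ≤ m * w (c : K) ∧ w (c : K) ≤ 2) → c ≠ 0 := by
    rintro c hc rfl
    have := (hc w₁).1
    simp at this
    linarith
  have hc₂0 := hc0 hc₂
  have hc₃0 := hc0 hc₃
  have hl2 := Real.log_two_lt_d9
  have hl20 := Real.log_two_gt_d9
  by_cases hsmall : B < 4 * finrank ℚ K * (Real.log 2 + Real.log (m * g))
  · have h1 : Real.log (m * g) ≤ Real.log M := Real.log_le_log (by positivity) (by exact_mod_cast hgM)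
    have h2 : 4 * (finrank ℚ K : ℝ) * (Real.log 2 + Real.log (m * g)) ≤
        16 * finrank ℚ K * (50 + 10 * Real.log (finrank ℚ K) + Real.log M) := by
      have : 4 * (finrank ℚ K : ℝ) ≤ 16 * finrank ℚ K := by linarith
      have : Real.log 2 + Real.log (m * g) ≤ 50 + 10 * Real.log (finrank ℚ K) + Real.log M := by
        linarith
      have : 0 ≤ Real.log (m * g) := Real.log_nonneg (by nlinarith)
      gcongr
    have h3 := Real.add_one_le_exp (16 * finrank ℚ K * (50 + 10 * Real.log (finrank ℚ K) + Real.log M))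
    linarith
  push Not at hsmall
  set l := Real.log (2 * m) with hl
  have hl1 : Real.log 2 + Real.log (m * g) = l + Real.log g := by
    rw [hl, Real.log_mul (by norm_num) hm0, Real.log_mul hm0 (by linarith)]
    ring
  have hlg : 0 ≤ Real.log g := Real.log_natCast_nonneg g
  have hl0 : Real.log 2 ≤ l := Real.log_le_log (by norm_num) (by linarith)
  rw [hl1] at hsmall
  have hBl : 4 * finrank ℚ K * l ≤ B := by nlinarith
  have hBl' : 4 * l ≤ B := by nlinarith
  have hBg : 2 * finrank ℚ K * Real.log g ≤ B := by nlinarith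
  have hB0 : 0 < B := by linarith
  obtain ⟨w₀, hw₀⟩ := exists_place_log_le hb₁ hb₂ hg h₁ hB0 hBg hw₁
  set β : K := ((-(c₃ * b₃) : 𝓞 K) : K) / ((c₂ * b₂ : 𝓞 K) : K) with hβ
  have hb₂K : (b₂ : K) ≠ 0 := by simpa using hb₂
  have hc₂K : (c₂ : K) ≠ 0 := by simpa using hc₂0
  have hβ1 : β - 1 = (c₁ : K) * b₁ / (c₂ * b₂) := by
    have hK : (c₁ : K) * b₁ + c₂ * b₂ + c₃ * b₃ = 0 := by
      have := congrArg (algebraMap (𝓞 K) K) h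
      simpa using this
    rw [hβ]
    push_cast
    rw [div_sub_one (mul_ne_zero hc₂K hb₂K)]
    congr 1
    linear_combination -hK
  have hlogc : ∀ {c : 𝓞 K}, (∀ w : InfinitePlace K, 1 ≤ m * w (c : K) ∧ w (c : K) ≤ 2) →
      ∀ w : InfinitePlace K, -Real.log m ≤ Real.log (w (c : K)) ∧ Real.log (w (c : K)) ≤ Real.log 2 :=
    fun hc w => by
      have h1 := hpos (hc0 hc) w
      refine ⟨?_, Real.log_le_log h1 (hc w).2⟩
      have h2 := Real.log_nonneg (hc w).1
      rw [Real.log_mul (by positivity) h1.ne'] at h2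
      linarith
  have hll : l = Real.log 2 + Real.log m := Real.log_mul (by norm_num) (by positivity)
  have hlogβ : ∀ w : InfinitePlace K, Real.log (w β) = Real.log (w (c₃ : K)) +
      Real.log (w (b₃ : K)) - (Real.log (w (c₂ : K)) + Real.log (w (b₂ : K))) := fun w => by
    have h1 := (hpos hc₂0 w).ne'
    have h2 := (hpos hc₃0 w).ne'
    have h3 := (hpos hb₂ w).ne'
    have h4 := (hpos hb₃ w).ne'
    rw [hβ]
    push_cast
    rw [map_div₀, show w (-((c₃ : K) * b₃)) = w ((c₃ : K) * b₃) from w.1.map_neg _, map_mul, map_mul, Real.log_div (mul_ne_zero h2 h4)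
      (mul_ne_zero h1 h3), Real.log_mul h2 h4, Real.log_mul h1 h3]
  have hlogβ1 : ∀ w : InfinitePlace K, Real.log (w (β - 1)) = Real.log (w (c₁ : K)) +
      Real.log (w (b₁ : K)) - (Real.log (w (c₂ : K)) + Real.log (w (b₂ : K))) := fun w => by
    have h1 := (hpos hc₂0 w).ne'
    have h2 := (hpos (hc0 hc₁) w).ne'
    have h3 := (hpos hb₂ w).ne'
    have h4 := (hpos hb₁ w).ne'
    rw [hβ1, map_div₀, map_mul, map_mul, Real.log_div (mul_ne_zero h2 h4)
      (mul_ne_zero h1 h3), Real.log_mul h2 h4, Real.log_mul h1 h3]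
  have hβ10 : ∀ w : InfinitePlace K, 0 < w (β - 1) := fun w => by
    rw [hβ1]
    exact w.pos_iff.mpr (div_ne_zero (mul_ne_zero (by simpa using hc0 hc₁) (by simpa using hb₁))
      (mul_ne_zero hc₂K hb₂K))
  obtain ⟨v, -, hv⟩ := Finset.exists_max_image Finset.univ
    (fun w : InfinitePlace K => |Real.log (w β)|) ⟨w₁, Finset.mem_univ _⟩
  set B' := |Real.log (v β)| with hB'
  have hB'le : B' ≤ B + l := by
    have h1 := hlogc hc₃ v
    have h2 := hlogc hc₂ v
    have h3 := abs_le.mp (h32 v)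
    rw [hB', hlogβ, abs_le]
    constructor <;> linarith
  have hB'ge : B / 2 ≤ B' := by
    refine le_trans ?_ (hv w₁ (Finset.mem_univ _))
    refine le_trans ?_ (le_abs_self _)
    have h1 : B - l ≤ Real.log (w₁ (β - 1)) := by
      have h1 := hlogc hc₁ w₁
      have h2 := hlogc hc₂ w₁
      rw [hlogβ1]; linarith
    rw [Real.le_log_iff_exp_le (hβ10 w₁)] at h1
    have h2 : w₁ (β - 1) ≤ w₁ β + w₁ 1 := w₁.1.sub_le_add β 1
    rw [map_one] at h2
    have h3 : Real.exp (B - l) = Real.exp (B / 2 - l) * Real.exp (B / 2) := by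
      rw [← Real.exp_add]; congr 1; ring
    have h4 : 2 ≤ Real.exp (B / 2 - l) :=
      (Real.exp_log two_pos).ge.trans (Real.exp_le_exp.mpr (by linarith))
    have h5 : 1 ≤ Real.exp (B / 2) := Real.one_le_exp (by linarith)
    have h6 : Real.exp (B / 2) ≤ w₁ β := by nlinarith
    rw [Real.le_log_iff_exp_le (by linarith)]
    exact h6
  have hφ : ‖w₀.embedding β - 1‖ ≤ Real.exp (-(B' / (8 * finrank ℚ K : ℕ))) := by
    rw [← map_one w₀.embedding, ← map_sub, w₀.norm_embedding_eq,
      ← Real.log_le_iff_le_exp (hβ10 w₀), hlogβ1]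
    have h1 := hlogc hc₁ w₀
    have h2 := hlogc hc₂ w₀
    have h3 : B' / (8 * finrank ℚ K : ℕ) ≤ B / (2 * finrank ℚ K) - l := by
      rw [div_le_iff₀ (by positivity)]
      push_cast
      have : (B / (2 * finrank ℚ K) - l) * (8 * finrank ℚ K) = 4 * B - 2 * (4 * finrank ℚ K * l) := by
        field_simp; ring
      rw [this]
      linarith
    linarith
  have key := log_le_of_norm_embedding_sub_one_le_exp w₀.embedding (mul_ne_zero hc₂0 hb₂)
    (neg_ne_zero.mpr (mul_ne_zero hc₃0 hb₃)) hg h₂ ((neg_dvd).mpr h₃) hM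
    (e := 8 * finrank ℚ K) (by omega) (B := B') (fun w => hv w (Finset.mem_univ _)) ⟨v, rfl⟩ hφ
  have hB'0 : 0 < B' := by linarith
  have h8 : Real.log (8 * finrank ℚ K : ℕ) ≤ 3 + Real.log (finrank ℚ K) := by
    push_cast
    rw [Real.log_mul (by norm_num) (by positivity), show (8 : ℝ) = 2 ^ 3 by norm_num, Real.log_pow]
    push_cast
    linarith
  rw [← Real.log_le_iff_le_exp hB0]
  have h9 : Real.log B ≤ Real.log 2 + Real.log B' := by
    rw [← Real.log_mul (by norm_num) (by positivity)]
    exact Real.log_le_log hB0 (by linarith)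
  have h10 : 16 * (finrank ℚ K : ℝ) * (44 + 9 * Real.log (finrank ℚ K) +
      Real.log (8 * finrank ℚ K : ℕ) + Real.log M) ≤ 16 * (finrank ℚ K : ℝ) * (44 +
      9 * Real.log (finrank ℚ K) + (3 + Real.log (finrank ℚ K)) + Real.log M) := by gcongr
  nlinarith

theorem one_le_mul_norm_sub_of_pow_eq_one {m : ℕ} (hm : m ≠ 0) {x y : ℂ} (hx : x ^ m = 1)
    (hy : y ^ m = 1) (hxy : x ≠ y) : 1 ≤ m * ‖x - y‖ := by
  have hx1 : ‖x‖ = 1 := Complex.norm_eq_one_of_pow_eq_one hx hm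
  have hy1 : ‖y‖ = 1 := Complex.norm_eq_one_of_pow_eq_one hy hm
  have h0 : ∑ i ∈ Finset.range m, x ^ i * y ^ (m - 1 - i) = 0 := by
    have := (Commute.all x y).geom_sum₂_mul m
    rw [hx, hy, sub_self] at this
    exact (mul_eq_zero.mp this).resolve_right (sub_ne_zero.mpr hxy)
  have h1 : ∑ i ∈ Finset.range m, (x ^ i - y ^ i) * y ^ (m - 1 - i) = -(m * y ^ (m - 1)) := by
    have : ∀ i ∈ Finset.range m, (x ^ i - y ^ i) * y ^ (m - 1 - i) =
        x ^ i * y ^ (m - 1 - i) - y ^ (m - 1) := fun i hi => by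
      rw [sub_mul, ← pow_add, show i + (m - 1 - i) = m - 1 by have := Finset.mem_range.mp hi; omega]
    rw [Finset.sum_congr rfl this, Finset.sum_sub_distrib, h0]
    simp
  have h2 : ∀ i : ℕ, ‖x ^ i - y ^ i‖ ≤ i * ‖x - y‖ := fun i => by
    rw [← (Commute.all x y).geom_sum₂_mul i, norm_mul]
    gcongr
    refine (norm_sum_le _ _).trans ?_
    simp [hx1, hy1]
  have h3 : (m : ℝ) ≤ m * (m * ‖x - y‖) := by
    calc (m : ℝ) = ‖∑ i ∈ Finset.range m, (x ^ i - y ^ i) * y ^ (m - 1 - i)‖ := by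
          rw [h1]; simp [hy1]
      _ ≤ ∑ i ∈ Finset.range m, ‖(x ^ i - y ^ i) * y ^ (m - 1 - i)‖ := norm_sum_le _ _
      _ ≤ ∑ i ∈ Finset.range m, (m * ‖x - y‖) := by
          refine Finset.sum_le_sum fun i hi => ?_
          rw [norm_mul, norm_pow, hy1, one_pow, mul_one]
          refine (h2 i).trans ?_
          have : (i : ℝ) ≤ m := by exact_mod_cast (Finset.mem_range.mp hi).le
          gcongr
      _ = _ := by simp
  have hm0 : (0 : ℝ) < m := by exact_mod_cast Nat.pos_of_ne_zero hm
  exact le_of_mul_le_mul_left (by linarith) hm0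

theorem sub_dvd_natCast_of_pow_eq_one {R : Type*} [CommRing R] [IsDomain R] {m : ℕ} (hm : m ≠ 0)
    {x y : R} (hx : x ^ m = 1) (hy : y ^ m = 1) (hxy : x ≠ y) : x - y ∣ (m : R) := by
  have h0 : ∑ i ∈ Finset.range m, x ^ i * y ^ (m - 1 - i) = 0 := by
    have := (Commute.all x y).geom_sum₂_mul m
    rw [hx, hy, sub_self] at this
    exact (mul_eq_zero.mp this).resolve_right (sub_ne_zero.mpr hxy)
  have h1 : ∑ i ∈ Finset.range m, (x ^ i - y ^ i) * y ^ (m - 1 - i) = -(m * y ^ (m - 1)) := by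
    have : ∀ i ∈ Finset.range m, (x ^ i - y ^ i) * y ^ (m - 1 - i) =
        x ^ i * y ^ (m - 1 - i) - y ^ (m - 1) := fun i hi => by
      rw [sub_mul, ← pow_add, show i + (m - 1 - i) = m - 1 by have := Finset.mem_range.mp hi; omega]
    rw [Finset.sum_congr rfl this, Finset.sum_sub_distrib, h0]
    simp
  have h2 : x - y ∣ -(m * y ^ (m - 1)) := by
    rw [← h1]
    exact Finset.dvd_sum fun i _ => (sub_dvd_pow_sub_pow x y i).mul_right _
  have h3 : (m : R) = -(m * y ^ (m - 1)) * -y := by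
    rw [neg_mul_neg, mul_assoc, ← pow_succ, Nat.sub_add_cancel (Nat.one_le_iff_ne_zero.mpr hm), hy,
      mul_one]
  rw [h3]
  exact h2.mul_right _

theorem place_le_of_pow_sub_pow_eq {K : Type*} [Field K] [NumberField K] {m : ℕ} (hm : 3 ≤ m)
    {ζ : 𝓞 K} (hζ : IsPrimitiveRoot ζ m) {u v g : 𝓞 K} (huv : u ^ m - v ^ m = g) (hg : g ≠ 0)
    {G M : ℕ} (hG : G ≠ 0) (hgG : g ∣ (G : 𝓞 K)) (hgn : ∀ w : InfinitePlace K, w (g : K) ≤ G)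
    (hM : M = (((discr K).natAbs + 1) * (m * G) ^ 2) ^ finrank ℚ K) (w : InfinitePlace K) :
    w (u : K) ≤ 2 * m * G * Real.exp (Real.exp
      (16 * finrank ℚ K * (50 + 10 * Real.log (finrank ℚ K) + Real.log M))) := by
  classical
  have hm0 : m ≠ 0 := by omega
  set S := Polynomial.nthRootsFinset m (1 : 𝓞 K) with hS
  have hmem : ∀ {z}, z ∈ S ↔ z ^ m = 1 := fun {z} =>
    Polynomial.mem_nthRootsFinset (by omega) 1
  have hone : (1 : 𝓞 K) ∈ S := hmem.mpr (one_pow m)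
  have hcard : S.card = m := hζ.card_nthRootsFinset
  set b : 𝓞 K → 𝓞 K := fun z => u - z * v with hb
  have hprod : ∏ z ∈ S, b z = g := by
    rw [← huv, hζ.pow_sub_pow_eq_prod_sub_mul u v (by omega)]
  have hbg : ∀ z ∈ S, b z ∣ g := fun z hz => hprod ▸ Finset.dvd_prod_of_mem b hz
  have hb0 : ∀ z ∈ S, b z ≠ 0 := fun z hz h => hg (by
    have := hbg z hz
    rwa [h, zero_dvd_iff] at this)
  have hpos : ∀ z ∈ S, ∀ w : InfinitePlace K, 0 < w (b z : K) := fun z hz w =>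
    w.pos_iff.mpr (by simpa using hb0 z hz)
  have hroot : ∀ z ∈ S, ∀ w : InfinitePlace K, w (z : K) = 1 := fun z hz w => by
    have h1 : w (z : K) ^ m = 1 := by
      rw [← map_pow, ← map_pow, hmem.mp hz]; simp
    exact (pow_eq_one_iff_of_nonneg (apply_nonneg w _) hm0).mp h1
  have hsub : ∀ z ∈ S, ∀ z' ∈ S, z ≠ z' → ∀ w : InfinitePlace K,
      1 ≤ m * w ((z - z' : 𝓞 K) : K) ∧ w ((z - z' : 𝓞 K) : K) ≤ 2 := fun z hz z' hz' hne w => by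
    constructor
    · rw [← w.norm_embedding_eq]
      push_cast
      rw [map_sub]
      refine one_le_mul_norm_sub_of_pow_eq_one hm0 ?_ ?_ ?_
      · rw [← map_pow, ← map_pow, hmem.mp hz]; simp
      · rw [← map_pow, ← map_pow, hmem.mp hz']; simp
      · exact fun h => hne (RingOfIntegers.coe_injective (w.embedding.injective h))
    · push_cast
      have h1 : w ((z : K) - z') ≤ w (z : K) + w (z' : K) := w.1.sub_le_add _ _
      rw [hroot z hz, hroot z' hz'] at h1
      linarith
  have hdvd : ∀ z ∈ S, ∀ x ∈ S, ∀ y ∈ S, x ≠ y → (x - y) * b z ∣ ((m * G : ℕ) : 𝓞 K) :=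
    fun z hz x hx y hy hxy => by
      rw [Nat.cast_mul]
      exact mul_dvd_mul (sub_dvd_natCast_of_pow_eq_one hm0 (hmem.mp hx) (hmem.mp hy) hxy)
        ((hbg z hz).trans hgG)
  obtain ⟨⟨i, j, w₁⟩, hmax1, hmax⟩ := Finset.exists_max_image
    (S ×ˢ S ×ˢ (Finset.univ : Finset (InfinitePlace K)))
    (fun p => Real.log (p.2.2 (b p.1 : K)) - Real.log (p.2.2 (b p.2.1 : K)))
    ⟨(1, 1, w), by simp [hone]⟩
  simp only [Finset.mem_product, Finset.mem_univ, and_true] at hmax1 hmax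
  obtain ⟨hi, hj⟩ := hmax1
  obtain ⟨B, hB⟩ : ∃ B, B = Real.log (w₁ (b i : K)) - Real.log (w₁ (b j : K)) := ⟨_, rfl⟩
  have hle : ∀ x ∈ S, ∀ y ∈ S, ∀ w : InfinitePlace K,
      Real.log (w (b x : K)) - Real.log (w (b y : K)) ≤ B := fun x hx y hy w =>
    hB ▸ hmax (x, y, w) ⟨hx, hy⟩
  have hBle : B ≤ Real.exp (16 * finrank ℚ K * (50 + 10 * Real.log (finrank ℚ K) +
      Real.log M)) := by
    by_cases hij : i = j
    · rw [hB, hij, sub_self]; positivity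
    obtain ⟨k, hk, hkij⟩ : ∃ k ∈ S, k ∉ ({i, j} : Finset (𝓞 K)) := by
      by_contra! hcon
      have := Finset.card_le_card (show S ⊆ {i, j} from hcon)
      have h2 := Finset.card_le_two (a := i) (b := j)
      omega
    simp only [Finset.mem_insert, Finset.mem_singleton, not_or] at hkij
    refine le_exp_of_add_eq_zero (b₁ := b i) (b₂ := b j) (b₃ := b k) (c₁ := j - k) (c₂ := k - i)
      (c₃ := i - j) (m := m) (g := m * G) (by simp only [hb]; ring) (hb0 i hi) (hb0 j hj) (hb0 k hk)
      (mul_ne_zero hm0 hG) (by omega) (Nat.le_mul_of_pos_right _ (Nat.pos_of_ne_zero hG)) ?_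
      (hdvd j hj k hk i hi hkij.1) (hdvd k hk i hi j hj hij)
      (hsub j hj k hk (Ne.symm hkij.2)) (hsub k hk i hi hkij.1) (hsub i hi j hj hij) hM
      (fun w => ?_) ⟨w₁, hB.symm⟩
    · rw [Nat.cast_mul]
      exact ((hbg i hi).trans hgG).mul_left _
    · rw [abs_le]
      have h1 := hle k hk j hj w
      have h2 := hle j hj k hk w
      constructor <;> linarith
  have hG1 : (1 : ℝ) ≤ G := by exact_mod_cast Nat.one_le_iff_ne_zero.mpr hG
  obtain ⟨j₀, hj₀, hj₀G⟩ : ∃ z ∈ S, w (b z : K) ≤ G := by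
    by_contra! hcon
    have h1 : ∏ z ∈ S, (G : ℝ) < ∏ z ∈ S, w (b z : K) :=
      Finset.prod_lt_prod_of_nonempty (fun _ _ => by linarith) hcon ⟨1, hone⟩
    have h2 : ∏ z ∈ S, w (b z : K) = w (g : K) := by
      rw [← hprod, show ((∏ z ∈ S, b z : 𝓞 K) : K) = ∏ z ∈ S, (b z : K) from
        map_prod (algebraMap (𝓞 K) K) _ _, map_prod]
    rw [Finset.prod_const, hcard, h2] at h1
    exact absurd (h1.trans_le (hgn w)) (not_lt.mpr (le_self_pow₀ hG1 hm0))
  have hall : ∀ z ∈ S, w (b z : K) ≤ G * Real.exp B := fun z hz => by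
    have h1 := hle z hz j₀ hj₀ w
    rw [← Real.log_le_log_iff (hpos z hz w) (by positivity), Real.log_mul (by positivity)
      (by positivity), Real.log_exp]
    have := Real.log_le_log (hpos j₀ hj₀ w) hj₀G
    linarith
  have hζS : ζ ∈ S := hmem.mpr hζ.pow_eq_one
  have hζ1 : ζ ≠ 1 := hζ.ne_one (by omega)
  have hlow := (hsub ζ hζS 1 hone hζ1 w).1
  have hid : ((ζ - 1 : 𝓞 K) : K) * u = ζ * b 1 - b ζ := by
    simp only [hb]; push_cast; ring
  have hup : w ((ζ - 1 : 𝓞 K) : K) * w (u : K) ≤ 2 * (G * Real.exp B) := by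
    rw [← map_mul, hid]
    have h1 : w ((ζ : K) * b 1 - b ζ) ≤ w ((ζ : K) * b 1) + w (b ζ : K) := w.1.sub_le_add _ _
    rw [map_mul, hroot ζ hζS, one_mul] at h1
    linarith [hall 1 hone, hall ζ hζS]
  have hu0 : 0 ≤ w (u : K) := apply_nonneg w _
  calc w (u : K) ≤ (m * w ((ζ - 1 : 𝓞 K) : K)) * w (u : K) := le_mul_of_one_le_left hu0 hlow
    _ = m * (w ((ζ - 1 : 𝓞 K) : K) * w (u : K)) := by ring
    _ ≤ m * (2 * (G * Real.exp B)) := by gcongr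
    _ = 2 * m * G * Real.exp B := by ring
    _ ≤ _ := by gcongr

/-- The number field `K` is spanned over `ℚ` by `D` algebraic integers, all of whose conjugates
have absolute value at most `W`. -/
def IsSpannedByBounded (K : Type*) [Field K] [CharZero K] (D : ℕ) (W : ℝ) : Prop :=
  ∃ b : Fin D → 𝓞 K, Submodule.span ℚ (Set.range fun i => (b i : K)) = ⊤ ∧
    ∀ (i : Fin D) (w : InfinitePlace K), w (b i : K) ≤ W

theorem IsSpannedByBounded.finrank_le {K : Type*} [Field K] [CharZero K] {D : ℕ} {W : ℝ}
    (h : IsSpannedByBounded K D W) : finrank ℚ K ≤ D := by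
  obtain ⟨b, hb, -⟩ := h
  have := finrank_range_le_card (R := ℚ) (fun i => (b i : K))
  rw [Set.finrank, hb, finrank_top, Fintype.card_fin] at this
  exact this

theorem isSpannedByBounded_rat : IsSpannedByBounded ℚ 1 1 := by
  refine ⟨fun _ => 1, ?_, fun _ w => by simp⟩
  rw [Set.range_const]
  exact Ideal.span_singleton_one

theorem IsSpannedByBounded.abs_discr_le {K : Type*} [Field K] [NumberField K] {D : ℕ} {W : ℝ}
    (h : IsSpannedByBounded K D W) (hW : 1 ≤ W) : |(discr K : ℝ)| ≤ (D * W) ^ (2 * D) := by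
  classical
  have hfin := h.finrank_le
  obtain ⟨b, hb, hbW⟩ := h
  have hex := Submodule.exists_fun_fin_finrank_span_eq ℚ (Set.range fun i => (b i : K))
  rw [hb, finrank_top] at hex
  obtain ⟨f, hf, hfspan, hfind⟩ := hex
  choose r hr using hf
  let c : Basis (Fin (finrank ℚ K)) ℚ K := Basis.mk hfind hfspan.ge
  have hc : ∀ i, c i = (b (r i) : K) := fun i => by
    rw [Basis.mk_apply]; exact (hr i).symm
  let e : Free.ChooseBasisIndex ℤ (𝓞 K) ≃ Fin (finrank ℚ K) := (integralBasis K).indexEquiv c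
  let ω := (integralBasis K).reindex e
  let P : Matrix (Fin (finrank ℚ K)) (Fin (finrank ℚ K)) ℤ := fun i j =>
    (RingOfIntegers.basis K).repr (b (r j)) (e.symm i)
  have hP : ω.toMatrix c = P.map (Int.castRingHom ℚ) := by
    ext i j
    simp only [Basis.toMatrix_apply, hc, ω, P, Basis.repr_reindex_apply]
    exact integralBasis_repr_apply K _ _
  have h1 : Algebra.discr ℚ c = ((P.det ^ 2 * discr K : ℤ) : ℚ) := by
    have h := Algebra.discr_of_matrix_vecMul ω (ω.toMatrix c)
    rw [ω.toMatrix_map_vecMul c, hP] at h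
    rw [h, show (Algebra.discr ℚ ω) = discr K by
      rw [coe_discr, ← Algebra.discr_reindex ℚ (integralBasis K) e]; simp [ω]]
    push_cast
    congr 2
  have h0 : P.det ^ 2 * discr K ≠ 0 := by
    have h := Algebra.discr_not_zero_of_basis ℚ c
    rw [h1] at h
    exact_mod_cast h
  have h2 : |(discr K : ℝ)| ≤ |((P.det ^ 2 * discr K : ℤ) : ℝ)| := by
    rw [← Int.cast_abs, ← Int.cast_abs, abs_mul]
    have : 1 ≤ |P.det ^ 2| := Int.one_le_abs (left_ne_zero_of_mul h0)
    exact_mod_cast le_mul_of_one_le_left (abs_nonneg _) this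
  let ε : Fin (finrank ℚ K) ≃ (K →ₐ[ℚ] ℂ) := Fintype.equivOfCardEq (by
    rw [Fintype.card_fin, AlgHom.card])
  have h3 := Algebra.discr_eq_det_embeddingsMatrixReindex_pow_two ℚ ℂ (c : _ → K) ε
  have h4 : ‖(Algebra.embeddingsMatrixReindex ℚ ℂ (c : _ → K) ε).det‖ ≤
      (finrank ℚ K).factorial • W ^ finrank ℚ K := by
    have := Matrix.det_le (A := Algebra.embeddingsMatrixReindex ℚ ℂ (c : _ → K) ε)
      (abv := NormedField.toAbsoluteValue ℂ) (x := W) (fun i j => by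
        have := hbW (r i) (InfinitePlace.mk ((ε j : K →ₐ[ℚ] ℂ) : K →+* ℂ))
        rw [InfinitePlace.apply] at this
        simp only [Algebra.embeddingsMatrixReindex, Algebra.embeddingsMatrix, Matrix.reindex_apply,
          Matrix.submatrix_apply, Matrix.of_apply, hc]
        exact this)
    rw [Fintype.card_fin] at this
    exact this
  have h5 : |((P.det ^ 2 * discr K : ℤ) : ℝ)| =
      ‖(Algebra.embeddingsMatrixReindex ℚ ℂ (c : _ → K) ε).det‖ ^ 2 := by
    rw [← norm_pow, ← h3, h1, eq_ratCast, Rat.cast_intCast, Complex.norm_intCast]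
  have hD1 : finrank ℚ K ≠ 0 := finrank_pos.ne'
  have hD : (1 : ℝ) ≤ D := by exact_mod_cast (Nat.one_le_iff_ne_zero.mpr hD1).trans hfin
  have h6 : ‖(Algebra.embeddingsMatrixReindex ℚ ℂ (c : _ → K) ε).det‖ ≤ (D * W) ^ D := by
    refine h4.trans ?_
    rw [nsmul_eq_mul]
    have h7 : ((finrank ℚ K).factorial : ℝ) ≤ (D : ℝ) ^ finrank ℚ K := by
      exact_mod_cast (Nat.factorial_le_pow _).trans (Nat.pow_le_pow_left hfin _)
    calc ((finrank ℚ K).factorial : ℝ) * W ^ finrank ℚ K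
        ≤ (D : ℝ) ^ finrank ℚ K * W ^ finrank ℚ K := by gcongr
      _ = (D * W) ^ finrank ℚ K := (mul_pow _ _ _).symm
      _ ≤ (D * W) ^ D := pow_le_pow_right₀ (one_le_mul_of_one_le_of_one_le hD hW) hfin
  calc |(discr K : ℝ)| ≤ _ := h2
    _ = _ := h5
    _ ≤ ((D * W) ^ D) ^ 2 := by gcongr
    _ = _ := by rw [← pow_mul, mul_comm 2]

open IntermediateField in
theorem IsSpannedByBounded.adjoin_simple {E Ω : Type*} [Field E] [NumberField E] [Field Ω]
    [CharZero Ω] [Algebra E Ω] {D : ℕ} {W : ℝ} (h : IsSpannedByBounded E D W) (hW : 0 ≤ W) {z : Ω}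
    (hz : IsIntegral ℤ z) {q : Polynomial E} (hq : q ≠ 0) (hqz : Polynomial.aeval z q = 0)
    {V : ℝ} (hV : ∀ w : InfinitePlace E⟮z⟯, ∀ j < q.natDegree, w (AdjoinSimple.gen E z) ^ j ≤ V) :
    NumberField E⟮z⟯ ∧ IsSpannedByBounded E⟮z⟯ (D * q.natDegree) (W * V) := by
  have hzE : IsIntegral E z := isAlgebraic_iff_isIntegral.mp ⟨q, hq, hqz⟩
  constructor
  · have : FiniteDimensional E E⟮z⟯ := adjoin.finiteDimensional hzE
    exact { to_charZero := inferInstance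
            to_finiteDimensional := FiniteDimensional.trans ℚ E E⟮z⟯ }
  obtain ⟨b, hb, hbW⟩ := h
  have hg : IsIntegral ℤ (AdjoinSimple.gen E z) := by
    rw [← isIntegral_algebraMap_iff (B := Ω) (algebraMap E⟮z⟯ Ω).injective,
      AdjoinSimple.algebraMap_gen]
    exact hz
  let γ : 𝓞 E⟮z⟯ := ⟨AdjoinSimple.gen E z, hg⟩
  let φ : 𝓞 E →+* 𝓞 E⟮z⟯ := algebraMap (𝓞 E) (𝓞 E⟮z⟯)
  refine ⟨fun i => φ (b (finProdFinEquiv.symm i).1) * γ ^ ((finProdFinEquiv.symm i).2 : ℕ), ?_,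
    fun i w => ?_⟩
  · rw [eq_top_iff]
    rintro x -
    obtain ⟨f, hf⟩ := (adjoin.powerBasis hzE).exists_eq_aeval' x
    rw [adjoin.powerBasis_gen] at hf
    have hq0 : Polynomial.aeval (AdjoinSimple.gen E z) q = 0 := by
      apply (algebraMap E⟮z⟯ Ω).injective
      rw [← Polynomial.aeval_algebraMap_apply, AdjoinSimple.algebraMap_gen, hqz, map_zero]
    have hmod : x = Polynomial.aeval (AdjoinSimple.gen E z) (f % q) := by
      conv_lhs => rw [hf, ← EuclideanDomain.div_add_mod f q]
      rw [map_add, map_mul, hq0, zero_mul, zero_add]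
    have hdeg : ∀ i ∈ (f % q).support, i < q.natDegree := fun i hi => by
      have h1 := (Polynomial.le_degree_of_mem_supp i hi).trans_lt (Polynomial.degree_mod_lt f hq)
      rw [Polynomial.degree_eq_natDegree hq] at h1
      exact_mod_cast h1
    rw [hmod, Polynomial.aeval_eq_sum_range, ← Finset.sum_subset (s₁ := (f % q).support)]
    rotate_left
    · intro i hi
      rw [Finset.mem_range, Nat.lt_succ_iff]
      exact Polynomial.le_natDegree_of_mem_supp i hi
    · intro i _ hi
      rw [Polynomial.notMem_support_iff.mp hi, zero_smul]
    refine Submodule.sum_mem _ fun j hj => ?_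
    have hc : (f % q).coeff j ∈ Submodule.span ℚ (Set.range fun i => (b i : E)) := by
      rw [hb]; trivial
    refine Submodule.span_induction (p := fun c _ => c • AdjoinSimple.gen E z ^ j ∈ _) ?_ ?_ ?_ ?_ hc
    · rintro _ ⟨i, rfl⟩
      refine Submodule.subset_span ⟨finProdFinEquiv (i, ⟨j, hdeg j hj⟩), ?_⟩
      simp only [Equiv.symm_apply_apply]
      rw [Algebra.smul_def]
      rfl
    · rw [zero_smul]; exact Submodule.zero_mem _
    · intro x y _ _ hx hy
      rw [add_smul]; exact Submodule.add_mem _ hx hy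
    · intro c x _ hx
      rw [smul_assoc]; exact Submodule.smul_mem _ _ hx
  · push_cast
    rw [map_mul, map_pow]
    refine mul_le_mul ?_ (hV w _ (finProdFinEquiv.symm i).2.isLt) (by positivity) hW
    exact hbW _ (w.comap (algebraMap E E⟮z⟯))

theorem NumberField.InfinitePlace.apply_le_of_aeval_eq_zero {K : Type*} [Field K] {F : Polynomial ℤ}
    {B : ℝ} (hB : ∀ z : ℂ, Polynomial.aeval z F = 0 → ‖z‖ ≤ B) {x : K}
    (hx : Polynomial.aeval x F = 0) (w : InfinitePlace K) : w x ≤ B := by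
  rw [← w.norm_embedding_eq]
  refine hB _ ?_
  have : Polynomial.aeval ((w.embedding.toIntAlgHom) x) F = 0 := by
    rw [Polynomial.aeval_algHom_apply, hx, map_zero]
  exact this

open IntermediateField in
theorem IsSpannedByBounded.adjoin_root {E : Type*} [Field E] [NumberField E] [Algebra E ℂ]
    {D : ℕ} {W : ℝ} (h : IsSpannedByBounded E D W) (hW : 0 ≤ W) {F : Polynomial ℤ} (hF : F ≠ 0)
    {B : ℝ} (hB1 : 1 ≤ B) (hB : ∀ z : ℂ, Polynomial.aeval z F = 0 → ‖z‖ ≤ B) {z : ℂ}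
    (hz : IsIntegral ℤ z) (hFz : Polynomial.aeval z F = 0) :
    NumberField E⟮z⟯ ∧ IsSpannedByBounded E⟮z⟯ (D * F.natDegree) (W * B ^ F.natDegree) := by
  have hinj : Function.Injective (algebraMap ℤ E) := RingHom.injective_int _
  have hdeg : (F.map (algebraMap ℤ E)).natDegree = F.natDegree :=
    Polynomial.natDegree_map_eq_of_injective hinj F
  have hg : Polynomial.aeval (AdjoinSimple.gen E z) F = 0 := by
    apply (algebraMap E⟮z⟯ ℂ).injective
    rw [← Polynomial.aeval_algebraMap_apply, AdjoinSimple.algebraMap_gen, hFz, map_zero]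
  have := h.adjoin_simple hW hz (q := F.map (algebraMap ℤ E)) ((Polynomial.map_ne_zero_iff hinj).mpr hF)
    (by rwa [Polynomial.aeval_map_algebraMap]) (V := B ^ F.natDegree) (fun w j hj => by
      rw [hdeg] at hj
      have h1 := w.apply_le_of_aeval_eq_zero hB hg
      calc w (AdjoinSimple.gen E z) ^ j ≤ B ^ j := by gcongr
        _ ≤ _ := pow_le_pow_right₀ hB1 hj.le)
  rwa [hdeg] at this

open IntermediateField in
theorem exists_numberField_of_roots {F : Polynomial ℤ} (hF : F ≠ 0) {B : ℝ} (hB1 : 1 ≤ B)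
    (hB : ∀ z : ℂ, Polynomial.aeval z F = 0 → ‖z‖ ≤ B) {z₁ z₂ : ℂ}
    (hz₁ : IsIntegral ℤ z₁) (hz₂ : IsIntegral ℤ z₂) (hF₁ : Polynomial.aeval z₁ F = 0)
    (hF₂ : Polynomial.aeval z₂ F = 0) :
    ∃ (K : Type) (_ : Field K) (_ : NumberField K) (α₁ α₂ : 𝓞 K) (φ : K →+* ℂ),
      φ α₁ = z₁ ∧ φ α₂ = z₂ ∧
      IsSpannedByBounded K (F.natDegree ^ 2) (B ^ (2 * F.natDegree)) := by
  obtain ⟨hN₁, h₁⟩ := isSpannedByBounded_rat.adjoin_root zero_le_one hF hB1 hB hz₁ hF₁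
  obtain ⟨hN₂, h₂⟩ := h₁.adjoin_root (by positivity) hF hB1 hB hz₂ hF₂
  have key : ∀ x : ℚ⟮z₁⟯⟮z₂⟯, IsIntegral ℤ (x : ℂ) → IsIntegral ℤ x := fun x hx =>
    (isIntegral_algebraMap_iff (B := ℂ) (algebraMap ℚ⟮z₁⟯⟮z₂⟯ ℂ).injective).mp hx
  refine ⟨ℚ⟮z₁⟯⟮z₂⟯, inferInstance, hN₂,
    ⟨algebraMap ℚ⟮z₁⟯ ℚ⟮z₁⟯⟮z₂⟯ (AdjoinSimple.gen ℚ z₁), key _ hz₁⟩,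
    ⟨AdjoinSimple.gen _ z₂, key _ hz₂⟩, algebraMap _ ℂ, rfl, rfl, ?_⟩
  convert h₂ using 1
  · ring
  · ring

open IntermediateField in
theorem IsSpannedByBounded.exists_pow_eq {K : Type} [Field K] [NumberField K] {D : ℕ} {W : ℝ}
    (h : IsSpannedByBounded K D W) (hW : 0 ≤ W) {m : ℕ} (hm : m ≠ 0) {t : 𝓞 K} {T : ℝ} (hT : 1 ≤ T)
    (ht : ∀ w : InfinitePlace K, w (t : K) ≤ T) :
    ∃ (L : Type) (_ : Field L) (_ : NumberField L) (i : K →+* L) (τ ζ : 𝓞 L),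
      τ ^ m = RingOfIntegers.mapRingHom i t ∧ IsPrimitiveRoot ζ m ∧
      IsSpannedByBounded L (D * m ^ 2) (W * T) := by
  obtain ⟨τ, hτ⟩ := IsAlgClosed.exists_pow_nat_eq (algebraMap K (AlgebraicClosure K) t)
    (Nat.pos_of_ne_zero hm)
  have : NeZero (m : AlgebraicClosure K) := ⟨by exact_mod_cast hm⟩
  have hζ := HasEnoughRootsOfUnity.exists_primitiveRoot (AlgebraicClosure K) m
  obtain ⟨ζ, hζ⟩ := hζ
  have hτi : IsIntegral ℤ τ := by
    refine IsIntegral.of_pow (Nat.pos_of_ne_zero hm) ?_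
    rw [hτ]
    exact t.isIntegral_coe.map (algebraMap K (AlgebraicClosure K)).toIntAlgHom
  have hζi : IsIntegral ℤ ζ := hζ.isIntegral (Nat.pos_of_ne_zero hm)
  have hτg : AdjoinSimple.gen K τ ^ m = algebraMap K K⟮τ⟯ t := by
    apply (algebraMap K⟮τ⟯ (AlgebraicClosure K)).injective
    rw [map_pow, AdjoinSimple.algebraMap_gen, hτ]
    rfl
  obtain ⟨hN₁, h₁⟩ := h.adjoin_simple hW hτi (q := Polynomial.X ^ m - Polynomial.C (t : K))
    (Polynomial.X_pow_sub_C_ne_zero (Nat.pos_of_ne_zero hm) _) (by simp [hτ]) (V := T)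
    (fun w j hj => by
      rw [Polynomial.natDegree_X_pow_sub_C] at hj
      have h1 : w (AdjoinSimple.gen K τ) ^ m ≤ T := by
        rw [← map_pow, hτg]
        exact ht (w.comap (algebraMap K K⟮τ⟯))
      rcases le_total (w (AdjoinSimple.gen K τ)) 1 with h2 | h2
      · exact (pow_le_one₀ (apply_nonneg w _) h2).trans hT
      · exact (pow_le_pow_right₀ h2 hj.le).trans h1)
  rw [Polynomial.natDegree_X_pow_sub_C] at h₁
  have hζg : AdjoinSimple.gen K⟮τ⟯ ζ ^ m = 1 := by
    apply (algebraMap K⟮τ⟯⟮ζ⟯ (AlgebraicClosure K)).injective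
    rw [map_pow, AdjoinSimple.algebraMap_gen, hζ.pow_eq_one, map_one]
  obtain ⟨hN₂, h₂⟩ := h₁.adjoin_simple (by positivity) hζi
    (q := Polynomial.X ^ m - Polynomial.C (1 : K⟮τ⟯))
    (Polynomial.X_pow_sub_C_ne_zero (Nat.pos_of_ne_zero hm) _) (by simp [hζ.pow_eq_one]) (V := 1)
    (fun w j hj => by
      have h1 : w (AdjoinSimple.gen K⟮τ⟯ ζ) ^ m = 1 := by
        rw [← map_pow, hζg, map_one]
      rw [(pow_eq_one_iff_of_nonneg (apply_nonneg w _) hm).mp h1, one_pow])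
  rw [Polynomial.natDegree_X_pow_sub_C] at h₂
  have key : ∀ x : K⟮τ⟯⟮ζ⟯, IsIntegral ℤ (x : AlgebraicClosure K) → IsIntegral ℤ x := fun x hx =>
    (isIntegral_algebraMap_iff (B := AlgebraicClosure K)
      (algebraMap K⟮τ⟯⟮ζ⟯ (AlgebraicClosure K)).injective).mp hx
  refine ⟨K⟮τ⟯⟮ζ⟯, inferInstance, hN₂, (algebraMap K⟮τ⟯ K⟮τ⟯⟮ζ⟯).comp (algebraMap K K⟮τ⟯),
    ⟨algebraMap K⟮τ⟯ K⟮τ⟯⟮ζ⟯ (AdjoinSimple.gen K τ), key _ hτi⟩, ⟨AdjoinSimple.gen _ ζ, key _ hζi⟩,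
    ?_, ?_, ?_⟩
  · apply RingOfIntegers.ext
    change algebraMap K⟮τ⟯ K⟮τ⟯⟮ζ⟯ (AdjoinSimple.gen K τ) ^ m = algebraMap K⟮τ⟯ K⟮τ⟯⟮ζ⟯ _
    rw [← map_pow, hτg]
  · have : IsPrimitiveRoot (algebraMap K⟮τ⟯⟮ζ⟯ (AlgebraicClosure K)
        (AdjoinSimple.gen K⟮τ⟯ ζ)) m := hζ
    exact IsPrimitiveRoot.of_map_of_injective
      (f := algebraMap (𝓞 K⟮τ⟯⟮ζ⟯) K⟮τ⟯⟮ζ⟯)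
      (this.of_map_of_injective (algebraMap K⟮τ⟯⟮ζ⟯ (AlgebraicClosure K)).injective)
      RingOfIntegers.coe_injective
  · convert h₂ using 1
    · ring
    · ring

theorem natAbs_norm_le_pow_of_place_le {K : Type*} [Field K] [NumberField K] {z : 𝓞 K} {B : ℝ}
    (hB : ∀ w : InfinitePlace K, w (z : K) ≤ B) :
    ((Algebra.norm ℤ z).natAbs : ℝ) ≤ B ^ finrank ℚ K := by
  have h1 := InfinitePlace.prod_eq_abs_norm (z : K)
  rw [← Algebra.coe_norm_int] at h1
  have h2 : ((Algebra.norm ℤ z).natAbs : ℝ) = ∏ w : InfinitePlace K, w (z : K) ^ w.mult := by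
    rw [h1, Nat.cast_natAbs]
    push_cast
    rfl
  rw [h2, ← InfinitePlace.sum_mult_eq, ← Finset.prod_pow_eq_pow_sum]
  exact Finset.prod_le_prod (fun _ _ => by positivity) fun w _ =>
    pow_le_pow_left₀ (apply_nonneg w _) (hB w) _

theorem NumberField.InfinitePlace.exists_one_le {K : Type*} [Field K] [NumberField K] {z : 𝓞 K}
    (hz : z ≠ 0) : ∃ w : InfinitePlace K, 1 ≤ w (z : K) := by
  by_contra! hcon
  obtain ⟨w⟩ : Nonempty (InfinitePlace K) := inferInstance
  exact absurd (InfinitePlace.one_le_of_lt_one hz fun {w'} _ => hcon w') (not_le.mpr (hcon w))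

theorem log_pow_le_of_le_exp {d m Δ G : ℕ} {P l : ℝ} (hl : 1 ≤ l) (hm : 3 ≤ m)
    (hmP : (m : ℝ) ^ 2 ≤ P) (hdP : (d : ℝ) ≤ P) (hΔ : (Δ : ℝ) ≤ Real.exp (4 * P ^ 2 * l))
    (hG0 : G ≠ 0) (hG : (G : ℝ) ≤ Real.exp (2 * P ^ 2 * l)) :
    Real.log ((((Δ + 1) * (m * G) ^ 2) ^ d : ℕ) : ℝ) ≤ 11 * P ^ 3 * l := by
  have hm' : (3 : ℝ) ≤ m := by exact_mod_cast hm
  have hP : 9 ≤ P := by nlinarith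
  have hPl : 1 ≤ P ^ 2 * l := one_le_mul_of_one_le_of_one_le (one_le_pow₀ (by linarith)) hl
  have hG0' : (0 : ℝ) < G := by exact_mod_cast Nat.pos_of_ne_zero hG0
  have h1 : Real.log (Δ + 1) ≤ 5 * (P ^ 2 * l) := by
    rw [Real.log_le_iff_le_exp (by positivity)]
    have h2 : (1 : ℝ) ≤ Real.exp (4 * P ^ 2 * l) := Real.one_le_exp (by positivity)
    have h3 : (2 : ℝ) ≤ Real.exp (P ^ 2 * l) := by linarith [Real.add_one_le_exp (P ^ 2 * l)]
    have h4 : Real.exp (5 * (P ^ 2 * l)) = Real.exp (4 * P ^ 2 * l) * Real.exp (P ^ 2 * l) := by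
      rw [← Real.exp_add]; congr 1; ring
    rw [h4]
    nlinarith
  have h2 : Real.log m ≤ P ^ 2 * l := by
    have := Real.log_le_self (show (0 : ℝ) ≤ m by positivity)
    have h5 : (m : ℝ) ≤ P := by nlinarith
    have h6 : P ≤ P ^ 2 * l := by nlinarith [mul_nonneg (sq_nonneg P) (sub_nonneg.mpr hl)]
    linarith
  have h3 : Real.log G ≤ 2 * (P ^ 2 * l) := by
    rw [Real.log_le_iff_le_exp hG0', ← mul_assoc]; exact hG
  push_cast
  rw [Real.log_pow, Real.log_mul (by positivity) (by positivity), Real.log_pow,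
    Real.log_mul (by positivity) hG0'.ne']
  push_cast
  have h4 : Real.log (Δ + 1) + 2 * (Real.log m + Real.log G) ≤ 11 * (P ^ 2 * l) := by linarith
  calc (d : ℝ) * (Real.log (Δ + 1) + 2 * (Real.log m + Real.log G))
      ≤ d * (11 * (P ^ 2 * l)) := by gcongr
    _ ≤ P * (11 * (P ^ 2 * l)) := by gcongr
    _ = _ := by ring

theorem add_mul_pow_le_exp_exp {d m G R : ℕ} {P l y : ℝ} (hl : 1 ≤ l) (hm : 3 ≤ m) (hd : d ≠ 0)
    (hmP : (m : ℝ) ^ 2 ≤ P) (hdP : (d : ℝ) ≤ P) (hG : (G : ℝ) ≤ Real.exp (2 * P ^ 2 * l))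
    (hy : y ≤ 11 * P ^ 3 * l) (hR : (R : ℝ) ≤ Real.exp (P * l)) :
    R + R * (2 * m * G * Real.exp (Real.exp (16 * d * (50 + 10 * Real.log d + y)))) ^ m ≤
      Real.exp (Real.exp (200 * P ^ 4 * l)) := by
  have hm' : (3 : ℝ) ≤ m := by exact_mod_cast hm
  have hP : 9 ≤ P := by nlinarith
  obtain ⟨Z, hZ⟩ : ∃ Z, Z = 192 * P ^ 4 * l := ⟨_, rfl⟩
  have hd1 : (1 : ℝ) ≤ d := by exact_mod_cast Nat.one_le_iff_ne_zero.mpr hd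
  have hlogd : Real.log d ≤ P := (Real.log_le_self (by positivity)).trans hdP
  have hP3 : 81 * P ≤ P ^ 3 * l := by
    have h1 : 81 * P ≤ P ^ 3 := by nlinarith
    nlinarith [mul_nonneg (pow_nonneg (by linarith : (0 : ℝ) ≤ P) 3) (sub_nonneg.mpr hl)]
  have hexp : 16 * d * (50 + 10 * Real.log d + y) ≤ Z := by
    have h1 : 50 + 10 * Real.log d + y ≤ 12 * (P ^ 3 * l) := by linarith
    calc 16 * (d : ℝ) * (50 + 10 * Real.log d + y) ≤ 16 * d * (12 * (P ^ 3 * l)) := by gcongr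
      _ ≤ 16 * P * (12 * (P ^ 3 * l)) := by gcongr
      _ = Z := by rw [hZ]; ring
  have h2m : 2 * (m : ℝ) ≤ Real.exp P := by
    have := Real.add_one_le_exp P
    nlinarith
  have hU : 2 * m * G * Real.exp (Real.exp (16 * d * (50 + 10 * Real.log d + y))) ≤
      Real.exp (P + 2 * P ^ 2 * l + Real.exp Z) := by
    rw [Real.exp_add, Real.exp_add]
    gcongr
  have hmPP : (m : ℝ) ≤ P := by nlinarith
  have hZ1 : P * l + 1 + P * (P + 2 * P ^ 2 * l) ≤ Real.exp Z := by
    have h1 := Real.add_one_le_exp Z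
    have h2 : P ^ 4 * l ≥ 9 * (P ^ 3 * l) := by
      have : 0 ≤ P ^ 3 * l := by positivity
      nlinarith
    have h3 : P * l ≤ P ^ 3 * l := by
      have : P ≤ P ^ 3 := by nlinarith
      nlinarith
    have h4 : P ^ 2 ≤ P ^ 3 * l := by
      have : P ^ 2 ≤ P ^ 3 := by nlinarith [sq_nonneg P]
      nlinarith [mul_nonneg (pow_nonneg (by linarith : (0 : ℝ) ≤ P) 3) (sub_nonneg.mpr hl)]
    nlinarith
  have h0 : 0 ≤ P + 2 * P ^ 2 * l + Real.exp Z := by positivity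
  calc R + R * (2 * m * G * Real.exp (Real.exp (16 * d * (50 + 10 * Real.log d + y)))) ^ m
      ≤ Real.exp (P * l) + Real.exp (P * l) * Real.exp (P + 2 * P ^ 2 * l + Real.exp Z) ^ m := by
        gcongr
    _ ≤ Real.exp (P * l) * Real.exp (P + 2 * P ^ 2 * l + Real.exp Z) ^ m * 2 := by
        have : 1 ≤ Real.exp (P + 2 * P ^ 2 * l + Real.exp Z) ^ m :=
          one_le_pow₀ (Real.one_le_exp h0)
        nlinarith [Real.exp_pos (P * l)]
    _ ≤ Real.exp (P * l) * Real.exp (P + 2 * P ^ 2 * l + Real.exp Z) ^ m * Real.exp 1 := by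
        gcongr
        linarith [Real.add_one_le_exp (1 : ℝ)]
    _ = Real.exp (P * l + m * (P + 2 * P ^ 2 * l + Real.exp Z) + 1) := by
        rw [← Real.exp_nat_mul, ← Real.exp_add, ← Real.exp_add]
    _ ≤ Real.exp (Real.exp (200 * P ^ 4 * l)) := by
        rw [Real.exp_le_exp]
        have h1 : m * (P + 2 * P ^ 2 * l + Real.exp Z) ≤ P * (P + 2 * P ^ 2 * l + Real.exp Z) := by
          gcongr
        have h2 : P + 1 ≤ Real.exp P := Real.add_one_le_exp P
        have h3 : Real.exp P * Real.exp Z ≤ Real.exp (200 * P ^ 4 * l) := by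
          rw [← Real.exp_add, Real.exp_le_exp, hZ]
          have : P ≤ P ^ 4 * l := by nlinarith
          nlinarith
        nlinarith [Real.exp_pos Z]

/-- If `X - α₁` and `X - α₂` are both, up to bounded factors, `m`-th powers, then the integer `X`
is bounded effectively. -/
theorem abs_le_exp_exp_of_sub_mul_eq_mul_pow {K : Type} [Field K] [NumberField K] {D m R : ℕ}
    {W P l : ℝ} (hm : 3 ≤ m) (hK : IsSpannedByBounded K D W) (hW : 1 ≤ W) (hl : 1 ≤ l)
    {α₁ α₂ ρ₁ ρ₂ ξ₁ ξ₂ : 𝓞 K} {A₁ A₂ : ℕ} {X : ℤ} (hα : α₁ ≠ α₂) (hρ₁ : ρ₁ ≠ 0) (hρ₂ : ρ₂ ≠ 0)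
    (hA₁ : A₁ ≠ 0) (h₁ : ((X : 𝓞 K) - α₁) * ρ₁ = A₁ * ξ₁ ^ m)
    (h₂ : ((X : 𝓞 K) - α₂) * ρ₂ = A₂ * ξ₂ ^ m) (hR : 2 ≤ R) (hA₁R : A₁ ≤ R) (hA₂R : A₂ ≤ R)
    (hρ₁R : ∀ w : InfinitePlace K, w (ρ₁ : K) ≤ R) (hρ₂R : ∀ w : InfinitePlace K, w (ρ₂ : K) ≤ R)
    (hα₁R : ∀ w : InfinitePlace K, w (α₁ : K) ≤ R) (hα₂R : ∀ w : InfinitePlace K, w (α₂ : K) ≤ R)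
    (hDP : (D : ℝ) * m ^ 2 ≤ P) (hWP : W * (R : ℝ) ^ (2 * m) ≤ Real.exp (P * l))
    (hRP : (R : ℝ) ^ (2 * m + 2) ≤ Real.exp (P * l)) :
    |(X : ℝ)| ≤ Real.exp (Real.exp (200 * P ^ 4 * l)) := by
  have hm0 : m ≠ 0 := by omega
  have hR2 : (2 : ℝ) ≤ R := by exact_mod_cast hR
  have hR1 : (1 : ℝ) ≤ R := by linarith
  have hA₁R' : (A₁ : ℝ) ≤ R := by exact_mod_cast hA₁R
  have hA₂R' : (A₂ : ℝ) ≤ R := by exact_mod_cast hA₂R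
  have hnatR : ∀ (w : InfinitePlace K) (k : ℕ), w ((k : 𝓞 K) : K) = k := fun w k => by
    rw [← w.norm_embedding_eq]; simp
  have hAρ : ∀ (w : InfinitePlace K) (k : ℕ),
      w (((A₁ : 𝓞 K) * ρ₂) ^ k : 𝓞 K) ≤ (R : ℝ) ^ (2 * k) := fun w k => by
    have : (((A₁ : 𝓞 K) * ρ₂) ^ k : 𝓞 K) = ((((A₁ : 𝓞 K) : K) * (ρ₂ : K)) ^ k : K) := by push_cast; rfl
    rw [this, map_pow, map_mul, hnatR, pow_mul, sq]
    gcongr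
    exact hρ₂R w
  obtain ⟨k, rfl⟩ : ∃ k, m = k + 1 := ⟨m - 1, by omega⟩
  obtain ⟨t, ht⟩ : ∃ t : 𝓞 K, t = A₂ * ρ₁ * (A₁ * ρ₂) ^ k := ⟨_, rfl⟩
  have htR : ∀ w : InfinitePlace K, w (t : K) ≤ (R : ℝ) ^ (2 * (k + 1)) := fun w => by
    have : (t : K) = ((A₂ : 𝓞 K) : K) * ρ₁ * (((A₁ : 𝓞 K) * ρ₂) ^ k : 𝓞 K) := by
      rw [ht]; push_cast; ring
    rw [this, map_mul, map_mul, hnatR]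
    calc (A₂ : ℝ) * w (ρ₁ : K) * w (((A₁ : 𝓞 K) * ρ₂) ^ k : 𝓞 K) ≤ R * R * (R : ℝ) ^ (2 * k) := by
          gcongr
          · exact hρ₁R w
          · exact hAρ w k
      _ = _ := by ring
  obtain ⟨L, _, _, i, τ, ζ, hτ, hζ, hL⟩ := hK.exists_pow_eq (by linarith) hm0
    (one_le_pow₀ hR1) htR
  set j := RingOfIntegers.mapRingHom i with hj
  have hji : ∀ x : 𝓞 K, ((j x : 𝓞 L) : L) = i x := fun x => rfl
  have hwj : ∀ (w : InfinitePlace L) (x : 𝓞 K), w (j x : L) = w.comap i (x : K) := fun w x => rfl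
  have hjinj : Function.Injective j := fun x y hxy => by
    apply RingOfIntegers.coe_injective
    apply i.injective
    rw [← hji, ← hji, hxy]
  obtain ⟨g₀, hg₀⟩ : ∃ g : 𝓞 K, g = ρ₁ * ρ₂ * (A₁ * ρ₂) ^ k * (α₂ - α₁) := ⟨_, rfl⟩
  have hAK : (A₁ : 𝓞 K) ≠ 0 := by exact_mod_cast hA₁
  have hg₀0 : g₀ ≠ 0 := by
    rw [hg₀]
    exact mul_ne_zero (mul_ne_zero (mul_ne_zero hρ₁ hρ₂) (pow_ne_zero _ (mul_ne_zero hAK hρ₂)))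
      (sub_ne_zero.mpr hα.symm)
  have hg₀R : ∀ w : InfinitePlace K, w (g₀ : K) ≤ (R : ℝ) ^ (2 * (k + 1) + 2) := fun w => by
    have : (g₀ : K) = (ρ₁ : K) * ρ₂ * (((A₁ : 𝓞 K) * ρ₂) ^ k : 𝓞 K) * (α₂ - α₁) := by
      rw [hg₀]; push_cast; ring
    rw [this, map_mul, map_mul, map_mul]
    have h3 : w ((α₂ : K) - α₁) ≤ w (α₂ : K) + w (α₁ : K) := w.1.sub_le_add _ _
    have h4 : w ((α₂ : K) - α₁) ≤ R * R := by nlinarith [hα₁R w, hα₂R w]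
    calc w (ρ₁ : K) * w (ρ₂ : K) * w (((A₁ : 𝓞 K) * ρ₂) ^ k : 𝓞 K) * w ((α₂ : K) - α₁)
        ≤ R * R * (R : ℝ) ^ (2 * k) * (R * R) := by
          gcongr
          · exact hρ₁R w
          · exact hρ₂R w
          · exact hAρ w k
      _ = _ := by ring
  obtain ⟨u, hu⟩ : ∃ u : 𝓞 K, u = A₁ * ρ₂ * ξ₁ := ⟨_, rfl⟩
  have hrel : j u ^ (k + 1) - (τ * j ξ₂) ^ (k + 1) = j g₀ := by
    rw [mul_pow, hτ, ← map_pow, ← map_pow, ← map_mul, ← map_sub, hg₀, hu, ht]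
    congr 1
    have e1 : ρ₁ * ρ₂ * (A₁ * ρ₂) ^ k * (α₂ - α₁) = (A₁ * ρ₂) ^ k *
        (ρ₂ * ((X - α₁) * ρ₁) - ρ₁ * ((X - α₂) * ρ₂)) := by ring
    rw [e1, h₁, h₂]
    ring
  have hjg0 : j g₀ ≠ 0 := (map_ne_zero_iff j hjinj).mpr hg₀0
  have hjgR : ∀ w : InfinitePlace L, w (j g₀ : L) ≤ (R : ℝ) ^ (2 * (k + 1) + 2) := fun w => by
    rw [hwj]; exact hg₀R _
  obtain ⟨N, hN⟩ : ∃ N, N = (Algebra.norm ℤ (j g₀)).natAbs := ⟨_, rfl⟩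
  have hN0 : N ≠ 0 := by
    rw [hN, Int.natAbs_ne_zero, Algebra.norm_ne_zero_iff]; exact hjg0
  have hNdvd : j g₀ ∣ (N : 𝓞 L) := by
    have h3 := Ideal.absNorm_mem (Ideal.span {j g₀})
    rwa [Ideal.absNorm_span_singleton, ← hN, Ideal.mem_span_singleton] at h3
  obtain ⟨G, hG⟩ : ∃ G, G = N * R ^ (2 * (k + 1) + 2) := ⟨_, rfl⟩
  have hG0 : G ≠ 0 := hG ▸ mul_ne_zero hN0 (pow_ne_zero _ (by omega))
  have hGdvd : j g₀ ∣ (G : 𝓞 L) := by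
    rw [hG, Nat.cast_mul]; exact hNdvd.mul_right _
  have hN1 : (1 : ℝ) ≤ N := by exact_mod_cast Nat.one_le_iff_ne_zero.mpr hN0
  have hgG : ∀ w : InfinitePlace L, w (j g₀ : L) ≤ G := fun w => by
    rw [hG]; push_cast
    exact (hjgR w).trans (le_mul_of_one_le_left (by positivity) hN1)
  have hd0 : finrank ℚ L ≠ 0 := finrank_pos.ne'
  have hdD : finrank ℚ L ≤ D * (k + 1) ^ 2 := hL.finrank_le
  have hdD' : ((D * (k + 1) ^ 2 : ℕ) : ℝ) ≤ P := by push_cast at hDP ⊢; exact hDP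
  have hdP : (finrank ℚ L : ℝ) ≤ P := le_trans (by exact_mod_cast hdD) hdD'
  have hD0 : 1 ≤ D := Nat.one_le_iff_ne_zero.mpr (by rintro rfl; omega)
  have hmP : ((k + 1 : ℕ) : ℝ) ^ 2 ≤ P := by
    refine le_trans ?_ hDP
    exact le_mul_of_one_le_left (by positivity) (by exact_mod_cast hD0)
  have hP1 : 1 ≤ P := by
    refine le_trans ?_ hdP
    exact_mod_cast Nat.one_le_iff_ne_zero.mpr hd0
  have hW' : 1 ≤ W * (R : ℝ) ^ (2 * (k + 1)) :=
    one_le_mul_of_one_le_of_one_le hW (one_le_pow₀ hR1)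
  have hΔ : (((discr L).natAbs : ℕ) : ℝ) ≤ Real.exp (4 * P ^ 2 * l) := by
    have h3 := hL.abs_discr_le hW'
    rw [Nat.cast_natAbs, Int.cast_abs]
    have h4 : ((D * (k + 1) ^ 2 : ℕ) : ℝ) * (W * (R : ℝ) ^ (2 * (k + 1))) ≤
        Real.exp (2 * (P * l)) := by
      rw [two_mul (P * l), Real.exp_add]
      refine mul_le_mul ?_ hWP (by linarith) (by positivity)
      refine hdD'.trans ?_
      have := Real.add_one_le_exp (P * l)
      nlinarith
    calc |(discr L : ℝ)| ≤ _ := h3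
      _ ≤ Real.exp (2 * (P * l)) ^ (2 * (D * (k + 1) ^ 2)) :=
          pow_le_pow_left₀ (by positivity) h4 _
      _ = Real.exp (((2 * (D * (k + 1) ^ 2) : ℕ) : ℝ) * (2 * (P * l))) := (Real.exp_nat_mul _ _).symm
      _ ≤ _ := by
          rw [Real.exp_le_exp, Nat.cast_mul, Nat.cast_two]
          calc 2 * ((D * (k + 1) ^ 2 : ℕ) : ℝ) * (2 * (P * l)) ≤ 2 * P * (2 * (P * l)) := by gcongr
            _ = _ := by ring
  have hGP : (G : ℝ) ≤ Real.exp (2 * P ^ 2 * l) := by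
    have h3 := natAbs_norm_le_pow_of_place_le hjgR
    rw [← hN] at h3
    have h4 : (N : ℝ) ≤ Real.exp (P ^ 2 * l) := by
      calc (N : ℝ) ≤ _ := h3
        _ ≤ Real.exp (P * l) ^ finrank ℚ L := pow_le_pow_left₀ (by positivity) hRP _
        _ = Real.exp (finrank ℚ L * (P * l)) := (Real.exp_nat_mul _ _).symm
        _ ≤ Real.exp (P * (P * l)) := by gcongr
        _ = _ := by rw [sq, mul_assoc]
    rw [hG]
    push_cast
    calc (N : ℝ) * (R : ℝ) ^ (2 * (k + 1) + 2) ≤ Real.exp (P ^ 2 * l) * Real.exp (P * l) := by gcongr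
      _ ≤ Real.exp (P ^ 2 * l) * Real.exp (P ^ 2 * l) := by
          gcongr
          nlinarith
      _ = _ := by rw [← Real.exp_add]; congr 1; ring
  have hRexp : (R : ℝ) ≤ Real.exp (P * l) := (le_self_pow₀ hR1 (by omega)).trans hRP
  obtain ⟨w, hw⟩ := InfinitePlace.exists_one_le (K := L)
    (z := j (ρ₁ * (A₁ * ρ₂) ^ (k + 1))) ((map_ne_zero_iff j hjinj).mpr
      (mul_ne_zero hρ₁ (pow_ne_zero _ (mul_ne_zero hAK hρ₂))))
  have hplace := place_le_of_pow_sub_pow_eq hm hζ hrel hjg0 hG0 hGdvd hgG rfl w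
  have hXeq : j ((X : 𝓞 K) - α₁) * j (ρ₁ * (A₁ * ρ₂) ^ (k + 1)) = j (A₁ * u ^ (k + 1)) := by
    rw [← map_mul, hu]
    congr 1
    rw [← mul_assoc, h₁]
    ring
  have hXw : w (j ((X : 𝓞 K) - α₁) : L) ≤ R * w (j u : L) ^ (k + 1) := by
    have h3 : w (j ((X : 𝓞 K) - α₁) : L) * w (j (ρ₁ * (A₁ * ρ₂) ^ (k + 1)) : L) =
        A₁ * w (j u : L) ^ (k + 1) := by
      rw [← map_mul, ← map_mul, hXeq]
      simp
    calc w (j ((X : 𝓞 K) - α₁) : L)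
        ≤ w (j ((X : 𝓞 K) - α₁) : L) * w (j (ρ₁ * (A₁ * ρ₂) ^ (k + 1)) : L) :=
          le_mul_of_one_le_right (apply_nonneg w _) hw
      _ = _ := h3
      _ ≤ _ := by gcongr
  have hXabs : |(X : ℝ)| ≤ R + w (j ((X : 𝓞 K) - α₁) : L) := by
    have h3 : w (j (X : 𝓞 K) : L) = |(X : ℝ)| := by
      rw [← w.norm_embedding_eq]; simp
    have h4 : (j (X : 𝓞 K) : L) = (j α₁ : L) + (j ((X : 𝓞 K) - α₁) : L) := by
      rw [map_sub]; push_cast; ring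
    rw [← h3, h4]
    refine (w.1.add_le _ _).trans ?_
    exact add_le_add (hα₁R (w.comap i)) le_rfl
  refine le_trans ?_ (add_mul_pow_le_exp_exp (d := finrank ℚ L) (G := G) hl hm hd0 hmP hdP hGP
    (log_pow_le_of_le_exp hl hm hmP hdP hΔ hG0 hGP) hRexp)
  refine hXabs.trans ?_
  gcongr
  refine hXw.trans ?_
  gcongr

theorem Polynomial.norm_aeval_le {q : Polynomial ℤ} {k : ℕ} {C V : ℝ} (hq : q.natDegree < k)
    (hC : ∀ i, |(q.coeff i : ℝ)| ≤ C) (hV : 1 ≤ V) {z : ℂ} (hz : ‖z‖ ≤ V) :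
    ‖aeval z q‖ ≤ k * C * V ^ k := by
  have hC0 : 0 ≤ C := (abs_nonneg _).trans (hC 0)
  rw [aeval_eq_sum_range' hq]
  calc ‖∑ i ∈ Finset.range k, q.coeff i • z ^ i‖
      ≤ ∑ i ∈ Finset.range k, ‖q.coeff i • z ^ i‖ := norm_sum_le _ _
    _ ≤ ∑ i ∈ Finset.range k, C * V ^ k := by
        refine Finset.sum_le_sum fun i hi => ?_
        rw [zsmul_eq_mul, norm_mul, norm_pow, Complex.norm_intCast]
        have h1 : ‖z‖ ^ i ≤ V ^ k := (pow_le_pow_left₀ (norm_nonneg _) hz i).trans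
          (pow_le_pow_right₀ hV (Finset.mem_range.mp hi).le)
        exact mul_le_mul (hC i) h1 (by positivity) hC0
    _ = _ := by simp [mul_assoc]

theorem Polynomial.norm_le_of_aeval_eq_zero {q : Polynomial ℤ} (hq : q ≠ 0) (hn : q.natDegree ≠ 0)
    {C : ℝ} (hC : ∀ i, |(q.coeff i : ℝ)| ≤ C) {z : ℂ} (hz : aeval z q = 0) :
    ‖z‖ ≤ q.natDegree * C := by
  have hlead : (1 : ℝ) ≤ |(q.coeff q.natDegree : ℝ)| := by
    rw [← Int.cast_abs]
    exact_mod_cast Int.one_le_abs (leadingCoeff_ne_zero.mpr hq)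
  have hC1 : 1 ≤ C := hlead.trans (hC _)
  have hn1 : (1 : ℝ) ≤ q.natDegree := by exact_mod_cast Nat.one_le_iff_ne_zero.mpr hn
  rcases le_total ‖z‖ 1 with h | h
  · nlinarith
  obtain ⟨k, hk⟩ : ∃ k, q.natDegree = k + 1 := ⟨q.natDegree - 1, by omega⟩
  rw [aeval_eq_sum_range, Finset.sum_range_succ, add_comm, add_eq_zero_iff_eq_neg] at hz
  have h1 : ‖z‖ ^ (k + 1) ≤ q.natDegree * C * ‖z‖ ^ k := by
    calc ‖z‖ ^ (k + 1) ≤ |(q.coeff q.natDegree : ℝ)| * ‖z‖ ^ (k + 1) :=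
          le_mul_of_one_le_left (by positivity) hlead
      _ = ‖q.coeff q.natDegree • z ^ q.natDegree‖ := by
          rw [zsmul_eq_mul, norm_mul, norm_pow, Complex.norm_intCast, hk]
      _ = ‖∑ i ∈ Finset.range q.natDegree, q.coeff i • z ^ i‖ := by rw [hz, norm_neg]
      _ ≤ ∑ i ∈ Finset.range q.natDegree, ‖q.coeff i • z ^ i‖ := norm_sum_le _ _
      _ ≤ ∑ i ∈ Finset.range q.natDegree, C * ‖z‖ ^ k := by
          refine Finset.sum_le_sum fun i hi => ?_
          rw [zsmul_eq_mul, norm_mul, norm_pow, Complex.norm_intCast]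
          have : i ≤ k := by have := Finset.mem_range.mp hi; omega
          exact mul_le_mul (hC i) (pow_le_pow_right₀ h this) (by positivity) (by linarith)
      _ = _ := by simp [mul_assoc]
  rw [pow_succ'] at h1
  exact le_of_mul_le_mul_right h1 (by positivity)

theorem Polynomial.scaleRoots_comp_C_mul_X {R : Type*} [CommRing R] (p : Polynomial R) (s : R) :
    (p.scaleRoots s).comp (C s * X) = C (s ^ p.natDegree) * p := by
  have := scaleRoots_eval₂_mul (p := p) (C : R →+* Polynomial R) X s
  rwa [eval₂_C_X, ← C_pow] at this

theorem Polynomial.mul_aeval_derivative_scaleRoots {R A : Type*} [CommRing R] [CommRing A]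
    [Algebra R A] (p : Polynomial R) (s : R) (r : A) :
    algebraMap R A s * aeval (algebraMap R A s * r) (derivative (p.scaleRoots s)) =
      algebraMap R A s ^ p.natDegree * aeval r (derivative p) := by
  have h := congrArg (fun q => aeval r (derivative q)) (scaleRoots_comp_C_mul_X p s)
  simp only [derivative_comp, derivative_C_mul, derivative_X, mul_one, map_mul, aeval_C,
    aeval_comp, aeval_X] at h
  rwa [map_pow] at h

open Polynomial in
theorem Polynomial.norm_le_of_aeval_scaleRoots_eq_zero {p : Polynomial ℤ} {s H : ℕ} (hp : p ≠ 0)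
    (hn : p.natDegree ≠ 0) (hH : ∀ i, (p.coeff i).natAbs ≤ H) (hs : s = p.natDegree * H) {z : ℂ}
    (hz : aeval z (p.scaleRoots p.leadingCoeff) = 0) :
    ‖z‖ ≤ (s : ℝ) ^ 2 ∧ ‖((p.leadingCoeff ^ p.natDegree : ℤ) : ℂ) *
      aeval z (derivative (p.scaleRoots p.leadingCoeff))‖ ≤ (s : ℝ) ^ (4 * p.natDegree) := by
  obtain ⟨c, hc⟩ : ∃ c, c = p.leadingCoeff := ⟨_, rfl⟩
  rw [← hc] at hz ⊢
  have hc0 : c ≠ 0 := hc ▸ leadingCoeff_ne_zero.mpr hp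
  have hcC : (c : ℂ) ≠ 0 := by exact_mod_cast hc0
  obtain ⟨n, hn'⟩ : ∃ n, n = p.natDegree := ⟨_, rfl⟩
  rw [← hn'] at hn hs ⊢
  have hHR : ∀ i, |(p.coeff i : ℝ)| ≤ H := fun i => by
    rw [← Int.cast_abs, Int.abs_eq_natAbs]
    exact_mod_cast hH i
  have hcH : |(c : ℝ)| ≤ H := hc ▸ hHR _
  have hc1 : (1 : ℝ) ≤ |(c : ℝ)| := by
    rw [← Int.cast_abs]; exact_mod_cast Int.one_le_abs hc0
  have hH1 : (1 : ℝ) ≤ H := hc1.trans hcH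
  have hn1 : (1 : ℝ) ≤ n := by exact_mod_cast Nat.one_le_iff_ne_zero.mpr hn
  have hsR : (s : ℝ) = n * H := by rw [hs]; push_cast; rfl
  have hHs : (H : ℝ) ≤ s := by rw [hsR]; nlinarith
  have hns : (n : ℝ) ≤ s := by rw [hsR]; nlinarith
  have hs1 : (1 : ℝ) ≤ s := hn1.trans hns
  obtain ⟨r, hr⟩ : ∃ r : ℂ, z = c * r := ⟨z / c, by field_simp⟩
  have hpr : aeval r p = 0 := by
    have := scaleRoots_eval₂_mul (p := p) (algebraMap ℤ ℂ) r c
    rw [← aeval_def, ← aeval_def, eq_intCast, ← hr, hz] at this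
    exact (mul_eq_zero.mp this.symm).resolve_left (pow_ne_zero _ hcC)
  have hrs : ‖r‖ ≤ s := by
    have := norm_le_of_aeval_eq_zero hp (hn' ▸ hn) hHR hpr
    rwa [← hn', ← hsR] at this
  constructor
  · rw [hr, norm_mul, Complex.norm_intCast, sq]
    exact mul_le_mul (hcH.trans hHs) hrs (norm_nonneg _) (by linarith)
  · have h1 := mul_aeval_derivative_scaleRoots p c r
    rw [eq_intCast, ← hr, ← hn'] at h1
    have h2 : ‖aeval r (derivative p)‖ ≤ n * (s : ℝ) * (s : ℝ) ^ n := by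
      refine norm_aeval_le (hn' ▸ natDegree_derivative_lt (hn' ▸ hn)) (fun i => ?_) hs1 hrs
      rw [coeff_derivative]
      rcases lt_or_ge n (i + 1) with h | h
      · rw [coeff_eq_zero_of_natDegree_lt (hn' ▸ h)]
        simp
      · push_cast
        rw [abs_mul, hsR, mul_comm, show |(i : ℝ) + 1| = ((i + 1 : ℕ) : ℝ) by
          push_cast; exact abs_of_nonneg (by positivity)]
        exact mul_le_mul (by exact_mod_cast h) (hHR _) (abs_nonneg _) (by linarith)
    obtain ⟨k, rfl⟩ : ∃ k, n = k + 1 := ⟨n - 1, by omega⟩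
    have h3 : ((c ^ (k + 1) : ℤ) : ℂ) * aeval z (derivative (p.scaleRoots c)) =
        c ^ k * (c ^ (k + 1) * aeval r (derivative p)) := by
      rw [← h1]; push_cast; ring
    rw [h3, norm_mul, norm_mul, norm_pow, norm_pow, Complex.norm_intCast]
    have h4 := hcH.trans hHs
    calc |(c : ℝ)| ^ k * (|(c : ℝ)| ^ (k + 1) * ‖aeval r (derivative p)‖)
        ≤ (s : ℝ) ^ k * ((s : ℝ) ^ (k + 1) * (s * s * (s : ℝ) ^ (k + 1))) := by
          gcongr
          exact h2.trans (by gcongr)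
      _ = (s : ℝ) ^ (3 * k + 4) := by ring
      _ ≤ _ := pow_le_pow_right₀ hs1 (by omega)

theorem NumberField.exists_mul_eq_mul_pow_of_isSpannedByBounded {K : Type} [Field K] [NumberField K]
    {p : Polynomial ℤ} {s H m : ℕ} (hm : 0 < m) (hp : p ≠ 0)
    (hn : 3 ≤ p.natDegree) (hH : ∀ i, (p.coeff i).natAbs ≤ H) (hs : s = p.natDegree * H)
    (hK : IsSpannedByBounded K (p.natDegree ^ 2) ((s : ℝ) ^ (4 * p.natDegree))) {α : 𝓞 K}
    (hα : Polynomial.aeval α (p.scaleRoots p.leadingCoeff) = 0)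
    (hα' : Polynomial.aeval α (p.scaleRoots p.leadingCoeff).derivative ≠ 0) {x y : ℤ} (hy : y ≠ 0)
    (hxy : p.eval x = y ^ m) : ∃ (ρ ξ : 𝓞 K) (A : ℕ), ρ ≠ 0 ∧ A ≠ 0 ∧
      (((p.leadingCoeff * x : ℤ) : 𝓞 K) - α) * ρ = A * ξ ^ m ∧
      A ≤ s ^ (14 * p.natDegree ^ 3 * m) ∧
      ∀ w : InfinitePlace K, w (ρ : K) ≤ (s : ℝ) ^ (14 * p.natDegree ^ 3 * m) := by
  have hc0 : p.leadingCoeff ≠ 0 := Polynomial.leadingCoeff_ne_zero.mpr hp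
  obtain ⟨ρ, ξ, A, hρ, -, hA, hrel, hAle, hρle⟩ := exists_mul_eq_mul_pow_of_eval_eq hm
    (p.scaleRoots p.leadingCoeff) α hα (p.leadingCoeff ^ p.natDegree) (p.leadingCoeff * x) y
    (pow_ne_zero _ hc0) hy hα' (by rw [Polynomial.scaleRoots_eval_mul, hxy])
  obtain ⟨n, hn'⟩ : ∃ n, n = p.natDegree := ⟨_, rfl⟩
  have hbound : ∀ w : InfinitePlace K, w ((((p.leadingCoeff ^ p.natDegree : ℤ) : 𝓞 K) *
      Polynomial.aeval α (p.scaleRoots p.leadingCoeff).derivative : 𝓞 K) : K) ≤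
      (s : ℝ) ^ (4 * n) := fun w => by
    let ψ : 𝓞 K →ₐ[ℤ] ℂ := (w.embedding.comp (algebraMap (𝓞 K) K)).toIntAlgHom
    have h1 : Polynomial.aeval (ψ α) (p.scaleRoots p.leadingCoeff) = 0 := by
      rw [Polynomial.aeval_algHom_apply, hα, map_zero]
    have h2 := (Polynomial.norm_le_of_aeval_scaleRoots_eq_zero hp (by omega) hH hs h1).2
    rw [← w.norm_embedding_eq, hn']
    rw [Polynomial.aeval_algHom_apply, ← map_intCast ψ, ← map_mul] at h2
    exact h2
  have hN := natAbs_norm_le_pow_of_place_le hbound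
  have hs3 : 3 ≤ s := by
    have : 1 ≤ H := (Int.natAbs_pos.mpr hc0).trans_le (hH _)
    rw [hs]; nlinarith
  have hs1 : (1 : ℝ) ≤ s := by exact_mod_cast (by omega : 1 ≤ s)
  have hd : finrank ℚ K ≤ n ^ 2 := hn' ▸ hK.finrank_le
  have hA' : (A : ℝ) ≤ (s : ℝ) ^ (4 * n ^ 3 * m) := by
    refine (Nat.cast_le.mpr hAle).trans ?_
    rw [Nat.cast_pow]
    refine (pow_le_pow_left₀ (Nat.cast_nonneg _) hN m).trans ?_
    rw [← pow_mul, ← pow_mul]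
    refine pow_le_pow_right₀ hs1 ?_
    calc 4 * n * (finrank ℚ K * m) ≤ 4 * n * (n ^ 2 * m) := by gcongr
      _ = _ := by ring
  have hdisc : |(discr K : ℝ)| + 1 ≤ (s : ℝ) ^ (10 * n ^ 3) := by
    have h1 := hK.abs_discr_le (one_le_pow₀ hs1)
    rw [← hn'] at h1 hs hn
    have hns : (n : ℝ) ≤ s := by
      have : 1 ≤ H := (Int.natAbs_pos.mpr hc0).trans_le (hH _)
      rw [hs]; push_cast
      exact le_mul_of_one_le_right (by positivity) (by exact_mod_cast this)
    have h2 : |(discr K : ℝ)| ≤ (s : ℝ) ^ (8 * n ^ 3 + 4 * n ^ 2) := by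
      calc |(discr K : ℝ)| ≤ _ := h1
        _ ≤ ((s : ℝ) ^ 2 * (s : ℝ) ^ (4 * n)) ^ (2 * n ^ 2) := by push_cast; gcongr
        _ = _ := by rw [← pow_add, ← pow_mul]; ring_nf
    have h3 : (1 : ℝ) ≤ (s : ℝ) ^ (8 * n ^ 3 + 4 * n ^ 2) := one_le_pow₀ hs1
    have h4 : (2 : ℝ) ≤ s := by exact_mod_cast (by omega : 2 ≤ s)
    calc |(discr K : ℝ)| + 1 ≤ (s : ℝ) ^ (8 * n ^ 3 + 4 * n ^ 2) * s := by nlinarith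
      _ = (s : ℝ) ^ (8 * n ^ 3 + 4 * n ^ 2 + 1) := (pow_succ _ _).symm
      _ ≤ _ := pow_le_pow_right₀ hs1 (by nlinarith [sq_nonneg n, Nat.mul_le_mul_right (n ^ 2) hn])
  have hexp : 4 * n ^ 3 * m + 10 * n ^ 3 * m = 14 * n ^ 3 * m := by ring
  rw [← hn']
  refine ⟨ρ, ξ, A, hρ, hA, hrel, ?_, fun w => ?_⟩
  · have : (A : ℝ) ≤ (s : ℝ) ^ (14 * n ^ 3 * m) := hA'.trans (pow_le_pow_right₀ hs1 (by omega))
    exact_mod_cast this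
  · calc w (ρ : K) ≤ _ := hρle w
      _ ≤ (s : ℝ) ^ (4 * n ^ 3 * m) * ((s : ℝ) ^ (10 * n ^ 3)) ^ m := by gcongr
      _ = _ := by rw [← pow_mul, ← pow_add, hexp]

open Polynomial in
theorem Polynomial.aeval_derivative_ne_zero_of_rootMultiplicity_eq_one {p : ℤ[X]} (hp : p ≠ 0)
    {r : ℂ} (hr : rootMultiplicity r (p.map (Int.castRingHom ℂ)) = 1) :
    aeval r p = 0 ∧ aeval r (derivative p) ≠ 0 := by
  have hp' : p.map (Int.castRingHom ℂ) ≠ 0 :=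
    (Polynomial.map_ne_zero_iff (RingHom.injective_int _)).mpr hp
  have h1 : (p.map (Int.castRingHom ℂ)).IsRoot r :=
    (rootMultiplicity_pos hp').mp (by omega)
  have h2 := (one_lt_rootMultiplicity_iff_isRoot (t := r) hp').not.mp (by omega)
  have e : ∀ q : ℤ[X], (q.map (Int.castRingHom ℂ)).eval r = aeval r q := fun q => by
    rw [eval_map, aeval_def]; rfl
  rw [IsRoot, e] at h1
  refine ⟨h1, fun h => h2 ⟨?_, ?_⟩⟩
  · rw [IsRoot, e, h1]
  · rw [IsRoot, derivative_map, e, h]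

/-- The bound for `|x|` when `p(x) = y ^ m` with `y ≠ 0`. -/
theorem abs_le_exp_exp_of_eval_eq {p : Polynomial ℤ} {s H m : ℕ} (hm : 3 ≤ m) (hp : p ≠ 0)
    (hn : 3 ≤ p.natDegree) (hH : ∀ i, (p.coeff i).natAbs ≤ H) (hs : s = p.natDegree * H)
    {r₁ r₂ : ℂ} (hr : r₁ ≠ r₂)
    (hr₁ : Polynomial.rootMultiplicity r₁ (p.map (Int.castRingHom ℂ)) = 1)
    (hr₂ : Polynomial.rootMultiplicity r₂ (p.map (Int.castRingHom ℂ)) = 1) {x y : ℤ} (hy : y ≠ 0)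
    (hxy : p.eval x = y ^ m) :
    |(x : ℝ)| ≤ Real.exp (Real.exp (200 * (42 * (p.natDegree : ℝ) ^ 3 * m ^ 2) ^ 4 * s)) := by
  obtain ⟨c, hc⟩ : ∃ c, c = p.leadingCoeff := ⟨_, rfl⟩
  have hc0 : c ≠ 0 := hc ▸ Polynomial.leadingCoeff_ne_zero.mpr hp
  have hcC : (c : ℂ) ≠ 0 := by exact_mod_cast hc0
  obtain ⟨n, hn'⟩ : ∃ n, n = p.natDegree := ⟨_, rfl⟩
  have hs3 : 3 ≤ s := by
    have : 1 ≤ H := (Int.natAbs_pos.mpr (hc ▸ hc0)).trans_le (hH _)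
    rw [hs]; nlinarith
  have hs1 : (1 : ℝ) ≤ s := by exact_mod_cast (by omega : 1 ≤ s)
  have hF0 : p.scaleRoots c ≠ 0 := Polynomial.scaleRoots_ne_zero hp c
  have hdeg : (p.scaleRoots c).natDegree = n := by rw [Polynomial.natDegree_scaleRoots, hn']
  have hB : ∀ z : ℂ, Polynomial.aeval z (p.scaleRoots c) = 0 → ‖z‖ ≤ (s : ℝ) ^ 2 := fun z hz =>
    (Polynomial.norm_le_of_aeval_scaleRoots_eq_zero hp (by omega) hH hs (hc ▸ hz)).1
  obtain ⟨hr₁0, hr₁'⟩ := Polynomial.aeval_derivative_ne_zero_of_rootMultiplicity_eq_one hp hr₁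
  obtain ⟨hr₂0, hr₂'⟩ := Polynomial.aeval_derivative_ne_zero_of_rootMultiplicity_eq_one hp hr₂
  have hroot : ∀ r : ℂ, Polynomial.aeval r p = 0 →
      Polynomial.aeval ((c : ℂ) * r) (p.scaleRoots c) = 0 := fun r h =>
    Polynomial.scaleRoots_aeval_eq_zero h
  have hder : ∀ r : ℂ, Polynomial.aeval r p.derivative ≠ 0 →
      Polynomial.aeval ((c : ℂ) * r) (p.scaleRoots c).derivative ≠ 0 := fun r h h0 => by
    have := Polynomial.mul_aeval_derivative_scaleRoots p c r
    rw [eq_intCast, h0, mul_zero] at this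
    exact mul_ne_zero (pow_ne_zero _ hcC) h this.symm
  have hint : ∀ r : ℂ, Polynomial.aeval r p = 0 → IsIntegral ℤ ((c : ℂ) * r) := fun r h => by
    have := isIntegral_leadingCoeff_smul p r h
    rwa [← hc, zsmul_eq_mul] at this
  obtain ⟨K, _, _, α₁, α₂, φ, h₁, h₂, hK⟩ := exists_numberField_of_roots hF0
    (one_le_pow₀ hs1) hB (hint r₁ hr₁0) (hint r₂ hr₂0) (hroot r₁ hr₁0) (hroot r₂ hr₂0)
  have hK' : IsSpannedByBounded K (p.natDegree ^ 2) ((s : ℝ) ^ (4 * p.natDegree)) := by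
    rw [hdeg, hn', ← pow_mul, show 2 * (2 * p.natDegree) = 4 * p.natDegree by ring] at hK
    exact hK
  let ψ : 𝓞 K →ₐ[ℤ] ℂ := (φ.comp (algebraMap (𝓞 K) K)).toIntAlgHom
  have hψ : Function.Injective ψ := φ.injective.comp (FaithfulSMul.algebraMap_injective (𝓞 K) K)
  have hψα₁ : ψ α₁ = c * r₁ := h₁
  have hψα₂ : ψ α₂ = c * r₂ := h₂
  have hz : ∀ {α : 𝓞 K} {q : Polynomial ℤ}, Polynomial.aeval α q = 0 ↔
      Polynomial.aeval (ψ α) q = 0 := fun {α q} => by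
    rw [Polynomial.aeval_algHom_apply, map_eq_zero_iff ψ hψ]
  have hα₁ : Polynomial.aeval α₁ (p.scaleRoots c) = 0 := hz.mpr (hψα₁ ▸ hroot r₁ hr₁0)
  have hα₂ : Polynomial.aeval α₂ (p.scaleRoots c) = 0 := hz.mpr (hψα₂ ▸ hroot r₂ hr₂0)
  have hα₁' : Polynomial.aeval α₁ (p.scaleRoots c).derivative ≠ 0 :=
    hz.not.mpr (hψα₁ ▸ hder r₁ hr₁')
  have hα₂' : Polynomial.aeval α₂ (p.scaleRoots c).derivative ≠ 0 :=
    hz.not.mpr (hψα₂ ▸ hder r₂ hr₂')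
  have hα : α₁ ≠ α₂ := fun h => hr (mul_left_cancel₀ hcC (by rw [← hψα₁, ← hψα₂, h]))
  have hαB : ∀ α : 𝓞 K, Polynomial.aeval α (p.scaleRoots c) = 0 →
      ∀ w : InfinitePlace K, w (α : K) ≤ (s : ℝ) ^ (14 * n ^ 3 * m) := fun α h w => by
    refine (w.apply_le_of_aeval_eq_zero hB (x := (α : K)) ?_).trans
      (pow_le_pow_right₀ hs1 ?_)
    · have := congrArg (algebraMap (𝓞 K) K) h
      rwa [← Polynomial.aeval_algebraMap_apply, map_zero] at this
    · have : 1 ≤ n ^ 3 * m := Nat.mul_pos (pow_pos (by omega) _) (by omega)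
      rw [mul_assoc]; omega
  obtain ⟨ρ₁, ξ₁, A₁, hρ₁, hA₁, hrel₁, hA₁R, hρ₁R⟩ :=
    exists_mul_eq_mul_pow_of_isSpannedByBounded (by omega) hp hn hH hs hK' (hc ▸ hα₁)
      (hc ▸ hα₁') hy hxy
  obtain ⟨ρ₂, ξ₂, A₂, hρ₂, -, hrel₂, hA₂R, hρ₂R⟩ :=
    exists_mul_eq_mul_pow_of_isSpannedByBounded (by omega) hp hn hH hs hK' (hc ▸ hα₂)
      (hc ▸ hα₂') hy hxy
  rw [← hc] at hrel₁ hrel₂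
  rw [← hn'] at hA₁R hA₂R hρ₁R hρ₂R hK' hn ⊢
  have hexp : ∀ k : ℕ, k ≤ 42 * n ^ 3 * m ^ 2 →
      (s : ℝ) ^ k ≤ Real.exp (42 * (n : ℝ) ^ 3 * m ^ 2 * s) := fun k hk => by
    calc (s : ℝ) ^ k ≤ (s : ℝ) ^ (42 * n ^ 3 * m ^ 2) := pow_le_pow_right₀ hs1 hk
      _ ≤ (Real.exp s) ^ (42 * n ^ 3 * m ^ 2) := by
        gcongr
        linarith [Real.add_one_le_exp (s : ℝ)]
      _ = _ := by rw [← Real.exp_nat_mul]; push_cast; ring_nf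
  have hnm : n ^ 3 * m * 3 ≤ n ^ 3 * m * m := Nat.mul_le_mul_left _ hm
  have hn3 : n * (9 * m * m) ≤ n ^ 3 * m * m := by
    rw [show n ^ 3 * m * m = n * (n * n * m * m) by ring]
    gcongr
    nlinarith
  have hmm : 9 ≤ m * m := by nlinarith
  have hnmm : n * 9 ≤ n * (m * m) := Nat.mul_le_mul_left _ hmm
  have hR2 : 2 ≤ s ^ (14 * n ^ 3 * m) := by
    have : 14 * n ^ 3 * m ≠ 0 := by positivity
    calc 2 ≤ s := by omega
      _ ≤ _ := Nat.le_self_pow this s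
  have key := abs_le_exp_exp_of_sub_mul_eq_mul_pow (R := s ^ (14 * n ^ 3 * m))
    (P := 42 * (n : ℝ) ^ 3 * m ^ 2) (l := s) hm hK' (one_le_pow₀ hs1) hs1 hα hρ₁ hρ₂ hA₁ hrel₁
    hrel₂ hR2 hA₁R hA₂R (by exact_mod_cast hρ₁R) (by exact_mod_cast hρ₂R)
    (by exact_mod_cast hαB α₁ hα₁) (by exact_mod_cast hαB α₂ hα₂)
    (by
      have : n ^ 2 * m ^ 2 ≤ 42 * n ^ 3 * m ^ 2 := by
        refine Nat.mul_le_mul_right _ ?_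
        nlinarith [Nat.pow_le_pow_right (by omega : 0 < n) (by omega : 2 ≤ 3)]
      exact_mod_cast this)
    (by
      push_cast
      rw [← pow_mul, ← pow_add]
      refine hexp _ ?_
      nlinarith)
    (by
      push_cast
      rw [← pow_mul]
      refine hexp _ ?_
      have : 2 * m + 2 ≤ 3 * m := by omega
      calc 14 * n ^ 3 * m * (2 * m + 2) ≤ 14 * n ^ 3 * m * (3 * m) := Nat.mul_le_mul_left _ this
        _ = _ := by ring)
  refine le_trans ?_ key
  push_cast
  rw [abs_mul]
  refine le_mul_of_one_le_left (abs_nonneg _) ?_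
  rw [← Int.cast_abs]
  exact_mod_cast Int.one_le_abs hc0

theorem max_abs_le_exp_exp_of_eval_eq {p : Polynomial ℤ} {s H m : ℕ} (hm : 3 ≤ m) (hp : p ≠ 0)
    (hn : 3 ≤ p.natDegree) (hH : ∀ i, (p.coeff i).natAbs ≤ H) (hs : s = p.natDegree * H)
    {r₁ r₂ : ℂ} (hr : r₁ ≠ r₂)
    (hr₁ : Polynomial.rootMultiplicity r₁ (p.map (Int.castRingHom ℂ)) = 1)
    (hr₂ : Polynomial.rootMultiplicity r₂ (p.map (Int.castRingHom ℂ)) = 1) {x y : ℤ}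
    (hxy : p.eval x = y ^ m) :
    max |(x : ℝ)| |(y : ℝ)| ≤
      Real.exp (Real.exp (2 * (200 * (42 * (p.natDegree : ℝ) ^ 3 * m ^ 2) ^ 4 * s))) := by
  have hc0 : p.leadingCoeff ≠ 0 := Polynomial.leadingCoeff_ne_zero.mpr hp
  have hHR : ∀ i, |(p.coeff i : ℝ)| ≤ H := fun i => by
    rw [← Int.cast_abs, Int.abs_eq_natAbs]
    exact_mod_cast hH i
  have hH1 : (1 : ℝ) ≤ H := by
    exact_mod_cast (Int.natAbs_pos.mpr hc0).trans_le (hH _)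
  have hsR : (s : ℝ) = p.natDegree * H := by rw [hs]; push_cast; rfl
  have hx : |(x : ℝ)| ≤
      Real.exp (Real.exp (200 * (42 * (p.natDegree : ℝ) ^ 3 * m ^ 2) ^ 4 * s)) := by
    rcases eq_or_ne y 0 with rfl | hy
    · rw [zero_pow (by omega)] at hxy
      have h0 : Polynomial.aeval (x : ℂ) p = 0 := by
        rw [← eq_intCast (algebraMap ℤ ℂ), Polynomial.aeval_algebraMap_apply,
          Polynomial.coe_aeval_eq_eval, hxy, map_zero]
      have h1 := Polynomial.norm_le_of_aeval_eq_zero hp (by omega) hHR h0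
      rw [Complex.norm_intCast, ← hsR] at h1
      have hP : (1 : ℝ) ≤ 200 * (42 * (p.natDegree : ℝ) ^ 3 * m ^ 2) ^ 4 := by
        have : 1 ≤ 200 * (42 * p.natDegree ^ 3 * m ^ 2) ^ 4 := Nat.succ_le_of_lt (by positivity)
        exact_mod_cast this
      have h2 : (s : ℝ) ≤ 200 * (42 * (p.natDegree : ℝ) ^ 3 * m ^ 2) ^ 4 * s :=
        le_mul_of_one_le_left (by positivity) hP
      obtain ⟨Q, hQ⟩ : ∃ Q, Q = 200 * (42 * (p.natDegree : ℝ) ^ 3 * m ^ 2) ^ 4 * s := ⟨_, rfl⟩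
      rw [← hQ] at h2 ⊢
      linarith [Real.add_one_le_exp Q, Real.add_one_le_exp (Real.exp Q)]
    · exact abs_le_exp_exp_of_eval_eq hm hp hn hH hs hr hr₁ hr₂ hy hxy
  obtain ⟨n, hn'⟩ : ∃ n, n = p.natDegree := ⟨_, rfl⟩
  rw [← hn'] at hx hsR hn ⊢
  have hn1 : (3 : ℝ) ≤ n := by exact_mod_cast hn
  have hQs : 8 * (s : ℝ) ≤ 200 * (42 * (n : ℝ) ^ 3 * m ^ 2) ^ 4 * s := by
    have : 8 ≤ 200 * (42 * n ^ 3 * m ^ 2) ^ 4 := by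
      have : 0 < (42 * n ^ 3 * m ^ 2) ^ 4 := by positivity
      omega
    gcongr
    exact_mod_cast this
  obtain ⟨Q, hQ⟩ : ∃ Q, Q = 200 * (42 * (n : ℝ) ^ 3 * m ^ 2) ^ 4 * s := ⟨_, rfl⟩
  rw [← hQ] at hx hQs ⊢
  have hns : (n : ℝ) ≤ s := by rw [hsR]; nlinarith
  have hHs : (H : ℝ) ≤ s := by rw [hsR]; nlinarith
  have hQ0 : 0 ≤ Q := by linarith
  have hY1 : 1 ≤ Real.exp (Real.exp Q) := Real.one_le_exp (Real.exp_pos _).le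
  have hle : Real.exp Q ≤ Real.exp (2 * Q) := Real.exp_le_exp.mpr (by linarith)
  refine max_le (hx.trans (Real.exp_le_exp.mpr hle)) ?_
  have h1 : |(y : ℝ)| ^ m ≤ (n + 1 : ℕ) * (H : ℝ) * Real.exp (Real.exp Q) ^ (n + 1) := by
    have hb : ‖(x : ℂ)‖ ≤ Real.exp (Real.exp Q) := by rwa [Complex.norm_intCast]
    have h2 := Polynomial.norm_aeval_le (hn' ▸ Nat.lt_succ_self _ : p.natDegree < n + 1) hHR hY1 hb
    rwa [← eq_intCast (algebraMap ℤ ℂ), Polynomial.aeval_algebraMap_apply,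
      Polynomial.coe_aeval_eq_eval, hxy, eq_intCast, Int.cast_pow, norm_pow,
      Complex.norm_intCast] at h2
  have h3 : |(y : ℝ)| ≤ |(y : ℝ)| ^ m := by
    rcases eq_or_ne y 0 with rfl | hy
    · simp
    · refine le_self_pow₀ ?_ (by omega)
      rw [← Int.cast_abs]
      exact_mod_cast Int.one_le_abs hy
  refine (h3.trans h1).trans ?_
  have h4 : ((n + 1 : ℕ) : ℝ) * H ≤ Real.exp (2 * s) := by
    have := Real.add_one_le_exp (s : ℝ)
    have e : Real.exp (2 * s) = Real.exp s * Real.exp s := by rw [← Real.exp_add]; ring_nf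
    rw [e]
    push_cast
    exact mul_le_mul (by linarith) (by linarith) (by linarith) (by positivity)
  have h5 : Real.exp (Real.exp Q) ^ (n + 1) = Real.exp ((n + 1) * Real.exp Q) := by
    rw [← Real.exp_nat_mul]; push_cast; rfl
  rw [h5]
  refine (mul_le_mul_of_nonneg_right h4 (Real.exp_pos _).le).trans ?_
  rw [← Real.exp_add]
  refine Real.exp_le_exp.mpr ?_
  have e : Real.exp (2 * Q) = Real.exp Q * Real.exp Q := by rw [← Real.exp_add]; ring_nf
  have hE := Real.add_one_le_exp Q
  rw [e]
  have hE1 : (1 : ℝ) ≤ Real.exp Q := by linarith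
  nlinarith

theorem bakerBound_lt {m n H : ℕ} (hm : 3 ≤ m) (hn : 3 ≤ n) (hH : 1 ≤ H) :
    2 * (200 * (42 * (n : ℝ) ^ 3 * m ^ 2) ^ 4 * (n * H : ℕ)) <
      (5 * (m : ℝ)) ^ 10 * ((n : ℝ) ^ (10 * n) * (H : ℝ)) ^ (n ^ 2) := by
  have key : 2 * (200 * (42 * n ^ 3 * m ^ 2) ^ 4 * (n * H)) <
      (5 * m) ^ 10 * (n ^ (10 * n) * H) ^ (n ^ 2) := by
    have h1 : n ^ 30 * H ≤ (n ^ (10 * n) * H) ^ (n ^ 2) := by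
      refine le_trans ?_ (Nat.le_self_pow (by positivity) _)
      gcongr <;> omega
    have h2 : m ^ 8 ≤ m ^ 10 := Nat.pow_le_pow_right (by omega) (by omega)
    have h3 : 3 ^ 17 ≤ n ^ 17 := Nat.pow_le_pow_left hn 17
    calc 2 * (200 * (42 * n ^ 3 * m ^ 2) ^ 4 * (n * H))
        = 400 * 42 ^ 4 * (m ^ 8 * n ^ 13 * H) := by ring
      _ < 5 ^ 10 * 3 ^ 17 * (m ^ 8 * n ^ 13 * H) :=
        Nat.mul_lt_mul_of_pos_right (by norm_num) (by positivity)
      _ ≤ 5 ^ 10 * n ^ 17 * (m ^ 10 * n ^ 13 * H) := by gcongr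
      _ = (5 * m) ^ 10 * (n ^ 30 * H) := by ring
      _ ≤ _ := Nat.mul_le_mul_left _ h1
  exact_mod_cast key

open Polynomial in
theorem coeff_sum_C_mul_X_pow_sub (a : ℕ → ℤ) (n j : ℕ) :
    (∑ i ∈ Finset.range (n + 1), C (a i) * X ^ (n - i)).coeff j =
      if j ≤ n then a (n - j) else 0 := by
  rw [← Finset.sum_range_reflect, finsetSum_coeff]
  have : ∀ i ∈ Finset.range (n + 1), (C (a (n + 1 - 1 - i)) * X ^ (n - (n + 1 - 1 - i))).coeff j =
      if j = i then a (n - i) else 0 := fun i hi => by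
    have hi := Finset.mem_range.mp hi
    rw [coeff_C_mul_X_pow, show n - (n + 1 - 1 - i) = i by omega]
    rfl
  rw [Finset.sum_congr rfl this, Finset.sum_ite_eq]
  simp

end

/-- **Baker's effective bound for superelliptic equations (1969).**
Let `m ≥ 3`, `n ≥ 3` and let `a₀, …, aₙ` be rational integers with `a₀ ≠ 0` such that
the polynomial `a₀ Xⁿ + a₁ X^(n−1) + ⋯ + aₙ` has at least two simple complex zeroes,
and let `H = max {|a₀|, …, |aₙ|}`. Then all rational integers `x`, `y` with
`y^m = a₀ xⁿ + ⋯ + aₙ` satisfy `max {|x|, |y|} < exp(exp((5m)^10 (n^(10n) H)^(n²)))`. -/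
theorem baker_superelliptic_bound (m n : ℕ) (hm : 3 ≤ m) (hn : 3 ≤ n)
    (a : ℕ → ℤ) (ha : a 0 ≠ 0) (p : Polynomial ℤ)
    (hp : p = ∑ i ∈ Finset.range (n + 1), Polynomial.C (a i) * Polynomial.X ^ (n - i))
    (hroots : ∃ r₁ r₂ : ℂ, r₁ ≠ r₂ ∧
      Polynomial.rootMultiplicity r₁ (p.map (Int.castRingHom ℂ)) = 1 ∧
      Polynomial.rootMultiplicity r₂ (p.map (Int.castRingHom ℂ)) = 1)
    (H : ℕ) (hH : H = (Finset.range (n + 1)).sup fun i => (a i).natAbs)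
    (x y : ℤ) (hxy : y ^ m = ∑ i ∈ Finset.range (n + 1), a i * x ^ (n - i)) :
    ((max |x| |y| : ℤ) : ℝ) <
      Real.exp (Real.exp ((5 * (m : ℝ)) ^ 10 * ((n : ℝ) ^ (10 * n) * (H : ℝ)) ^ (n ^ 2))) := by
  obtain ⟨r₁, r₂, hr, hr₁, hr₂⟩ := hroots
  have hcoeff : ∀ j, p.coeff j = if j ≤ n then a (n - j) else 0 := fun j => by
    rw [hp, coeff_sum_C_mul_X_pow_sub]
  have hcn : p.coeff n ≠ 0 := by rw [hcoeff]; simpa using ha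
  have hdeg : p.natDegree = n := by
    refine Polynomial.natDegree_eq_of_le_of_coeff_ne_zero ?_ hcn
    refine Polynomial.natDegree_le_iff_coeff_eq_zero.mpr fun j hj => ?_
    rw [hcoeff, if_neg (by omega)]
  have hp0 : p ≠ 0 := fun h => hcn (by rw [h, Polynomial.coeff_zero])
  have haH : ∀ i ≤ n, (a i).natAbs ≤ H := fun i hi => by
    rw [hH]
    exact Finset.le_sup (f := fun i => (a i).natAbs) (Finset.mem_range.mpr (by omega))
  have hcH : ∀ j, (p.coeff j).natAbs ≤ H := fun j => by
    rw [hcoeff]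
    split_ifs
    · exact haH _ (by omega)
    · simp
  have hH1 : 1 ≤ H := (Int.natAbs_pos.mpr ha).trans_le (haH 0 (by omega))
  have hev : p.eval x = y ^ m := by
    rw [hxy, hp]
    simp [Polynomial.eval_finsetSum]
  have hle := max_abs_le_exp_exp_of_eval_eq hm hp0 (by omega) hcH rfl hr hr₁ hr₂ hev
  rw [hdeg] at hle
  push_cast
  push_cast at hle
  refine hle.trans_lt (Real.exp_lt_exp.mpr (Real.exp_lt_exp.mpr ?_))
  exact_mod_cast bakerBound_lt hm hn hH1
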